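/- Let (Λ,t) ∈ E(r,s). Then (Λ,t) lies in the Kirwan cone 𝒦(r,s) if and only if the following two conditions hold: (1) T(Λ) = r·t; (2) for every d ∈ [r−1] and every s-tuple 𝐉 ∈ Subsets(d,r,s) such that (Γ(𝐉), r−d) ∈ 𝒦(d,s), one has T_𝐉(Λ) ≤ d·t. -/

import Mathlib

open Module

noncomputable section

/-- A complete flag on `ℂ^m`: an increasing family of subspaces with
`dim (F i) = i + 1` (`0`-based indexing, so `F i` is the `i+1`-st step). -/
structure Flagg (m : ℕ) where
  F : Fin m → Submodule ℂ (Fin m → ℂ)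
  mono : Monotone F
  rank_eq : ∀ i : Fin m, finrank ℂ (F i) = (i : ℕ) + 1

/-- An `s`-tuple `J` of (strictly increasing) maps `[d] → [r]` is *intersecting* if
for every `s`-tuple of complete flags on `ℂ^r` the corresponding intersection of
Schubert varieties in the Grassmannian `Gr(d, ℂ^r)` is nonempty. -/
def Intersecting {s d r : ℕ} (J : Fin s → Fin d → Fin r) : Prop :=
  ∀ F : Fin s → Flagg r, ∃ V : Submodule ℂ (Fin r → ℂ), finrank ℂ V = d ∧
    ∀ (l : Fin s) (k : Fin d), (k : ℕ) + 1 ≤ finrank ℂ ↥(V ⊓ (F l).F (J l k))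

/-- `dim I = ∑_j (I(j) - j)`. -/
def dimI {d r : ℕ} (J : Fin d → Fin r) : ℤ := ∑ k, ((J k : ℤ) - (k : ℤ))

/-- Expected dimension of a tuple `J ∈ Subsets(d,r,s)`. -/
def edim {s d r : ℕ} (J : Fin s → Fin d → Fin r) : ℤ :=
  (d : ℤ) * ((r : ℤ) - (d : ℤ)) - ∑ l, ((d : ℤ) * ((r : ℤ) - (d : ℤ)) - dimI (J l))

/-- `dim` for raw `ℕ`-valued increasing sequences. -/
def dimN {d : ℕ} (f : Fin d → ℕ) : ℤ := ∑ k, ((f k : ℤ) - (k : ℤ))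

/-- Expected dimension for raw `ℕ`-valued tuples, with ambient dimension `n` explicit. -/
def edimN {s d : ℕ} (n : ℕ) (f : Fin s → Fin d → ℕ) : ℤ :=
  (d : ℤ) * ((n : ℤ) - (d : ℤ)) - ∑ l, ((d : ℤ) * ((n : ℤ) - (d : ℤ)) - dimN (f l))

/-- `T(Λ) = ∑_l ∑_j Λ_l(j)`. -/
def TT {s r : ℕ} (Λ : Fin s → Fin r → ℝ) : ℝ := ∑ l, ∑ j, Λ l j

/-- `T_J(Λ) = ∑_l ∑_{j ∈ J_l} Λ_l(j)`. -/
def TJ {s d r : ℕ} (J : Fin s → Fin d → Fin r) (Λ : Fin s → Fin r → ℝ) : ℝ :=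
  ∑ l, ∑ k, Λ l (J l k)

/-- `Γ(J)_l(k) = k - J_l(k) + (r - d)`, a weakly decreasing real `d`-tuple. -/
def GammaT {s d r : ℕ} (J : Fin s → Fin d → Fin r) : Fin s → Fin d → ℝ :=
  fun l k => (k : ℝ) - (J l k : ℝ) + ((r : ℝ) - (d : ℝ))

/-- Membership of `(Λ, t)` in the Kirwan cone `𝒦(r,s)`: each `Λ_l` is weakly
decreasing and there are Hermitian matrices `A_1, …, A_s` summing to `t·I_r`
whose decreasingly-ordered spectra are the `Λ_l`. -/
def KirwanMem {s r : ℕ} (Λ : Fin s → Fin r → ℝ) (t : ℝ) : Prop :=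
  (∀ l, Antitone (Λ l)) ∧
  ∃ (A : Fin s → Matrix (Fin r) (Fin r) ℂ) (hA : ∀ l, (A l).IsHermitian),
    (∑ l, A l) = (t : ℂ) • (1 : Matrix (Fin r) (Fin r) ℂ) ∧
    ∀ l, ∃ e : Equiv.Perm (Fin r), ∀ i, Λ l i = (hA l).eigenvalues (e i)

/-- The subspace of a flag with `k` elements (so `flagAt G 0 = ⊥`). -/
def flagAt {m : ℕ} (G : Flagg m) : ℕ → Submodule ℂ (Fin m → ℂ)
  | 0 => ⊥
  | (k + 1) => if h : k < m then G.F ⟨k, h⟩ else ⊤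

/-- The space `ℒ_I(F,G)` of linear maps `φ : ℂ^r → ℂ^q` with
`φ(F_l(j)) ⊆ G_l(I_l(j) - j)` for all `l, j`. -/
def LSpace {s r q : ℕ} (I : Fin s → Fin r → ℕ) (F : Fin s → Flagg r) (G : Fin s → Flagg q) :
    Submodule ℂ ((Fin r → ℂ) →ₗ[ℂ] (Fin q → ℂ)) where
  carrier := {φ | ∀ (l : Fin s) (j : Fin r), ∀ v ∈ (F l).F j,
    φ v ∈ flagAt (G l) (I l j - (j : ℕ))}
  add_mem' := by
    intro a b ha hb l j v hv
    simpa using add_mem (ha l j v hv) (hb l j v hv)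
  zero_mem' := by
    intro l j v hv
    simp
  smul_mem' := by
    intro c a ha l j v hv
    simpa using Submodule.smul_mem _ c (ha l j v hv)

/-- The true dimension `tdim I`, for a raw tuple `I ∈ Subsets(r, r + q, s)`
(here `q = n - r`). -/
def tdim {s : ℕ} (r q : ℕ) (I : Fin s → Fin r → ℕ) : ℕ :=
  sInf {m : ℕ | ∃ (F : Fin s → Flagg r) (G : Fin s → Flagg q), finrank ℂ (LSpace I F G) = m}

/-- The kernel dimension `kdim I`. -/
def kdim {s : ℕ} (r q : ℕ) (I : Fin s → Fin r → ℕ) : ℕ :=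
  sInf {m : ℕ | ∃ (F : Fin s → Flagg r) (G : Fin s → Flagg q)
      (φ : (Fin r → ℂ) →ₗ[ℂ] (Fin q → ℂ)), φ ∈ LSpace I F G ∧
      finrank ℂ (LSpace I F G) = tdim r q I ∧ finrank ℂ (LinearMap.ker φ) = m}

/-- The (`0`-based) Schubert position of a subspace `W` w.r.t. a flag:
`posN Fl W k` is the least `j` with `dim (Fl(j) ⊓ W) = k + 1`. -/
def posN {m : ℕ} (Fl : Flagg m) (W : Submodule ℂ (Fin m → ℂ)) (k : ℕ) : ℕ :=
  sInf {j : ℕ | ∃ h : j < m, finrank ℂ ↥(Fl.F ⟨j, h⟩ ⊓ W) = k + 1}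

/-- The (`0`-based, `ℕ`-valued) kernel position `kPos(I)_l(k)`. -/
def kPosFun {s : ℕ} (r q : ℕ) (I : Fin s → Fin r → ℕ) (l : Fin s) (k : ℕ) : ℕ :=
  sInf {p : ℕ | ∃ (F : Fin s → Flagg r) (G : Fin s → Flagg q)
      (φ : (Fin r → ℂ) →ₗ[ℂ] (Fin q → ℂ)), φ ∈ LSpace I F G ∧
      finrank ℂ (LSpace I F G) = tdim r q I ∧
      finrank ℂ (LinearMap.ker φ) = kdim r q I ∧ posN (F l) (LinearMap.ker φ) k = p}

/-- Apply an `r`-tuple of reals at a natural index (junk value `0` out of range). -/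
def applyI {r : ℕ} (f : Fin r → ℝ) (j : ℕ) : ℝ := if h : j < r then f ⟨j, h⟩ else 0

/-- Apply an `r`-tuple of naturals at a natural index (junk value `0` out of range). -/
def applyN {r : ℕ} (f : Fin r → ℕ) (j : ℕ) : ℕ := if h : j < r then f ⟨j, h⟩ else 0

/-- The slope `slope_θ(J) = (1/d) ∑_l ∑_{j ∈ J_l} θ_l(j)` of a tuple. -/
def slopeT {s d r : ℕ} (θ : Fin s → Fin r → ℝ) (J : Fin s → Fin d → Fin r) : ℝ :=
  ((d : ℝ))⁻¹ * ∑ l, ∑ k, θ l (J l k)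

/-- The slope `slope_θ(W, F) = slope_θ(Pos(W, F))` of a (nonzero) subspace. -/
def slopeW {s r : ℕ} (θ : Fin s → Fin r → ℝ) (F : Fin s → Flagg r)
    (W : Submodule ℂ (Fin r → ℂ)) : ℝ :=
  ((finrank ℂ W : ℝ))⁻¹ * ∑ l, ∑ k ∈ Finset.range (finrank ℂ W), applyI (θ l) (posN (F l) W k)

end
section Part1
open Module Matrix Topology Filter
set_option linter.unusedSectionVars false
set_option linter.unusedSimpArgs false
set_option linter.unusedVariables false

section AbsLin
variable {E F : Type*} [AddCommGroup E] [Module ℂ E] [AddCommGroup F] [Module ℂ F]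
  [FiniteDimensional ℂ E] [FiniteDimensional ℂ F]

lemma rank_witness (T : E →ₗ[ℂ] F) (n : ℕ) (h : n ≤ finrank ℂ (LinearMap.range T)) :
    ∃ (v : Fin n → E) (ψ : F →ₗ[ℂ] (Fin n → ℂ)),
      (Matrix.of fun i j => ψ (T (v i)) j).det ≠ 0 := by
  obtain ⟨f, hf⟩ := exists_linearIndependent_of_le_finrank h
  have hf' : LinearIndependent ℂ (fun i => (f i : F)) :=
    hf.map' (LinearMap.range T).subtype (Submodule.ker_subtype _)
  choose v hv using fun i => (f i).2
  let g : (Fin n → ℂ) →ₗ[ℂ] F := Fintype.linearCombination ℂ (fun i => (f i : F))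
  have hg : LinearMap.ker g = ⊥ := by
    rw [LinearMap.ker_eq_bot]
    exact linearIndependent_iff_injective_fintypeLinearCombination.1 hf'
  obtain ⟨ψ, hψ⟩ := LinearMap.exists_leftInverse_of_injective g hg
  refine ⟨v, ψ, ?_⟩
  have : (Matrix.of fun i j => ψ (T (v i)) j) = 1 := by
    ext i j
    have h1 : g (Pi.single i 1) = (f i : F) := by
      simp [g, Fintype.linearCombination_apply_single]
    have h2 := congrArg (fun L => L (Pi.single i 1)) hψ
    simp only [LinearMap.comp_apply, LinearMap.id_apply, h1] at h2
    simp only [Matrix.of_apply, hv, h2, Matrix.one_apply, Pi.single_apply, eq_comm]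
  rw [this]; simp

lemma rank_of_det (T : E →ₗ[ℂ] F) (n : ℕ) (v : Fin n → E) (ψ : F →ₗ[ℂ] (Fin n → ℂ))
    (h : (Matrix.of fun i j => ψ (T (v i)) j).det ≠ 0) :
    n ≤ finrank ℂ (LinearMap.range T) := by
  have h1 : LinearIndependent ℂ (fun i => ψ (T (v i))) :=
    Matrix.linearIndependent_rows_of_det_ne_zero h
  have h2 : LinearIndependent ℂ (fun i => T (v i)) := LinearIndependent.of_comp ψ h1
  have h3 : LinearIndependent ℂ (fun i => (⟨T (v i), ⟨_, rfl⟩⟩ : LinearMap.range T)) :=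
    LinearIndependent.of_comp (LinearMap.range T).subtype h2
  simpa using h3.fintype_card_le_finrank

lemma isOpen_rank {Z : Type*} [TopologicalSpace Z] [TopologicalSpace F] [IsTopologicalAddGroup F]
    [ContinuousSMul ℂ F] [T2Space F] (T : Z → E →ₗ[ℂ] F) (hT : ∀ v, Continuous fun z => T z v)
    (n : ℕ) : IsOpen {z | n ≤ finrank ℂ (LinearMap.range (T z))} := by
  rw [isOpen_iff_mem_nhds]
  intro z hz
  obtain ⟨v, ψ, hd⟩ := rank_witness (T z) n hz
  have hψ : Continuous ψ := LinearMap.continuous_of_finiteDimensional ψ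
  have hc : Continuous fun z => (Matrix.of fun i j => ψ (T z (v i)) j).det := by
    apply Continuous.matrix_det
    apply continuous_matrix
    intro i j
    exact (continuous_apply j).comp (hψ.comp (hT _))
  filter_upwards [hc.continuousAt.eventually_ne hd] with z' hz'
  exact rank_of_det _ n v ψ hz'

lemma rank_line (T0 T1 T2 : E →ₗ[ℂ] F) (n : ℕ)
    (h : n ≤ finrank ℂ (LinearMap.range (T0 + T1 + T2))) :
    ∀ᶠ w : ℂ in 𝓝[≠] 0, n ≤ finrank ℂ (LinearMap.range (T0 + w • T1 + w ^ 2 • T2)) := by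
  obtain ⟨v, ψ, hd⟩ := rank_witness _ n h
  let P : Matrix (Fin n) (Fin n) (Polynomial ℂ) := Matrix.of fun i j =>
    Polynomial.C (ψ (T0 (v i)) j) + Polynomial.X * Polynomial.C (ψ (T1 (v i)) j)
      + Polynomial.X ^ 2 * Polynomial.C (ψ (T2 (v i)) j)
  have hP : ∀ w : ℂ, P.det.eval w
      = (Matrix.of fun i j => ψ ((T0 + w • T1 + w ^ 2 • T2) (v i)) j).det := by
    intro w
    rw [← Polynomial.coe_evalRingHom, RingHom.map_det]
    congr 1
    ext i j
    simp [P]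
    ring
  have hne : P.det ≠ 0 := by
    intro h0
    have := hP 1
    rw [h0] at this
    simp only [one_smul, one_pow] at this
    exact hd (by simpa using this.symm)
  have hfin : {w : ℂ | P.det.IsRoot w}.Finite := Polynomial.finite_setOfPred_isRoot hne
  have hc : ({w : ℂ | P.det.IsRoot w} \ {0})ᶜ ∈ 𝓝 (0:ℂ) := by
    apply (hfin.subset Set.sdiff_subset).isClosed.isOpen_compl.mem_nhds
    simp
  filter_upwards [nhdsWithin_le_nhds hc, self_mem_nhdsWithin] with w hw hw0
  apply rank_of_det _ n v ψ
  rw [← hP]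
  intro h0
  exact hw ⟨h0, hw0⟩

lemma rank_deriv (T0 T1 : E →ₗ[ℂ] F)
    (h : ∀ w : ℂ, finrank ℂ (LinearMap.range (T0 + w • T1)) ≤ finrank ℂ (LinearMap.range T0))
    (X : E) (hX : T0 X = 0) : T1 X ∈ LinearMap.range T0 := by
  by_contra hn
  let n := finrank ℂ (LinearMap.range T0)
  let S : ℂ → (E × ℂ) →ₗ[ℂ] F := fun w =>
    LinearMap.coprod (T0 + w • T1) (LinearMap.toSpanSingleton ℂ F (T1 X))
  have hS0 : n + 1 ≤ finrank ℂ (LinearMap.range (S 0)) := by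
    have hlt : LinearMap.range T0 < LinearMap.range (S 0) := by
      refine lt_of_le_of_ne ?_ ?_
      · rintro _ ⟨v, rfl⟩
        exact ⟨(v, 0), by simp [S]⟩
      · intro he
        apply hn
        rw [he]
        exact ⟨(0, 1), by simp [S]⟩
    exact Submodule.finrank_lt_finrank_of_lt hlt
  obtain ⟨v, ψ, hd⟩ := rank_witness _ _ hS0
  have hc : Continuous fun w => (Matrix.of fun i j => ψ (S w (v i)) j).det := by
    apply Continuous.matrix_det
    apply continuous_matrix
    intro i j
    simp only [S, LinearMap.coprod_apply, LinearMap.add_apply, LinearMap.smul_apply, map_add,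
      map_smul, Matrix.of_apply, Pi.add_apply, Pi.smul_apply]
    fun_prop
  have hev := (hc.continuousAt (x := (0:ℂ))).eventually_ne hd
  have hev2 : ∀ᶠ w : ℂ in 𝓝[≠] 0, (Matrix.of fun i j => ψ (S w (v i)) j).det ≠ 0 ∧ w ≠ 0 :=
    (hev.filter_mono nhdsWithin_le_nhds).and self_mem_nhdsWithin
  obtain ⟨w, hw, hw0⟩ := hev2.exists
  have h1 := rank_of_det _ _ v ψ hw
  have h2 : LinearMap.range (S w) ≤ LinearMap.range (T0 + w • T1) := by
    rintro _ ⟨⟨x, c⟩, rfl⟩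
    refine ⟨x + (c * w⁻¹) • X, ?_⟩
    have : w * (c * w⁻¹) = c := by field_simp
    simp [S, hX, smul_smul, this, add_assoc]
  have h3 := Submodule.finrank_mono h2
  have h4 := h w
  omega
end AbsLin
end Part1

section Part2
open Module Matrix Topology Filter
set_option linter.unusedSectionVars false
set_option linter.unusedSimpArgs false
set_option linter.unusedVariables false

section Core
variable {s d q : ℕ}

/-- tuples of matrices with the staircase support condition -/
def Xsp (q : ℕ) (θ : Fin s → Fin d → ℕ) : Submodule ℂ (Fin s → Matrix (Fin d) (Fin q) ℂ) where
  carrier := {X | ∀ l j (c : Fin q), θ l j ≤ (c : ℕ) → X l j c = 0}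
  add_mem' := by
    intro x y hx hy l j c h
    simp [hx l j c h, hy l j c h]
  zero_mem' := by intro l j c h; rfl
  smul_mem' := by
    intro k x hx l j c h
    simp [hx l j c h]

lemma mem_Xsp {θ : Fin s → Fin d → ℕ} {X : Fin s → Matrix (Fin d) (Fin q) ℂ} :
    X ∈ Xsp q θ ↔ ∀ l j (c : Fin q), θ l j ≤ (c : ℕ) → X l j c = 0 := Iff.rfl

def Mmap (a : Fin s → Matrix (Fin d) (Fin d) ℂ) (b : Fin s → Matrix (Fin q) (Fin q) ℂ) :
    (Fin s → Matrix (Fin d) (Fin q) ℂ) →ₗ[ℂ] Matrix (Fin d) (Fin q) ℂ where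
  toFun X := ∑ l, a l * X l * b l
  map_add' x y := by
    simp [Matrix.mul_add, Matrix.add_mul, Finset.sum_add_distrib]
  map_smul' k x := by
    simp [Finset.smul_sum]

lemma Mmap_apply (a : Fin s → Matrix (Fin d) (Fin d) ℂ) (b : Fin s → Matrix (Fin q) (Fin q) ℂ)
    (X) : Mmap a b X = ∑ l, a l * X l * b l := rfl

def Mr (θ : Fin s → Fin d → ℕ)
    (a : Fin s → Matrix (Fin d) (Fin d) ℂ) (b : Fin s → Matrix (Fin q) (Fin q) ℂ) :
    Xsp q θ →ₗ[ℂ] Matrix (Fin d) (Fin q) ℂ := (Mmap a b).domRestrict (Xsp q θ)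

lemma Mr_apply (θ : Fin s → Fin d → ℕ)
    (a : Fin s → Matrix (Fin d) (Fin d) ℂ) (b : Fin s → Matrix (Fin q) (Fin q) ℂ)
    (X : Xsp q θ) : Mr θ a b X = ∑ l, a l * X.1 l * b l := rfl

noncomputable def nul (θ : Fin s → Fin d → ℕ)
    (a : Fin s → Matrix (Fin d) (Fin d) ℂ) (b : Fin s → Matrix (Fin q) (Fin q) ℂ) : ℕ :=
  finrank ℂ (LinearMap.ker (Mr θ a b))

/-- generic nullity -/
noncomputable def mc (q : ℕ) (θ : Fin s → Fin d → ℕ) : ℕ :=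
  sInf {m | ∃ (a : Fin s → Matrix (Fin d) (Fin d) ℂ) (b : Fin s → Matrix (Fin q) (Fin q) ℂ),
    nul θ a b = m}

lemma mc_le (θ : Fin s → Fin d → ℕ)
    (a : Fin s → Matrix (Fin d) (Fin d) ℂ) (b : Fin s → Matrix (Fin q) (Fin q) ℂ) :
    mc q θ ≤ nul θ a b := Nat.sInf_le ⟨a, b, rfl⟩

lemma exists_mc (q : ℕ) (θ : Fin s → Fin d → ℕ) :
    ∃ (a : Fin s → Matrix (Fin d) (Fin d) ℂ) (b : Fin s → Matrix (Fin q) (Fin q) ℂ),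
    nul θ a b = mc q θ :=
  Nat.sInf_mem (s := {m | ∃ (a : Fin s → Matrix (Fin d) (Fin d) ℂ)
    (b : Fin s → Matrix (Fin q) (Fin q) ℂ), nul θ a b = m}) ⟨_, 0, 0, rfl⟩

lemma rank_add_nul (θ : Fin s → Fin d → ℕ)
    (a : Fin s → Matrix (Fin d) (Fin d) ℂ) (b : Fin s → Matrix (Fin q) (Fin q) ℂ) :
    finrank ℂ (LinearMap.range (Mr θ a b)) + nul θ a b = finrank ℂ (Xsp q θ) :=
  LinearMap.finrank_range_add_finrank_ker _

lemma nul_eq_zero_iff (θ : Fin s → Fin d → ℕ)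
    (a : Fin s → Matrix (Fin d) (Fin d) ℂ) (b : Fin s → Matrix (Fin q) (Fin q) ℂ) :
    nul θ a b = 0 ↔ ∀ X ∈ Xsp q θ, ∑ l, a l * X l * b l = 0 → X = 0 := by
  rw [nul, Submodule.finrank_eq_zero, LinearMap.ker_eq_bot']
  constructor
  · intro h X hX h0
    exact congrArg Subtype.val (h ⟨X, hX⟩ h0)
  · rintro h ⟨X, hX⟩ h0
    exact Subtype.ext (h X hX h0)

/-! dimension of `Xsp` -/
def XspEquiv (θ : Fin s → Fin d → ℕ) :
    Xsp q θ ≃ₗ[ℂ] ({p : Fin s × Fin d × Fin q // (p.2.2 : ℕ) < θ p.1 p.2.1} → ℂ) where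
  toFun X p := X.1 p.1.1 p.1.2.1 p.1.2.2
  map_add' x y := by ext p; simp
  map_smul' k x := by ext p; simp
  invFun f := ⟨fun l => Matrix.of fun j c => if h : (c : ℕ) < θ l j then f ⟨(l, j, c), h⟩ else 0, by
    intro l j c h
    simp [not_lt.2 h]⟩
  left_inv X := by
    apply Subtype.ext
    ext l j c
    by_cases h : (c : ℕ) < θ l j
    · simp [h]
    · simp [h, X.2 l j c (not_lt.1 h)]
  right_inv f := by
    ext p
    obtain ⟨⟨l, j, c⟩, h⟩ := p
    simp only at h
    simp [h]

lemma finrank_Xsp (θ : Fin s → Fin d → ℕ) (hθ : ∀ l j, θ l j ≤ q) :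
    finrank ℂ (Xsp q θ) = ∑ l, ∑ j, θ l j := by
  rw [(XspEquiv θ).finrank_eq, Module.finrank_fintype_fun_eq_card, Fintype.card_subtype]
  have : (Finset.univ.filter fun p : Fin s × Fin d × Fin q => (p.2.2 : ℕ) < θ p.1 p.2.1).card
      = ∑ l, ∑ j, ∑ c : Fin q, if (c : ℕ) < θ l j then 1 else 0 := by
    rw [Finset.card_filter, Fintype.sum_prod_type]
    simp only [Fintype.sum_prod_type]
  rw [this]
  refine Finset.sum_congr rfl fun l _ => Finset.sum_congr rfl fun j _ => ?_
  rw [← Finset.card_filter, Fin.card_filter_val_lt, min_eq_right (hθ l j)]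

/-! trace pairing -/
noncomputable def tp (d q : ℕ) : Matrix (Fin q) (Fin d) ℂ →ₗ[ℂ] Dual ℂ (Matrix (Fin d) (Fin q) ℂ) :=
  LinearMap.mk₂ ℂ (fun φ Y => Matrix.trace (φ * Y))
    (by intros; simp [Matrix.add_mul]) (by intros; simp) (by intros; simp [Matrix.mul_add])
    (by intros; simp)

lemma tp_apply (φ : Matrix (Fin q) (Fin d) ℂ) (Y) : tp d q φ Y = Matrix.trace (φ * Y) := rfl

lemma trace_mul_single (φ : Matrix (Fin q) (Fin d) ℂ) (j : Fin d) (c : Fin q) (z : ℂ) :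
    Matrix.trace (φ * Matrix.single j c z) = φ c j * z := by
  simp [Matrix.trace_mul_single]

lemma tp_inj : Function.Injective (tp d q) := by
  rw [injective_iff_map_eq_zero]
  intro φ h
  ext c j
  have := congrArg (fun f => f (Matrix.single j c (1:ℂ))) h
  simpa [tp_apply, Matrix.trace_mul_single] using this

lemma tp_surj : Function.Surjective (tp d q) := by
  have h : finrank ℂ (Matrix (Fin q) (Fin d) ℂ) = finrank ℂ (Dual ℂ (Matrix (Fin d) (Fin q) ℂ)) := by
    rw [Subspace.dual_finrank_eq]; simp [Module.finrank_matrix, mul_comm]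
  exact (LinearMap.injective_iff_surjective_of_finrank_eq_finrank h).1 tp_inj

def Hsp (θ : Fin s → Fin d → ℕ)
    (a : Fin s → Matrix (Fin d) (Fin d) ℂ) (b : Fin s → Matrix (Fin q) (Fin q) ℂ) :
    Submodule ℂ (Matrix (Fin q) (Fin d) ℂ) where
  carrier := {φ | ∀ l j (c : Fin q), (c : ℕ) < θ l j → (b l * φ * a l) c j = 0}
  add_mem' := by
    intro x y hx hy l j c h
    simp [Matrix.mul_add, Matrix.add_mul, hx l j c h, hy l j c h]
  zero_mem' := by intro l j c h; simp
  smul_mem' := by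
    intro k x hx l j c h
    simp [hx l j c h]

lemma mem_Hsp {θ : Fin s → Fin d → ℕ}
    {a : Fin s → Matrix (Fin d) (Fin d) ℂ} {b : Fin s → Matrix (Fin q) (Fin q) ℂ} {φ} :
    φ ∈ Hsp θ a b ↔ ∀ l j (c : Fin q), (c : ℕ) < θ l j → (b l * φ * a l) c j = 0 := Iff.rfl

lemma trace_pair (φ : Matrix (Fin q) (Fin d) ℂ)
    (a : Fin s → Matrix (Fin d) (Fin d) ℂ) (b : Fin s → Matrix (Fin q) (Fin q) ℂ)
    (X : Fin s → Matrix (Fin d) (Fin q) ℂ) :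
    Matrix.trace (φ * ∑ l, a l * X l * b l) = ∑ l, ∑ c, ∑ j, (b l * φ * a l) c j * X l j c := by
  rw [Matrix.mul_sum, Matrix.trace_sum]
  refine Finset.sum_congr rfl fun l _ => ?_
  have : Matrix.trace (φ * (a l * X l * b l)) = Matrix.trace ((b l * φ * a l) * X l) := by
    rw [← Matrix.mul_assoc, Matrix.trace_mul_comm]
    simp only [Matrix.mul_assoc]
  rw [this]
  simp [Matrix.trace, Matrix.mul_apply]

/-- elementary element of `Xsp` -/
lemma single_mem_Xsp (θ : Fin s → Fin d → ℕ) (l : Fin s) (j : Fin d) (c : Fin q)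
    (h : (c : ℕ) < θ l j) : (Pi.single l (Matrix.single j c (1:ℂ)) : Fin s → Matrix (Fin d) (Fin q) ℂ)
      ∈ Xsp q θ := by
  intro l' j' c' h'
  by_cases hl : l' = l
  · subst hl
    simp only [Pi.single_eq_same, Matrix.single_apply]
    rw [if_neg]
    rintro ⟨rfl, rfl⟩
    omega
  · simp [hl]

lemma trace_pair_single (g : Fin s → Matrix (Fin q) (Fin d) ℂ) (l : Fin s) (j : Fin d) (c : Fin q) :
    ∑ l', ∑ c', ∑ j', g l' c' j' *
      (Pi.single l (Matrix.single j c (1:ℂ)) : Fin s → Matrix (Fin d) (Fin q) ℂ) l' j' c' = g l c j := by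
  rw [Finset.sum_eq_single l, Finset.sum_eq_single c, Finset.sum_eq_single j]
  · simp
  · intro j' _ hj; simp [Matrix.single_apply, Ne.symm hj]
  · simp
  · intro c' _ hc; simp [Matrix.single_apply, Ne.symm hc]
  · simp
  · intro l' _ hl; simp [hl]
  · simp

lemma mem_Hsp_iff_trace {θ : Fin s → Fin d → ℕ}
    {a : Fin s → Matrix (Fin d) (Fin d) ℂ} {b : Fin s → Matrix (Fin q) (Fin q) ℂ} {φ} :
    φ ∈ Hsp θ a b ↔ ∀ X : Xsp q θ, Matrix.trace (φ * Mr θ a b X) = 0 := by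
  constructor
  · intro h X
    rw [Mr_apply, trace_pair]
    refine Finset.sum_eq_zero fun l _ => Finset.sum_eq_zero fun c _ => Finset.sum_eq_zero fun j _ => ?_
    by_cases hc : (c : ℕ) < θ l j
    · rw [h l j c hc, zero_mul]
    · rw [X.2 l j c (not_lt.1 hc), mul_zero]
  · intro h l j c hc
    have := h ⟨_, single_mem_Xsp θ l j c hc⟩
    rw [Mr_apply, trace_pair] at this
    simpa [trace_pair_single (fun l => b l * φ * a l)] using this

lemma dim_formula (θ : Fin s → Fin d → ℕ) (hθ : ∀ l j, θ l j ≤ q)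
    (a : Fin s → Matrix (Fin d) (Fin d) ℂ) (b : Fin s → Matrix (Fin q) (Fin q) ℂ) :
    nul θ a b + q * d = finrank ℂ (Hsp θ a b) + ∑ l, ∑ j, θ l j := by
  have h1 := rank_add_nul θ a b
  rw [finrank_Xsp θ hθ] at h1
  have h2 := Subspace.finrank_add_finrank_dualAnnihilator_eq (LinearMap.range (Mr θ a b))
  have h3 : finrank ℂ (Hsp θ a b) = finrank ℂ (LinearMap.range (Mr θ a b)).dualAnnihilator := by
    let e := LinearEquiv.ofBijective (tp d q) ⟨tp_inj, tp_surj⟩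
    have : Hsp θ a b = ((LinearMap.range (Mr θ a b)).dualAnnihilator).comap (e : _ →ₗ[ℂ] _) := by
      ext φ
      rw [mem_Hsp_iff_trace, Submodule.mem_comap, Submodule.mem_dualAnnihilator]
      constructor
      · rintro h _ ⟨X, rfl⟩
        exact h X
      · intro h X
        exact h _ ⟨X, rfl⟩
    rw [this]
    exact (LinearEquiv.finrank_eq (e.submoduleMap _)).trans (by
      rw [Submodule.map_comap_eq_of_surjective e.surjective])
  rw [Module.finrank_matrix] at h2
  simp at h2
  rw [mul_comm q d]
  omega

lemma duality (θ : Fin s → Fin d → ℕ)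
    (a : Fin s → Matrix (Fin d) (Fin d) ℂ) (b : Fin s → Matrix (Fin q) (Fin q) ℂ)
    (h : nul θ a b = 0) (m : Fin s → Matrix (Fin q) (Fin d) ℂ) :
    ∃ φ : Matrix (Fin q) (Fin d) ℂ, ∀ l j (c : Fin q), (c : ℕ) < θ l j →
      (b l * φ * a l) c j = m l c j := by
  have hk : LinearMap.ker (Mr θ a b) = ⊥ := by
    rwa [nul, Submodule.finrank_eq_zero] at h
  obtain ⟨g, hg⟩ := LinearMap.exists_leftInverse_of_injective _ hk
  let f : Xsp q θ →ₗ[ℂ] ℂ :=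
    { toFun := fun X => ∑ l, ∑ c, ∑ j, m l c j * X.1 l j c
      map_add' := by intro x y; simp [mul_add, Finset.sum_add_distrib]
      map_smul' := by intro k x; simp [Finset.mul_sum, mul_left_comm] }
  obtain ⟨φ, hφ⟩ := tp_surj (f ∘ₗ g)
  refine ⟨φ, fun l j c hc => ?_⟩
  have h1 := congrArg (fun F => F (Mr θ a b ⟨_, single_mem_Xsp θ l j c hc⟩)) hφ
  have h2 := congrArg (fun F => F ⟨_, single_mem_Xsp θ l j c hc⟩) hg
  simp only [LinearMap.comp_apply, LinearMap.id_apply] at h1 h2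
  rw [h2, tp_apply, Mr_apply, trace_pair] at h1
  simpa [f, trace_pair_single (fun l => b l * φ * a l), trace_pair_single m] using h1

lemma B1 (θ : Fin s → Fin d → ℕ)
    (a : Fin s → Matrix (Fin d) (Fin d) ℂ) (b : Fin s → Matrix (Fin q) (Fin q) ℂ)
    (h : nul θ a b = mc q θ) (φ) (hφ : φ ∈ Hsp θ a b) (X) (hX : X ∈ Xsp q θ)
    (h0 : ∑ l, a l * X l * b l = 0) (l : Fin s) : φ * a l * X l = 0 := by
  have key : ∀ γ : Matrix (Fin q) (Fin q) ℂ, Matrix.trace (φ * a l * X l * γ) = 0 := by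
    intro γ
    let g : Fin s → Matrix (Fin q) (Fin q) ℂ := Pi.single l γ
    have hlin : ∀ w : ℂ, Mr θ a b + w • Mr θ a g = Mr θ a (b + w • g) := by
      intro w
      ext1 Y
      simp only [LinearMap.add_apply, LinearMap.smul_apply, Mr_apply, Pi.add_apply, Pi.smul_apply,
        Matrix.mul_add, Finset.sum_add_distrib, Matrix.mul_smul, Finset.smul_sum]
    have hr := rank_deriv (Mr θ a b) (Mr θ a g) (by
      intro w
      rw [hlin]
      have h1 := rank_add_nul θ a b
      have h2 := rank_add_nul θ a (b + w • g)
      have h3 := mc_le θ a (b + w • g)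
      omega) ⟨X, hX⟩ (by rw [Mr_apply]; exact h0)
    obtain ⟨Y, hY⟩ := hr
    have h4 := mem_Hsp_iff_trace.1 hφ Y
    rw [hY, Mr_apply, Finset.sum_eq_single l] at h4
    · simpa [Matrix.mul_assoc, g] using h4
    · intro l' _ hl; simp [hl, g]
    · simp
  have : tp _ _ (φ * a l * X l) = 0 := by
    ext γ
    simp only [tp_apply, key]; simp
  exact (injective_iff_map_eq_zero _).1 tp_inj _ this

/-! topology -/
lemma dense_of_line {V : Type*} [AddCommGroup V] [Module ℂ V] [TopologicalSpace V]
    [ContinuousAdd V] [ContinuousSMul ℂ V] (S : Set V)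
    (h : ∀ x, ∃ δ : V, ∀ᶠ w : ℂ in 𝓝[≠] 0, x + w • δ ∈ S) : Dense S := by
  intro x
  obtain ⟨δ, hδ⟩ := h x
  refine mem_closure_of_tendsto (f := fun w : ℂ => x + w • δ) (b := 𝓝[≠] 0) ?_ hδ
  have : Continuous fun w : ℂ => x + w • δ := by fun_prop
  have h2 := this.tendsto 0
  simp only [zero_smul, add_zero] at h2
  exact h2.mono_left nhdsWithin_le_nhds

lemma nul_le_iff (θ : Fin s → Fin d → ℕ)
    (a : Fin s → Matrix (Fin d) (Fin d) ℂ) (b : Fin s → Matrix (Fin q) (Fin q) ℂ) (m : ℕ) :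
    nul θ a b ≤ m ↔ finrank ℂ (Xsp q θ) - m ≤ finrank ℂ (LinearMap.range (Mr θ a b)) := by
  have := rank_add_nul θ a b
  omega

lemma isOpen_nul (θ : Fin s → Fin d → ℕ) (m : ℕ) :
    IsOpen {p : (Fin s → Matrix (Fin d) (Fin d) ℂ) × (Fin s → Matrix (Fin q) (Fin q) ℂ) |
      nul θ p.1 p.2 ≤ m} := by
  simp only [nul_le_iff]
  apply isOpen_rank (fun p : (Fin s → Matrix (Fin d) (Fin d) ℂ) × (Fin s → Matrix (Fin q) (Fin q) ℂ)
    => Mr θ p.1 p.2)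
  intro X
  simp only [Mr_apply]
  fun_prop

lemma Mr_expand (θ : Fin s → Fin d → ℕ)
    (a a' : Fin s → Matrix (Fin d) (Fin d) ℂ) (b b' : Fin s → Matrix (Fin q) (Fin q) ℂ) (w : ℂ) :
    Mr θ (a + w • a') (b + w • b') =
      Mr θ a b + w • (Mr θ a' b + Mr θ a b') + w ^ 2 • Mr θ a' b' := by
  ext1 X
  simp only [LinearMap.add_apply, LinearMap.smul_apply, Mr_apply, Pi.add_apply, Pi.smul_apply,
        Matrix.mul_add, Matrix.add_mul, Finset.sum_add_distrib, Matrix.mul_smul, Matrix.smul_mul,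
        ← Finset.smul_sum, smul_add, smul_smul, pow_two]
  abel

lemma nul_line (θ : Fin s → Fin d → ℕ) (m : ℕ)
    (a a0 : Fin s → Matrix (Fin d) (Fin d) ℂ) (b b0 : Fin s → Matrix (Fin q) (Fin q) ℂ)
    (h : nul θ a0 b0 ≤ m) :
    ∀ᶠ w : ℂ in 𝓝[≠] 0, nul θ (a + w • (a0 - a)) (b + w • (b0 - b)) ≤ m := by
  rw [nul_le_iff] at h
  have h2 := rank_line (Mr θ a b) (Mr θ (a0 - a) b + Mr θ a (b0 - b)) (Mr θ (a0 - a) (b0 - b))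
    (finrank ℂ (Xsp q θ) - m) ?_
  · filter_upwards [h2] with w hw
    rw [nul_le_iff, Mr_expand]
    exact hw
  have := Mr_expand θ a (a0 - a) b (b0 - b) 1
  simp only [one_smul, add_sub_cancel, one_pow] at this
  rw [← this]; exact h

lemma dense_nul (θ : Fin s → Fin d → ℕ) (m : ℕ)
    (a0 : Fin s → Matrix (Fin d) (Fin d) ℂ) (b0 : Fin s → Matrix (Fin q) (Fin q) ℂ)
    (h : nul θ a0 b0 ≤ m) :
    Dense {p : (Fin s → Matrix (Fin d) (Fin d) ℂ) × (Fin s → Matrix (Fin q) (Fin q) ℂ) |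
      nul θ p.1 p.2 ≤ m} := by
  apply dense_of_line
  rintro ⟨a, b⟩
  exact ⟨(a0 - a, b0 - b), nul_line θ m a a0 b b0 h⟩

lemma dense_nul_a (θ : Fin s → Fin d → ℕ) (m : ℕ)
    (a0 : Fin s → Matrix (Fin d) (Fin d) ℂ) (b : Fin s → Matrix (Fin q) (Fin q) ℂ)
    (h : nul θ a0 b ≤ m) :
    Dense {a : (Fin s → Matrix (Fin d) (Fin d) ℂ) | nul θ a b ≤ m} := by
  apply dense_of_line
  intro a
  refine ⟨a0 - a, ?_⟩
  have := nul_line θ m a a0 b b h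
  simpa using this

lemma isOpen_nul_a (θ : Fin s → Fin d → ℕ) (m : ℕ) (b : Fin s → Matrix (Fin q) (Fin q) ℂ) :
    IsOpen {a : (Fin s → Matrix (Fin d) (Fin d) ℂ) | nul θ a b ≤ m} :=
  (isOpen_nul θ m).preimage (f := fun a => (a, b)) (by fun_prop)

lemma isOpen_unit : IsOpen {a : Fin s → Matrix (Fin d) (Fin d) ℂ | ∀ l, IsUnit (a l).det} := by
  simp only [isUnit_iff_ne_zero, Set.ofPred_forall]
  apply isOpen_iInter_of_finite
  intro l
  exact isOpen_ne_fun (by fun_prop) continuous_const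

lemma dense_unit : Dense {a : Fin s → Matrix (Fin d) (Fin d) ℂ | ∀ l, IsUnit (a l).det} := by
  apply dense_of_line
  intro a
  refine ⟨fun _ => 1, ?_⟩
  simp only [Set.mem_ofPred_eq, Pi.add_apply, Pi.smul_apply]
  rw [eventually_all]
  intro l
  have hfin : {w : ℂ | (-(a l)).charpoly.IsRoot w}.Finite :=
    Polynomial.finite_setOfPred_isRoot (Matrix.charpoly_monic _).ne_zero
  have hc : ({w : ℂ | (-(a l)).charpoly.IsRoot w} \ {0})ᶜ ∈ 𝓝 (0:ℂ) := by
    apply (hfin.subset Set.sdiff_subset).isClosed.isOpen_compl.mem_nhds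
    simp
  filter_upwards [nhdsWithin_le_nhds hc, self_mem_nhdsWithin] with w hw hw0
  rw [isUnit_iff_ne_zero]
  intro h0
  apply hw
  refine ⟨?_, hw0⟩
  simp only [Set.mem_ofPred_eq, Polynomial.IsRoot, Matrix.eval_charpoly]
  rw [← h0]
  congr 1
  simp [add_comm, Matrix.smul_one_eq_diagonal]
end Core
end Part2

section Part3
open Module Matrix Topology Filter
set_option linter.unusedSectionVars false
set_option linter.unusedSimpArgs false
set_option linter.unusedVariables false

section LemB
variable {s d q : ℕ}

def Co (θ : Fin d → ℕ) (c : ℕ) : Submodule ℂ (Fin d → ℂ) where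
  carrier := {x | ∀ j, θ j ≤ c → x j = 0}
  add_mem' := by intro x y hx hy j h; simp [hx j h, hy j h]
  zero_mem' := by intro j h; rfl
  smul_mem' := by intro k x hx j h; simp [hx j h]

lemma mem_Co {θ : Fin d → ℕ} {c : ℕ} {x : Fin d → ℂ} : x ∈ Co θ c ↔ ∀ j, θ j ≤ c → x j = 0 := Iff.rfl

def Es (a : Matrix (Fin d) (Fin d) ℂ) (θ : Fin d → ℕ) (c : ℕ) : Submodule ℂ (Fin d → ℂ) :=
  (Co θ c).map a.mulVecLin

lemma mem_Es {a : Matrix (Fin d) (Fin d) ℂ} {θ : Fin d → ℕ} {c : ℕ} {y} :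
    y ∈ Es a θ c ↔ ∃ x ∈ Co θ c, a *ᵥ x = y := Iff.rfl

lemma mem_Es_iff {a : Matrix (Fin d) (Fin d) ℂ} (ha : IsUnit a.det) {θ : Fin d → ℕ} {c : ℕ} {y} :
    y ∈ Es a θ c ↔ a⁻¹ *ᵥ y ∈ Co θ c := by
  rw [mem_Es]
  constructor
  · rintro ⟨x, hx, rfl⟩
    simpa [Matrix.mulVec_mulVec, Matrix.nonsing_inv_mul a ha] using hx
  · intro h
    exact ⟨_, h, by simp [Matrix.mulVec_mulVec, Matrix.mul_nonsing_inv a ha]⟩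

lemma mem_Es_mul {a p : Matrix (Fin d) (Fin d) ℂ} (hp : IsUnit p.det) {θ : Fin d → ℕ} {c : ℕ} {y} :
    p *ᵥ y ∈ Es (p * a) θ c ↔ y ∈ Es a θ c := by
  rw [mem_Es, mem_Es]
  constructor
  · rintro ⟨x, hx, h⟩
    refine ⟨x, hx, ?_⟩
    have := congrArg (fun v => p⁻¹ *ᵥ v) h
    simpa [Matrix.mulVec_mulVec, ← Matrix.mul_assoc, Matrix.nonsing_inv_mul p hp] using this
  · rintro ⟨x, hx, h⟩
    exact ⟨x, hx, by rw [← Matrix.mulVec_mulVec, h]⟩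

lemma finrank_Co (θ : Fin d → ℕ) (c : ℕ) :
    finrank ℂ (Co θ c) = (Finset.univ.filter fun j => c < θ j).card := by
  let e : Co θ c ≃ₗ[ℂ] ({j : Fin d // c < θ j} → ℂ) :=
    { toFun := fun x j => x.1 j.1
      map_add' := by intros; rfl
      map_smul' := by intros; rfl
      invFun := fun f => ⟨fun j => if h : c < θ j then f ⟨j, h⟩ else 0, by
        intro j h; simp [not_lt.2 h]⟩
      left_inv := by
        intro x
        apply Subtype.ext
        funext j
        by_cases h : c < θ j
        · simp [h]
        · simpa [h] using (x.2 j (not_lt.1 h)).symm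
      right_inv := by
        intro f
        funext j
        simp [j.2] }
  rw [e.finrank_eq, Module.finrank_fintype_fun_eq_card, Fintype.card_subtype]

lemma mulVecLin_inj {a : Matrix (Fin d) (Fin d) ℂ} (ha : IsUnit a.det) :
    Function.Injective a.mulVecLin := by
  have := Matrix.mulVec_injective_iff_isUnit.2 ((Matrix.isUnit_iff_isUnit_det a).2 ha)
  exact this

lemma finrank_Es {a : Matrix (Fin d) (Fin d) ℂ} (ha : IsUnit a.det) (θ : Fin d → ℕ) (c : ℕ) :
    finrank ℂ (Es a θ c) = (Finset.univ.filter fun j => c < θ j).card := by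
  rw [← finrank_Co]
  exact (LinearEquiv.finrank_eq (Submodule.equivMapOfInjective _ (mulVecLin_inj ha) (Co θ c))).symm

lemma sum_layer (θ : Fin d → ℕ) (hθ : ∀ j, θ j ≤ q) :
    ∑ c ∈ Finset.range q, (Finset.univ.filter fun j => c < θ j).card = ∑ j, θ j := by
  simp only [Finset.card_filter]
  rw [Finset.sum_comm]
  refine Finset.sum_congr rfl fun j _ => ?_
  rw [← Finset.card_filter]
  have : (Finset.range q).filter (fun c => c < θ j) = Finset.range (θ j) := by
    ext c; simp only [Finset.mem_filter, Finset.mem_range]; have := hθ j; omega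
  rw [this, Finset.card_range]

/-! adapted bases -/
lemma adapted_set {V : Type*} [AddCommGroup V] [Module ℂ V] (n : ℕ) :
    ∀ (U : ℕ → Submodule ℂ V), Antitone U →
    ∃ S : Set V, LinearIndepOn ℂ id S ∧ S ⊆ U 0 ∧ ∀ c ≤ n, U c ≤ Submodule.span ℂ (S ∩ U c) := by
  induction n with
  | zero =>
    intro U hU
    obtain ⟨b, hb, -, hspan, hli⟩ := exists_linearIndepOn_id_extension
      (linearIndepOn_empty ℂ (id : V → V)) (Set.empty_subset (U 0 : Set V))
    refine ⟨b, hli, hb, fun c hc => ?_⟩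
    obtain rfl : c = 0 := by omega
    intro x hx
    rw [Set.inter_eq_left.2 hb]
    exact hspan hx
  | succ n ih =>
    intro U hU
    obtain ⟨S, hS, hS1, hS2⟩ := ih (fun c => U (c + 1)) (fun a b h => hU (by omega))
    obtain ⟨b, hb, hsb, hspan, hli⟩ := exists_linearIndepOn_id_extension hS
      (hS1.trans (hU (Nat.zero_le 1)) : S ⊆ (U 0 : Set V))
    refine ⟨b, hli, hb, fun c hc => ?_⟩
    rcases c with _ | c
    · intro x hx
      rw [Set.inter_eq_left.2 hb]
      exact hspan hx
    · exact (hS2 c (by omega)).trans (Submodule.span_mono (Set.inter_subset_inter_left _ hsb))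

lemma adapted (q : ℕ) (U : ℕ → Submodule ℂ (Fin d → ℂ)) (hU : Antitone U) :
    ∃ (a : Matrix (Fin d) (Fin d) ℂ) (θ : Fin d → ℕ), IsUnit a.det ∧ (∀ j, θ j ≤ q) ∧
      ∀ c < q, U c = Es a θ c := by
  classical
  obtain ⟨S, hS, -, hS2⟩ := adapted_set (q + 1) (fun c => Nat.casesOn c ⊤ U) (by
    apply antitone_nat_of_succ_le
    intro n
    rcases n with _ | n
    · exact le_top
    · exact hU (by omega))
  have hspan : ⊤ ≤ Submodule.span ℂ (Set.range (Subtype.val : S → (Fin d → ℂ))) := by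
    have := hS2 0 (by omega)
    simpa using this
  have hli : LinearIndependent ℂ (Subtype.val : S → (Fin d → ℂ)) := hS
  let B0 := Basis.mk hli hspan
  haveI : Finite S := Module.Finite.finite_basis B0
  haveI : Fintype S := Fintype.ofFinite S
  have hcard : Fintype.card S = d := by
    have := Module.finrank_eq_card_basis B0
    simpa using this.symm
  let e : S ≃ Fin d := Fintype.equivFinOfCardEq hcard
  let B : Fin d → (Fin d → ℂ) := fun k => (e.symm k : Fin d → ℂ)
  have hB : LinearIndependent ℂ B := hli.comp e.symm e.symm.injective
  let a : Matrix (Fin d) (Fin d) ℂ := (Matrix.of B)ᵀ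
  have ha : IsUnit a.det := by
    rw [← Matrix.isUnit_iff_isUnit_det, ← Matrix.linearIndependent_cols_iff_isUnit]
    exact hB
  let θ : Fin d → ℕ := fun k => ((Finset.range q).filter fun c => B k ∈ U c).card
  have hθ : ∀ k, ∀ c < q, (c < θ k ↔ B k ∈ U c) := by
    intro k c hc
    constructor
    · intro h
      by_contra hn
      have : (Finset.range q).filter (fun c => B k ∈ U c) ⊆ Finset.range c := by
        intro x hx
        rw [Finset.mem_filter] at hx
        rw [Finset.mem_range]
        by_contra hxc
        exact hn (hU (not_lt.1 hxc) hx.2)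
      have := Finset.card_le_card this
      rw [Finset.card_range] at this
      exact absurd h (not_lt.2 this)
    · intro h
      have : Finset.range (c + 1) ⊆ (Finset.range q).filter (fun c => B k ∈ U c) := by
        intro x hx
        rw [Finset.mem_range] at hx
        rw [Finset.mem_filter, Finset.mem_range]
        exact ⟨by omega, hU (by omega) h⟩
      have := Finset.card_le_card this
      rw [Finset.card_range] at this
      exact this
  have haB : ∀ x : Fin d → ℂ, a *ᵥ x = ∑ k, x k • B k := by
    intro x
    ext i
    simp [a, Matrix.mulVec, dotProduct, mul_comm]
  refine ⟨a, θ, ha, ?_, ?_⟩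
  · intro k
    exact (Finset.card_filter_le _ _).trans (by simp)
  · intro c hc
    apply le_antisymm
    · refine (hS2 (c + 1) (by omega)).trans ?_
      rw [Submodule.span_le]
      rintro v ⟨hv, hvU⟩
      refine ⟨Pi.single (e ⟨v, hv⟩) 1, ?_, ?_⟩
      · intro j hj
        rw [Pi.single_apply, if_neg]
        rintro rfl
        have := (hθ (e ⟨v, hv⟩) c hc).2 (by simpa [B] using hvU)
        omega
      · simp [haB, a, B, Matrix.mulVecLin_apply]
    · rintro _ ⟨x, hx, rfl⟩
      rw [Matrix.mulVecLin_apply, haB]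
      apply Submodule.sum_mem
      intro k _
      by_cases hk : c < θ k
      · exact Submodule.smul_mem _ _ ((hθ k c hc).1 hk)
      · rw [hx k (not_lt.1 hk), zero_smul]; exact Submodule.zero_mem _

lemma exists_incl (S : Submodule ℂ (Fin d → ℂ)) :
    ∃ (ι : Matrix (Fin d) (Fin (finrank ℂ S)) ℂ) (π : Matrix (Fin (finrank ℂ S)) (Fin d) ℂ),
      π * ι = 1 ∧ (∀ v, v ∈ S ↔ ∃ x, ι *ᵥ x = v) := by
  let B := Module.finBasis ℂ S
  let f : (Fin (finrank ℂ S) → ℂ) →ₗ[ℂ] (Fin d → ℂ) := S.subtype ∘ₗ B.equivFun.symm.toLinearMap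
  have hf : LinearMap.ker f = ⊥ := by
    rw [LinearMap.ker_eq_bot]
    exact S.injective_subtype.comp B.equivFun.symm.injective
  obtain ⟨g, hg⟩ := LinearMap.exists_leftInverse_of_injective f hf
  refine ⟨LinearMap.toMatrix' f, LinearMap.toMatrix' g, ?_, ?_⟩
  · rw [← LinearMap.toMatrix'_comp, hg, LinearMap.toMatrix'_id]
  · intro v
    constructor
    · intro hv
      exact ⟨B.equivFun ⟨v, hv⟩, by simp [f]⟩
    · rintro ⟨x, rfl⟩
      rw [LinearMap.toMatrix'_mulVec]
      exact (B.equivFun.symm x).2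
end LemB
end Part3

section Part4
open Module Matrix Topology Filter
set_option linter.unusedSectionVars false
set_option linter.unusedSimpArgs false
set_option linter.unusedVariables false

section LemB2
variable {s d q : ℕ}

lemma Co_antitone (θ : Fin d → ℕ) : Antitone (Co θ) := by
  intro c c' h x hx j hj
  exact hx j (hj.trans h)

lemma Es_antitone (a : Matrix (Fin d) (Fin d) ℂ) (θ : Fin d → ℕ) : Antitone (Es a θ) := by
  intro c c' h
  exact Submodule.map_mono (Co_antitone θ h)

def Dset (q : ℕ) (θ : Fin s → Fin d → ℕ) : Set (Fin s → Matrix (Fin d) (Fin d) ℂ) :=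
  {a | (∀ l, IsUnit (a l).det) ∧ ∃ S : Submodule ℂ (Fin d → ℂ),
    mc q θ + q * finrank ℂ S ≤
      ∑ l, ∑ c ∈ Finset.range q, finrank ℂ ↥(S ⊓ Es (a l) (θ l) c)}

/-- transfer of the kernel -/
lemma nul_transfer {d' : ℕ} (θ : Fin s → Fin d → ℕ) (θ' : Fin s → Fin d' → ℕ)
    (a2 : Fin s → Matrix (Fin d) (Fin d) ℂ) (a'' : Fin s → Matrix (Fin d') (Fin d') ℂ)
    (b : Fin s → Matrix (Fin q) (Fin q) ℂ)
    (ι : Matrix (Fin d) (Fin d') ℂ) (π : Matrix (Fin d') (Fin d) ℂ)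
    (hπ : π * ι = 1) (ha2 : ∀ l, IsUnit (a2 l).det) (ha'' : ∀ l, IsUnit (a'' l).det)
    (hE : ∀ l, ∀ c < q, ∀ y, y ∈ Es (a'' l) (θ' l) c ↔ ι *ᵥ y ∈ Es (a2 l) (θ l) c)
    (hcol : ∀ X ∈ Xsp q θ, ∑ l, a2 l * X l * b l = 0 → ∀ l, ι * (π * (a2 l * X l)) = a2 l * X l) :
    nul θ a2 b ≤ nul θ' a'' b := by
  let L : LinearMap.ker (Mr θ a2 b) → (Fin s → Matrix (Fin d') (Fin q) ℂ) :=
    fun X l => (a'' l)⁻¹ * (π * (a2 l * X.1.1 l))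
  have hk : ∀ X : LinearMap.ker (Mr θ a2 b), ∑ l, a2 l * X.1.1 l * b l = 0 := fun X => X.2
  have hL1 : ∀ X, L X ∈ Xsp q θ' := by
    intro X l k c hc
    have h1 : (X.1.1 l).col c ∈ Co (θ l) c := by
      intro j hj
      exact X.1.2 l j c hj
    have h2 : a2 l *ᵥ (X.1.1 l).col c ∈ Es (a2 l) (θ l) c := ⟨_, h1, rfl⟩
    have h3 := hcol X.1.1 X.1.2 (hk X) l
    have h4 : ι *ᵥ (π *ᵥ (a2 l *ᵥ (X.1.1 l).col c)) = a2 l *ᵥ (X.1.1 l).col c := by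
      funext i
      have := congrFun (congrFun h3 i) c
      simpa [Matrix.mul_apply, Matrix.mulVec, dotProduct, Matrix.col] using this
    rw [← h4, ← hE l c c.2, mem_Es_iff (ha'' l)] at h2
    have := h2 k hc
    simpa [L, Matrix.mul_apply, Matrix.mulVec, dotProduct, Matrix.col] using this
  have hL2 : ∀ X, ∑ l, a'' l * L X l * b l = 0 := by
    intro X
    have : ∑ l, a'' l * L X l * b l = π * ∑ l, a2 l * X.1.1 l * b l := by
      rw [Matrix.mul_sum]
      refine Finset.sum_congr rfl fun l _ => ?_
      simp only [L]
      rw [← Matrix.mul_assoc (a'' l), Matrix.mul_nonsing_inv _ (ha'' l), Matrix.one_mul]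
      simp only [Matrix.mul_assoc]
    rw [this, hk X, Matrix.mul_zero]
  let LL : LinearMap.ker (Mr θ a2 b) →ₗ[ℂ] LinearMap.ker (Mr θ' a'' b) :=
    { toFun := fun X => ⟨⟨L X, hL1 X⟩, hL2 X⟩
      map_add' := by
        intro X Y
        apply Subtype.ext; apply Subtype.ext
        funext l
        simp [L, Matrix.mul_add]
      map_smul' := by
        intro k X
        apply Subtype.ext; apply Subtype.ext
        funext l
        simp [L] }
  apply LinearMap.finrank_le_finrank_of_injective (f := LL)
  rw [injective_iff_map_eq_zero]
  intro X hX
  have h0 : ∀ l, (a'' l)⁻¹ * (π * (a2 l * X.1.1 l)) = 0 := by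
    intro l
    exact congrFun (congrArg (fun Y => Y.1.1) hX) l
  apply Subtype.ext; apply Subtype.ext
  funext l
  have h1 : π * (a2 l * X.1.1 l) = 0 := by
    have := congrArg (fun Y => a'' l * Y) (h0 l)
    simpa [← Matrix.mul_assoc, Matrix.mul_nonsing_inv _ (ha'' l)] using this
  have h2 := hcol X.1.1 X.1.2 (hk X) l
  rw [h1, Matrix.mul_zero] at h2
  have := congrArg (fun Y => (a2 l)⁻¹ * Y) h2
  simpa [← Matrix.mul_assoc, Matrix.nonsing_inv_mul _ (ha2 l)] using this.symm

theorem claim_dense (b : Fin s → Matrix (Fin q) (Fin q) ℂ) (r : ℕ)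
    (hb : ∀ d ≤ r, ∀ θ : Fin s → Fin d → ℕ, (∀ l j, θ l j ≤ q) → ∃ a, nul θ a b = mc q θ) (d : ℕ) :
    d ≤ r → ∀ θ : Fin s → Fin d → ℕ, (∀ l j, θ l j ≤ q) → Dense (Dset q θ) := by
  induction d using Nat.strong_induction_on with
  | _ d ih =>
  intro hd θ hθ
  rw [dense_iff_inter_open]
  intro O hO hne
  obtain ⟨a0, ha0⟩ := hb d hd θ hθ
  have hO1 : (O ∩ {a | ∀ l, IsUnit (a l).det}).Nonempty := dense_unit.inter_open_nonempty O hO hne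
  have hO1o : IsOpen (O ∩ {a : Fin s → Matrix (Fin d) (Fin d) ℂ | ∀ l, IsUnit (a l).det}) :=
    hO.inter isOpen_unit
  obtain ⟨a1, ⟨ha1O, ha1u⟩, ha1n⟩ :=
    (dense_nul_a θ (mc q θ) a0 b ha0.le).inter_open_nonempty _ hO1o hO1
  have ha1 : nul θ a1 b = mc q θ := le_antisymm ha1n (mc_le _ _ _)
  by_cases hH : Hsp θ a1 b = ⊥
  · refine ⟨a1, ha1O, ha1u, ⊤, ?_⟩
    have := dim_formula θ hθ a1 b
    rw [hH, finrank_bot, zero_add, ha1] at this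
    rw [finrank_top, Module.finrank_fintype_fun_eq_card, Fintype.card_fin, this]
    apply le_of_eq
    refine Finset.sum_congr rfl fun l _ => ?_
    rw [← sum_layer (θ l) (hθ l)]
    refine Finset.sum_congr rfl fun c _ => ?_
    rw [top_inf_eq, finrank_Es (ha1u l)]
  · let S : Submodule ℂ (Fin d → ℂ) := ⨅ φ : Hsp θ a1 b, LinearMap.ker φ.1.mulVecLin
    have hSm : ∀ v, v ∈ S ↔ ∀ φ ∈ Hsp θ a1 b, φ *ᵥ v = 0 := by
      intro v
      simp [S, Submodule.mem_iInf]
    have hSlt : finrank ℂ S < d := by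
      have : S < ⊤ := by
        rw [lt_top_iff_ne_top]
        intro hS
        apply hH
        rw [eq_bot_iff]
        intro φ hφ
        rw [Submodule.mem_bot]
        ext i j
        have h1 := (hSm (Pi.single j 1)).1 (by rw [hS]; trivial) φ hφ
        have := congrFun h1 i
        simpa using this
      have := Submodule.finrank_lt_finrank_of_lt this
      simpa using this
    obtain ⟨ι, π, hπ, hι⟩ := exists_incl S
    choose a' θ' ha'u hθ' hU using fun l => adapted q
      (fun c => (Es (a1 l) (θ l) c).comap ι.mulVecLin)
      (fun c c' h => Submodule.comap_mono (Es_antitone (a1 l) (θ l) h))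
    have hdense := ih _ hSlt (hSlt.le.trans hd) θ' hθ'
    obtain ⟨a0', ha0'⟩ := hb _ (hSlt.le.trans hd) θ' hθ'
    let Ψ : (Fin s → Matrix (Fin (finrank ℂ S)) (Fin (finrank ℂ S)) ℂ) →
        (Fin s → Matrix (Fin d) (Fin d) ℂ) :=
      fun a'' l => (1 + ι * (a'' l * (a' l)⁻¹ - 1) * π) * a1 l
    have hΨ : Continuous Ψ := by fun_prop
    have hΨa : Ψ a' = a1 := by
      funext l
      simp [Ψ, Matrix.mul_nonsing_inv _ (ha'u l)]
    let W := Ψ ⁻¹' ((O ∩ {a | ∀ l, IsUnit (a l).det}) ∩ {a | nul θ a b ≤ mc q θ})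
    have hWo : IsOpen W := (hO1o.inter (isOpen_nul_a θ _ b)).preimage hΨ
    have hWn : W.Nonempty := ⟨a', by
      rw [Set.mem_preimage, hΨa]; exact ⟨⟨ha1O, ha1u⟩, ha1n⟩⟩
    have hW2 := (dense_nul_a θ' (mc q θ') a0' b ha0'.le).inter_open_nonempty W hWo hWn
    obtain ⟨a'', ⟨ha''W, ha''n⟩, ha''u, S'', hS''⟩ :=
      hdense.inter_open_nonempty _ (hWo.inter (isOpen_nul_a θ' (mc q θ') b)) hW2
    obtain ⟨⟨h2O, h2u⟩, h2n⟩ := ha''W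
    set a2 := Ψ a'' with ha2
    have h2 : nul θ a2 b = mc q θ := le_antisymm h2n (mc_le _ _ _)
    have h'' : nul θ' a'' b = mc q θ' := le_antisymm ha''n (mc_le _ _ _)
    -- the group element
    let p : Fin s → Matrix (Fin d) (Fin d) ℂ := fun l => 1 + ι * (a'' l * (a' l)⁻¹ - 1) * π
    have hpa : ∀ l, a2 l = p l * a1 l := fun l => rfl
    have hpu : ∀ l, IsUnit (p l).det := by
      intro l
      have := h2u l
      rw [hpa, Matrix.det_mul] at this
      exact isUnit_of_mul_isUnit_left this
    have hpι : ∀ l, p l * ι = ι * (a'' l * (a' l)⁻¹) := by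
      intro l
      simp only [p, Matrix.add_mul, Matrix.one_mul, Matrix.mul_assoc, hπ, Matrix.mul_one]
      rw [Matrix.mul_sub, Matrix.mul_one]
      abel
    have hE : ∀ l, ∀ c < q, ∀ y, y ∈ Es (a'' l) (θ' l) c ↔ ι *ᵥ y ∈ Es (a2 l) (θ l) c := by
      intro l c hc y
      have e1 : y ∈ Es (a'' l) (θ' l) c ↔ (a' l * (a'' l)⁻¹) *ᵥ y ∈ Es (a' l) (θ' l) c := by
        rw [mem_Es_iff (ha''u l), mem_Es_iff (ha'u l), Matrix.mulVec_mulVec, ← Matrix.mul_assoc,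
          Matrix.nonsing_inv_mul _ (ha'u l), Matrix.one_mul]
      rw [e1, ← hU l c hc, Submodule.mem_comap, Matrix.mulVecLin_apply, hpa, ← mem_Es_mul (hpu l)]
      have e2 : p l *ᵥ ι *ᵥ (a' l * (a'' l)⁻¹) *ᵥ y = ι *ᵥ y := by
        rw [Matrix.mulVec_mulVec, Matrix.mulVec_mulVec, hpι]
        congr 1
        rw [Matrix.mul_assoc, Matrix.mul_assoc (a'' l), ← Matrix.mul_assoc _ (a' l),
          Matrix.nonsing_inv_mul _ (ha'u l), Matrix.one_mul, Matrix.mul_nonsing_inv _ (ha''u l),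
          Matrix.mul_one]
      rw [e2]
    have hφι : ∀ φ ∈ Hsp θ a1 b, φ * ι = 0 := by
      intro φ hφ
      ext i j
      have h1 : ι *ᵥ Pi.single j 1 ∈ S := (hι _).2 ⟨_, rfl⟩
      have := congrFun ((hSm _).1 h1 φ hφ) i
      rw [Matrix.mulVec_mulVec] at this
      simpa using this
    have hH2 : ∀ φ ∈ Hsp θ a1 b, φ ∈ Hsp θ a2 b := by
      intro φ hφ l j c hc
      have : b l * φ * a2 l = b l * φ * a1 l := by
        have e : φ * p l = φ := by
          simp only [p, Matrix.mul_add, ← Matrix.mul_assoc, hφι φ hφ]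
          simp
        rw [hpa, Matrix.mul_assoc, ← Matrix.mul_assoc φ, e, Matrix.mul_assoc]
      rw [this]
      exact hφ l j c hc
    have hcol : ∀ X ∈ Xsp q θ, ∑ l, a2 l * X l * b l = 0 →
        ∀ l, ι * (π * (a2 l * X l)) = a2 l * X l := by
      intro X hX h0 l
      have hmem : ∀ c, (a2 l * X l).col c ∈ S := by
        intro c
        rw [hSm]
        intro φ hφ
        have := B1 θ a2 b h2 φ (hH2 φ hφ) X hX h0 l
        funext i
        have := congrFun (congrFun this i) c
        rw [Matrix.mul_assoc] at this
        simpa [Matrix.mul_apply, Matrix.mulVec, dotProduct, Matrix.col] using this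
      ext i c
      obtain ⟨x, hx⟩ := (hι _).1 (hmem c)
      have : (ι * (π * (a2 l * X l))).col c = ι *ᵥ (π *ᵥ ((a2 l * X l).col c)) := by
        funext i
        simp [Matrix.mul_apply, Matrix.mulVec, dotProduct, Matrix.col]
      have h4 := congrFun this i
      rw [← hx, Matrix.mulVec_mulVec x π, hπ, Matrix.one_mulVec, hx] at h4
      exact h4
    have hle : mc q θ ≤ mc q θ' := by
      rw [← h2, ← h'']
      exact nul_transfer θ θ' a2 a'' b ι π hπ h2u ha''u hE hcol
    have hιinj : Function.Injective ι.mulVecLin := by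
      intro x y hxy
      have := congrArg (fun v => π *ᵥ v) hxy
      simpa [Matrix.mulVec_mulVec, hπ] using this
    refine ⟨a2, h2O, h2u, S''.map ι.mulVecLin, ?_⟩
    have hf : ∀ T : Submodule ℂ (Fin (finrank ℂ S) → ℂ),
        finrank ℂ (T.map ι.mulVecLin) = finrank ℂ T := fun T =>
      (LinearEquiv.finrank_eq (Submodule.equivMapOfInjective _ hιinj T)).symm
    rw [hf]
    refine le_trans (Nat.add_le_add_right hle _) (hS''.trans ?_)
    refine Finset.sum_le_sum fun l _ => Finset.sum_le_sum fun c hc => ?_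
    rw [← hf]
    apply Submodule.finrank_mono
    rintro _ ⟨y, ⟨hy1, hy2⟩, rfl⟩
    exact ⟨⟨y, hy1, rfl⟩, (hE l c (Finset.mem_range.1 hc) y).1 hy2⟩

lemma exists_good_b (s q r : ℕ) : ∃ b : Fin s → Matrix (Fin q) (Fin q) ℂ,
    ∀ d ≤ r, ∀ θ : Fin s → Fin d → ℕ, (∀ l j, θ l j ≤ q) → ∃ a, nul θ a b = mc q θ := by
  let I := Σ d : Fin (r + 1), (Fin s → Fin d → Fin (q + 1))
  let G : I → Set (Fin s → Matrix (Fin q) (Fin q) ℂ) := fun i =>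
    Prod.snd '' {p : (Fin s → Matrix (Fin i.1) (Fin i.1) ℂ) × (Fin s → Matrix (Fin q) (Fin q) ℂ) |
      nul (fun l j => (i.2 l j : ℕ)) p.1 p.2 ≤ mc q (fun l j => (i.2 l j : ℕ))}
  have hGo : ∀ i, IsOpen (G i) := fun i => isOpenMap_snd _ (isOpen_nul _ _)
  have hGd : ∀ i, Dense (G i) := by
    intro i
    obtain ⟨a0, b0, h⟩ := exists_mc q (fun l j => (i.2 l j : ℕ))
    exact Prod.snd_surjective.denseRange.dense_image continuous_snd (dense_nul _ _ a0 b0 h.le)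
  have : BaireSpace (Fin s → Matrix (Fin q) (Fin q) ℂ) :=
    inferInstanceAs (BaireSpace (Fin s → Fin q → Fin q → ℂ))
  obtain ⟨b, hb⟩ := (dense_iInter_of_isOpen hGo hGd).nonempty
  rw [Set.mem_iInter] at hb
  refine ⟨b, fun d hd θ hθ => ?_⟩
  obtain ⟨⟨a, b'⟩, h, rfl⟩ := hb ⟨⟨d, by omega⟩, fun l j => ⟨θ l j, Nat.lt_succ_of_le (hθ l j)⟩⟩
  exact ⟨a, le_antisymm h (mc_le _ _ _)⟩
end LemB2
end Part4

section Part5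
open Module Matrix Topology Filter
set_option linter.unusedSectionVars false
set_option linter.unusedSimpArgs false
set_option linter.unusedVariables false

section LemB3
variable {s d q : ℕ}

lemma exists_proj (S : Submodule ℂ (Fin d → ℂ)) :
    ∃ P : Matrix (Fin d) (Fin d) ℂ, Pᴴ = P ∧ P * P = P ∧ P.trace = (finrank ℂ S : ℂ) ∧
      ∀ v, v ∈ S ↔ P *ᵥ v = v := by
  let e := (WithLp.linearEquiv 2 ℂ (Fin d → ℂ)).symm
  let S' : Submodule ℂ (EuclideanSpace ℂ (Fin d)) := S.map e.toLinearMap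
  let B := stdOrthonormalBasis ℂ S'
  have hfin : finrank ℂ S' = finrank ℂ S := LinearEquiv.finrank_map_eq e S
  let W : Matrix (Fin d) (Fin (finrank ℂ S')) ℂ := Matrix.of fun i k => (B k : EuclideanSpace ℂ (Fin d)) i
  have hW : Wᴴ * W = 1 := by
    ext k k'
    have h := (orthonormal_iff_ite.1 B.orthonormal) k k'
    rw [Submodule.coe_inner, PiLp.inner_apply] at h
    simp only [Matrix.mul_apply, Matrix.conjTranspose_apply, Matrix.one_apply, W, Matrix.of_apply]
    rw [← h]
    refine Finset.sum_congr rfl fun i _ => ?_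
    simp [mul_comm]
  have hmem : ∀ v, v ∈ S ↔ ∃ x, W *ᵥ x = v := by
    intro v
    have hWx : ∀ x : Fin (finrank ℂ S') → ℂ,
        W *ᵥ x = e.symm ((∑ k, x k • B k : S') : EuclideanSpace ℂ (Fin d)) := by
      intro x
      funext i
      simp [W, Matrix.mulVec, dotProduct, e, mul_comm]
    constructor
    · intro hv
      let v' : S' := ⟨e v, v, hv, rfl⟩
      refine ⟨fun k => B.repr v' k, ?_⟩
      rw [hWx, B.sum_repr]
      simp [v']
    · rintro ⟨x, rfl⟩
      rw [hWx]
      obtain ⟨w, hw, hw2⟩ := (∑ k, x k • B k : S').2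
      rw [← hw2]
      simpa using hw
  refine ⟨W * Wᴴ, ?_, ?_, ?_, ?_⟩
  · simp
  · rw [Matrix.mul_assoc, ← Matrix.mul_assoc Wᴴ, hW, Matrix.one_mul]
  · rw [Matrix.trace_mul_comm, hW, Matrix.trace_one, Fintype.card_fin, hfin]
  · intro v
    rw [hmem]
    constructor
    · rintro ⟨x, rfl⟩
      rw [Matrix.mulVec_mulVec, Matrix.mul_assoc, hW, Matrix.mul_one]
    · intro h
      exact ⟨Wᴴ *ᵥ v, by rw [Matrix.mulVec_mulVec, h]⟩

lemma trace_conj_mul_nonneg {m n : ℕ} (A : Matrix (Fin m) (Fin n) ℂ) : 0 ≤ (Aᴴ * A).trace.re := by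
  simp only [Matrix.trace, Matrix.diag, Matrix.mul_apply, Matrix.conjTranspose_apply, Complex.re_sum]
  refine Finset.sum_nonneg fun i _ => Finset.sum_nonneg fun j _ => ?_
  simp [Complex.mul_re]
  nlinarith [mul_self_nonneg (A j i).re, mul_self_nonneg (A j i).im]

lemma trace_proj_nonneg {P Q : Matrix (Fin d) (Fin d) ℂ} (hP : Pᴴ = P) (hP2 : P * P = P)
    (hQ : Qᴴ = Q) (hQ2 : Q * Q = Q) : 0 ≤ (P * Q).trace.re := by
  have h := trace_conj_mul_nonneg (P * Q)
  have e : ((P * Q)ᴴ * (P * Q)).trace = (P * Q).trace := by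
    rw [Matrix.conjTranspose_mul, hP, hQ, Matrix.mul_assoc, ← Matrix.mul_assoc P, hP2,
      Matrix.trace_mul_comm, Matrix.mul_assoc, hQ2]
  rwa [e] at h

lemma proj_entry_le {P : Matrix (Fin d) (Fin d) ℂ} (hP : Pᴴ = P) (hP2 : P * P = P) (i j) :
    ‖P i j‖ ≤ 1 := by
  have h1 : ∀ i, P i i = ((∑ j, ‖P i j‖ ^ 2 : ℝ) : ℂ) := by
    intro i
    conv_lhs => rw [← hP2, Matrix.mul_apply]
    rw [Complex.ofReal_sum]
    refine Finset.sum_congr rfl fun j _ => ?_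
    have : P j i = star (P i j) := by
      conv_lhs => rw [← hP, Matrix.conjTranspose_apply]
    rw [this]
    simpa using Complex.mul_conj' (P i j)
  have h2 : ‖P i i‖ = ∑ j, ‖P i j‖ ^ 2 := by
    conv_lhs => rw [h1 i]
    rw [Complex.norm_real, Real.norm_of_nonneg]
    exact Finset.sum_nonneg fun j _ => by positivity
  have h3 : ∀ j, ‖P i j‖ ^ 2 ≤ ‖P i i‖ := by
    intro j
    rw [h2]
    exact Finset.single_le_sum (f := fun j => ‖P i j‖ ^ 2) (fun j _ => by positivity) (Finset.mem_univ j)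
  have h4 := h3 i
  have h5 := h3 j
  have h6 : ‖P i i‖ ≤ 1 := by nlinarith [norm_nonneg (P i i)]
  nlinarith [norm_nonneg (P i j)]

lemma abs_trace_mul_le (D R : Matrix (Fin d) (Fin d) ℂ) (ε : ℝ) (hD : ∀ i j, ‖D i j‖ ≤ ε)
    (hR : ∀ i j, ‖R i j‖ ≤ 1) : (D * R).trace.re ≤ d * (d * ε) := by
  refine (Complex.re_le_norm _).trans ?_
  simp only [Matrix.trace, Matrix.diag, Matrix.mul_apply]
  refine (norm_sum_le _ _).trans ?_
  have : ∀ i ∈ (Finset.univ : Finset (Fin d)), ‖∑ j, D i j * R j i‖ ≤ d * ε := by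
    intro i _
    refine (norm_sum_le _ _).trans ?_
    have : ∀ j ∈ (Finset.univ : Finset (Fin d)), ‖D i j * R j i‖ ≤ ε := by
      intro j _
      rw [norm_mul]
      have h1 := hD i j
      have h2 := hR j i
      nlinarith [norm_nonneg (D i j), norm_nonneg (R j i)]
    refine (Finset.sum_le_card_nsmul _ _ _ this).trans ?_
    simp
  refine (Finset.sum_le_card_nsmul _ _ _ this).trans ?_
  simp

/-- indicator diagonal -/
def ind (θ : Fin d → ℕ) (c : ℕ) : Matrix (Fin d) (Fin d) ℂ :=
  Matrix.diagonal fun j => if c < θ j then 1 else 0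

lemma ind_mulVec {θ : Fin d → ℕ} {c : ℕ} {x} (hx : x ∈ Co θ c) : ind θ c *ᵥ x = x := by
  funext j
  rw [ind, Matrix.mulVec_diagonal]
  by_cases h : c < θ j
  · simp [h]
  · simp [h, hx j (not_lt.1 h)]

lemma sum_ind (θ : Fin d → ℕ) (hθ : ∀ j, θ j ≤ q) :
    ∑ c ∈ Finset.range q, ind θ c = Matrix.diagonal fun j => (θ j : ℂ) := by
  ext i j
  rw [Matrix.sum_apply]
  by_cases h : i = j
  · subst h
    simp only [ind, Matrix.diagonal_apply_eq]
    rw [← Finset.sum_filter, Finset.sum_const, nsmul_eq_mul, mul_one]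
    have : (Finset.range q).filter (fun c => c < θ i) = Finset.range (θ i) := by
      ext c; simp only [Finset.mem_filter, Finset.mem_range]; have := hθ i; omega
    rw [this, Finset.card_range]
  · simp [ind, h]

lemma continuousAt_conj (M u : Matrix (Fin d) (Fin d) ℂ) (hu : IsUnit u.det) :
    ContinuousAt (fun a : Matrix (Fin d) (Fin d) ℂ => a * M * a⁻¹) u := by
  simp only [Matrix.inv_def, Ring.inverse_eq_inv']
  have h1 : ContinuousAt (fun a : Matrix (Fin d) (Fin d) ℂ => (a.det)⁻¹) u :=
    ContinuousAt.inv₀ (by fun_prop) hu.ne_zero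
  have h2 : ContinuousAt (fun a : Matrix (Fin d) (Fin d) ℂ => a * M) u := by fun_prop
  have h3 : ContinuousAt (fun a : Matrix (Fin d) (Fin d) ℂ => a.adjugate) u :=
    (continuous_id.matrix_adjugate).continuousAt
  exact h2.mul (h1.smul h3)

theorem lemB (θ : Fin s → Fin d → ℕ) (hθ : ∀ l j, θ l j ≤ q)
    (u : Fin s → Matrix (Fin d) (Fin d) ℂ) (hu : ∀ l, u l * (u l)ᴴ = 1)
    (h : ∀ P : Matrix (Fin d) (Fin d) ℂ, Pᴴ = P → P * P = P →
      ∑ l, (P * (u l * Matrix.diagonal (fun j => (θ l j : ℂ)) * (u l)ᴴ)).trace.re ≤ q * P.trace.re) :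
    ∃ (a : Fin s → Matrix (Fin d) (Fin d) ℂ) (b : Fin s → Matrix (Fin q) (Fin q) ℂ),
      nul θ a b = 0 := by
  obtain ⟨b, hb⟩ := exists_good_b s q d
  have hD := claim_dense b d hb d le_rfl θ hθ
  have huu : ∀ l, IsUnit (u l).det := fun l => Matrix.isUnit_det_of_right_inverse (hu l)
  have hinv : ∀ l, (u l)⁻¹ = (u l)ᴴ := fun l => Matrix.inv_eq_right_inv (hu l)
  obtain ⟨ε, hε, hεs⟩ : ∃ ε : ℝ, 0 < ε ∧ (s : ℝ) * (q * (d * (d * ε))) < 1 := by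
    have h0 : (0:ℝ) ≤ (s : ℝ) * (q * (d * d)) := by positivity
    refine ⟨1 / (s * (q * (d * d)) + 1), by positivity, ?_⟩
    rw [show (s : ℝ) * (q * (d * (d * (1 / (s * (q * (d * d)) + 1))))) =
      (s * (q * (d * d))) / (s * (q * (d * d)) + 1) by ring, div_lt_one (by positivity)]
    linarith
  have hnear : ∀ᶠ a : Fin s → Matrix (Fin d) (Fin d) ℂ in 𝓝 u, ∀ l, ∀ c ∈ Finset.range q, ∀ i j,
      ‖(a l * ind (θ l) c * (a l)⁻¹ - u l * ind (θ l) c * (u l)ᴴ) i j‖ ≤ ε := by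
    rw [eventually_all]; intro l
    rw [Finset.eventually_all]; intro c hc
    rw [eventually_all]; intro i
    rw [eventually_all]; intro j
    have hc1 := (continuousAt_conj (ind (θ l) c) (u l) (huu l)).comp
      (continuous_apply l).continuousAt (x := u)
    have hc2 : ContinuousAt (fun a : Fin s → Matrix (Fin d) (Fin d) ℂ =>
        ‖(a l * ind (θ l) c * (a l)⁻¹ - u l * ind (θ l) c * (u l)ᴴ) i j‖) u := by
      have h5 : Continuous fun M : Matrix (Fin d) (Fin d) ℂ =>
        ‖(M - u l * ind (θ l) c * (u l)ᴴ) i j‖ :=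
          ((continuous_id.sub continuous_const).matrix_elem i j).norm
      exact h5.continuousAt.comp hc1
    have := hc2.eventually_lt continuousAt_const (g := fun _ => ε) (by simpa [hinv] using hε)
    filter_upwards [this] with a ha using ha.le
  obtain ⟨O, hO, hOo, huO⟩ := mem_nhds_iff.1 hnear
  obtain ⟨a, haO, hau, S, hS⟩ := hD.inter_open_nonempty O hOo ⟨u, huO⟩
  have hclose := hO haO
  obtain ⟨P, hP, hP2, hPtr, hPm⟩ := exists_proj S
  have key : ∀ l, ∀ c ∈ Finset.range q, (finrank ℂ ↥(S ⊓ Es (a l) (θ l) c) : ℝ) ≤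
      (P * (u l * ind (θ l) c * (u l)ᴴ)).trace.re + d * (d * ε) := by
    intro l c hc
    obtain ⟨R, hR, hR2, hRtr, hRm⟩ := exists_proj (S ⊓ Es (a l) (θ l) c)
    have hcols : ∀ j, R *ᵥ Pi.single j 1 ∈ S ⊓ Es (a l) (θ l) c := by
      intro j
      rw [hRm, Matrix.mulVec_mulVec, hR2]
    have hext : ∀ M : Matrix (Fin d) (Fin d) ℂ,
        (∀ j, M *ᵥ (R *ᵥ Pi.single j 1) = R *ᵥ Pi.single j 1) → M * R = R := by
      intro M hM
      ext i j
      have := congrFun (hM j) i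
      rw [Matrix.mulVec_mulVec] at this
      simpa using this
    have hPR : P * R = R := hext P fun j => (hPm _).1 (hcols j).1
    have hRP : R * P = R := by
      have := congrArg Matrix.conjTranspose hPR
      rwa [Matrix.conjTranspose_mul, hP, hR] at this
    have haR : (a l * ind (θ l) c * (a l)⁻¹) * R = R := by
      apply hext
      intro j
      have h1 := (mem_Es_iff (hau l)).1 (hcols j).2
      rw [← Matrix.mulVec_mulVec, ← Matrix.mulVec_mulVec, ind_mulVec h1, Matrix.mulVec_mulVec,
        Matrix.mul_nonsing_inv _ (hau l), Matrix.one_mulVec]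
    set Pr := u l * ind (θ l) c * (u l)ᴴ with hPr
    have hu' : (u l)ᴴ * u l = 1 := mul_eq_one_comm.1 (hu l)
    have hind : ind (θ l) c * ind (θ l) c = ind (θ l) c := by
      rw [ind, Matrix.diagonal_mul_diagonal]; congr 1; funext j; split_ifs <;> simp
    have hindH : (ind (θ l) c)ᴴ = ind (θ l) c := by
      rw [ind, Matrix.diagonal_conjTranspose]; congr 1; funext j
      simp only [Pi.star_apply]; split_ifs <;> simp
    have hPrH : Prᴴ = Pr := by
      simp only [hPr, Matrix.conjTranspose_mul, Matrix.conjTranspose_conjTranspose, hindH,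
        Matrix.mul_assoc]
    have hPr2 : Pr * Pr = Pr := by
      calc Pr * Pr = u l * (ind (θ l) c * ((u l)ᴴ * u l) * ind (θ l) c) * (u l)ᴴ := by
            simp only [hPr, Matrix.mul_assoc]
        _ = Pr := by rw [hu', Matrix.mul_one, hind]
    have hQ : 0 ≤ ((P - R) * Pr).trace.re := by
      apply trace_proj_nonneg _ _ hPrH hPr2
      · rw [Matrix.conjTranspose_sub, hP, hR]
      · rw [Matrix.sub_mul, Matrix.mul_sub, Matrix.mul_sub, hP2, hPR, hRP, hR2]; simp
    rw [Matrix.sub_mul, Matrix.trace_sub, Complex.sub_re] at hQ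
    have hb1 := abs_trace_mul_le _ R ε (hclose l c hc) (proj_entry_le hR hR2)
    rw [Matrix.sub_mul, haR, Matrix.trace_sub, Complex.sub_re, hRtr, Complex.natCast_re,
      Matrix.trace_mul_comm] at hb1
    linarith
  have hsum : ((mc q θ : ℝ) + q * finrank ℂ S) ≤ ∑ l, ∑ c ∈ Finset.range q,
      (finrank ℂ ↥(S ⊓ Es (a l) (θ l) c) : ℝ) := by exact_mod_cast hS
  have hsum2 : ∑ l, ∑ c ∈ Finset.range q, (finrank ℂ ↥(S ⊓ Es (a l) (θ l) c) : ℝ) ≤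
      ∑ l : Fin s, ∑ c ∈ Finset.range q, ((P * (u l * ind (θ l) c * (u l)ᴴ)).trace.re + d * (d * ε)) :=
    Finset.sum_le_sum fun l _ => Finset.sum_le_sum fun c hc => key l c hc
  have hsum3 : ∑ l : Fin s, ∑ c ∈ Finset.range q,
      ((P * (u l * ind (θ l) c * (u l)ᴴ)).trace.re + d * (d * ε)) =
      ∑ l, (P * (u l * Matrix.diagonal (fun j => (θ l j : ℂ)) * (u l)ᴴ)).trace.re
        + s * (q * (d * (d * ε))) := by
    simp only [Finset.sum_add_distrib]
    congr 1
    · refine Finset.sum_congr rfl fun l _ => ?_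
      rw [← sum_ind (θ l) (hθ l), Matrix.mul_sum, Matrix.sum_mul, Matrix.mul_sum, Matrix.trace_sum,
        Complex.re_sum]
    · simp
  have hPh := h P hP hP2
  rw [hPtr, Complex.natCast_re] at hPh
  have hlt : (mc q θ : ℝ) < 1 := by linarith
  have h0 : mc q θ = 0 := by
    have : mc q θ < 1 := by exact_mod_cast hlt
    omega
  obtain ⟨a0, b0, h1⟩ := exists_mc q θ
  exact ⟨a0, b0, h1.trans h0⟩
end LemB3
end Part5

section Part6
open Module Matrix Topology Filter
set_option linter.unusedSectionVars false
set_option linter.unusedSimpArgs false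
set_option linter.unusedVariables false

section LemA
variable {s d q r : ℕ}

/-- integer version of `GammaT` -/
def GN {d r : ℕ} (J : Fin d → Fin r) (k : Fin d) : ℕ := (r - d) + k - J k

lemma strictMono_ge {J : Fin d → Fin r} (hJ : StrictMono J) : ∀ (n : ℕ) (h : n < d), n ≤ (J ⟨n, h⟩ : ℕ) := by
  intro n
  induction n with
  | zero => intro h; exact Nat.zero_le _
  | succ n ih =>
    intro h
    have h1 := ih (by omega)
    have h2 : J ⟨n, by omega⟩ < J ⟨n + 1, h⟩ := hJ (by simp [Fin.lt_def])
    rw [Fin.lt_def] at h2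
    omega

lemma strictMono_le {J : Fin d → Fin r} (hJ : StrictMono J) (k : Fin d) : (J k : ℕ) + d ≤ r + k := by
  have := strictMono_ge (J := fun i => Fin.rev (J (Fin.rev i)))
    (fun i j h => by
      rw [Fin.rev_lt_rev]; exact hJ (Fin.rev_lt_rev.2 h)) (d - 1 - k) (by omega)
  have e : Fin.rev (⟨d - 1 - k, by omega⟩ : Fin d) = k := by
    ext; simp [Fin.val_rev]; omega
  simp only [e, Fin.val_rev] at this
  omega

lemma fin_lower {n : ℕ} (A : Finset (Fin n)) (hA : ∀ c ∈ A, ∀ c' ≤ c, c' ∈ A) (c : Fin n) :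
    (c : ℕ) < A.card ↔ c ∈ A := by
  constructor
  · intro h
    by_contra hn
    have : A ⊆ Finset.univ.filter fun x : Fin n => (x : ℕ) < c := by
      intro x hx
      simp only [Finset.mem_filter, Finset.mem_univ, true_and]
      by_contra hxc
      exact hn (hA x hx c (by rw [Fin.le_def]; omega))
    have := Finset.card_le_card this
    rw [Fin.card_filter_val_lt] at this
    omega
  · intro h
    have : (Finset.univ.filter fun x : Fin n => (x : ℕ) < c + 1) ⊆ A := by
      intro x hx
      simp only [Finset.mem_filter, Finset.mem_univ, true_and] at hx
      exact hA c h x (by rw [Fin.le_def]; omega)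
    have := Finset.card_le_card this
    rw [Fin.card_filter_val_lt] at this
    omega

lemma exists_split (J : Fin d → Fin r) (hJ : StrictMono J) (hdr : d ≤ r) :
    ∃ e : Fin d ⊕ Fin (r - d) ≃ Fin r, (∀ k, e (Sum.inl k) = J k) ∧
      ∀ (c : Fin (r - d)) k, (c : ℕ) < GN J k ↔ J k < e (Sum.inr c) := by
  classical
  let S : Finset (Fin r) := Finset.univ.image J
  have hS : S.card = d := by
    rw [Finset.card_image_of_injective _ hJ.injective]; simp
  have hSc : Sᶜ.card = r - d := by rw [Finset.card_compl, hS]; simp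
  let e0 := finSumEquivOfFinset hS hSc
  let e : Fin d ⊕ Fin (r - d) ≃ Fin r := (Equiv.sumCongr (Equiv.refl _) Fin.revPerm).trans e0
  have he1 : ∀ k, e (Sum.inl k) = J k := by
    intro k
    have := Finset.orderEmbOfFin_unique hS (f := J) (fun x => by simp [S]) hJ
    simp only [e, Equiv.trans_apply, Equiv.sumCongr_apply, Sum.map_inl, Equiv.refl_apply, e0,
      finSumEquivOfFinset_inl]
    rw [this]
  have he2 : ∀ c c' : Fin (r - d), c' ≤ c → e (Sum.inr c) ≤ e (Sum.inr c') := by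
    intro c c' h
    simp only [e, Equiv.trans_apply, Equiv.sumCongr_apply, Sum.map_inr, e0,
      finSumEquivOfFinset_inr]
    rw [OrderEmbedding.le_iff_le]
    simpa using h
  refine ⟨e, he1, fun c k => ?_⟩
  let A : Finset (Fin (r - d)) := Finset.univ.filter fun c => J k < e (Sum.inr c)
  have hA : A.card = GN J k := by
    have h1 : (Finset.univ.filter fun x : Fin r => J k < x).card
        = (Finset.univ.filter fun k' : Fin d => k < k').card + A.card := by
      have : (Finset.univ.filter fun x : Fin r => J k < x) =
          (Finset.univ.filter fun i : Fin d ⊕ Fin (r - d) => J k < e i).map e.toEmbedding := by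
        ext x
        simp only [Finset.mem_filter, Finset.mem_univ, true_and, Finset.mem_map, Equiv.coe_toEmbedding]
        constructor
        · intro h; exact ⟨e.symm x, by simpa using h, by simp⟩
        · rintro ⟨i, h, rfl⟩; exact h
      rw [this, Finset.card_map, Finset.card_filter, Fintype.sum_sum_type]
      simp only [he1, hJ.lt_iff_lt, A, Finset.card_filter]
    have h2 : (Finset.univ.filter fun x : Fin r => J k < x).card = r - 1 - J k := by
      rw [show (Finset.univ.filter fun x : Fin r => J k < x) = Finset.Ioi (J k) by ext; simp]
      simp
    have h3 : (Finset.univ.filter fun k' : Fin d => k < k').card = d - 1 - k := by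
      rw [show (Finset.univ.filter fun x : Fin d => k < x) = Finset.Ioi k by ext; simp]
      simp
    have h4 := strictMono_le hJ k
    have h5 := strictMono_ge hJ k k.2
    simp only [Fin.eta] at h5
    have h6 := (J k).2
    have h7 := k.2
    simp only [GN]
    omega
  rw [← hA, fin_lower A _ c]
  · simp [A]
  · intro c hc c' h
    simp only [A, Finset.mem_filter, Finset.mem_univ, true_and] at hc ⊢
    exact lt_of_lt_of_le hc (he2 c c' h)

end LemA

section LemA2
attribute [local instance] Matrix.linftyOpNormedAddCommGroup Matrix.linftyOpNormedSpace
  Matrix.linftyOpNormedRing Matrix.linftyOpNormedAlgebra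

lemma product_nhds {s : ℕ} {I E : Type} [Fintype I] [DecidableEq I] [NormedAddCommGroup E] [NormedSpace ℂ E]
    [FiniteDimensional ℂ E] (Lu : E →ₗ[ℂ] Matrix I I ℂ) (Lp Ly : Fin s → E →ₗ[ℂ] Matrix I I ℂ) (x0 : E)
    (hu0 : Lu x0 = 0) (hy0 : ∀ l, Ly l x0 = 0)
    (hsurj : ∀ m : Fin s → Matrix I I ℂ, ∃ v : E, ∀ l,
      Lu v * Lp l x0 + Lp l v + Lp l x0 * Ly l v = m l) :
    Set.range (fun x l => (1 + Lu x) * Lp l x * (1 + Ly l x)) ∈ 𝓝 (fun l => Lp l x0) := by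
  have : CompleteSpace E := FiniteDimensional.complete ℂ E
  have : CompleteSpace (Fin s → Matrix I I ℂ) := FiniteDimensional.complete ℂ _
  have hl : ∀ l, ∃ D : E →L[ℂ] Matrix I I ℂ, HasStrictFDerivAt
      (fun x => (1 + Lu x) * Lp l x * (1 + Ly l x)) D x0 ∧
      ∀ v, D v = Lu v * Lp l x0 + Lp l v + Lp l x0 * Ly l v := by
    intro l
    have h1 : HasStrictFDerivAt (fun x => 1 + Lu x) (LinearMap.toContinuousLinearMap Lu) x0 :=
      (LinearMap.toContinuousLinearMap Lu).hasStrictFDerivAt.const_add 1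
    have h2 : HasStrictFDerivAt (fun x => Lp l x) (LinearMap.toContinuousLinearMap (Lp l)) x0 :=
      (LinearMap.toContinuousLinearMap (Lp l)).hasStrictFDerivAt
    have h3 : HasStrictFDerivAt (fun x => 1 + Ly l x) (LinearMap.toContinuousLinearMap (Ly l)) x0 :=
      (LinearMap.toContinuousLinearMap (Ly l)).hasStrictFDerivAt.const_add 1
    refine ⟨_, (h1.mul' h2).mul' h3, fun v => ?_⟩
    change (1 + Lu x0) * Lp l x0 * Ly l v + ((1 + Lu x0) * Lp l v + Lu v * Lp l x0) * (1 + Ly l x0) = _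
    rw [hu0, hy0]
    simp only [add_zero, one_mul, mul_one]
    abel
  choose D hD hDv using hl
  have hΦ : HasStrictFDerivAt (fun x l => (1 + Lu x) * Lp l x * (1 + Ly l x))
      (ContinuousLinearMap.pi D) x0 := hasStrictFDerivAt_pi'.2 hD
  have hr : ((ContinuousLinearMap.pi D : E →L[ℂ] (Fin s → Matrix I I ℂ)) :
      E →ₗ[ℂ] (Fin s → Matrix I I ℂ)).range = ⊤ := by
    rw [LinearMap.range_eq_top]
    intro m
    obtain ⟨v, hv⟩ := hsurj m
    refine ⟨v, ?_⟩
    funext l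
    simp [hDv, hv]
  have hm := hΦ.map_nhds_eq_of_surj hr
  have e : (fun l => (1 + Lu x0) * Lp l x0 * (1 + Ly l x0)) = fun l => Lp l x0 := by
    funext l; simp [hu0, hy0]
  rw [e] at hm
  have := Filter.range_mem_map (f := 𝓝 x0) (m := (fun x l => (1 + Lu x) * Lp l x * (1 + Ly l x)))
  rw [hm] at this
  exact this
end LemA2


section LemA3
variable {s d q r : ℕ}

lemma exists_unit_pair (θ : Fin s → Fin d → ℕ) (a0 : Fin s → Matrix (Fin d) (Fin d) ℂ)
    (b0 : Fin s → Matrix (Fin q) (Fin q) ℂ) (h : nul θ a0 b0 = 0) :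
    ∃ b : Fin s → Matrix (Fin q) (Fin q) ℂ, nul θ a0 b = 0 ∧ ∀ l, IsUnit (b l).det := by
  have ho : IsOpen {b : Fin s → Matrix (Fin q) (Fin q) ℂ | nul θ a0 b ≤ 0} :=
    (isOpen_nul θ 0).preimage (f := fun b => (a0, b)) (by fun_prop)
  obtain ⟨b, hb1, hb2⟩ := dense_unit.inter_open_nonempty _ ho ⟨b0, h.le⟩
  exact ⟨b, Nat.le_zero.1 hb1, hb2⟩

abbrev EA (s d p : ℕ) := ((Fin p → Fin d → ℂ) × (Fin s → (Fin d ⊕ Fin p) → (Fin d ⊕ Fin p) → ℂ)) ×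
    (Fin s → Fin p → Fin d → ℂ)

lemma lemA (hdr : d ≤ r) (J : Fin s → Fin d → Fin r) (hJ : ∀ l, StrictMono (J l))
    (hJ0 : ∃ (a : Fin s → Matrix (Fin d) (Fin d) ℂ) (b : Fin s → Matrix (Fin (r - d)) (Fin (r - d)) ℂ),
      nul (fun l => GN (J l)) a b = 0)
    (θ : Fin s → Fin r → ℕ) (hθ : ∀ l j, θ l j ≤ q) (hanti : ∀ l, Antitone (θ l))
    (h1 : ∃ (a : Fin s → Matrix (Fin r) (Fin r) ℂ) (b : Fin s → Matrix (Fin q) (Fin q) ℂ),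
      nul θ a b = 0) :
    ∑ l, ∑ k, θ l (J l k) ≤ q * d := by
  obtain ⟨a0, b0', h0'⟩ := hJ0
  obtain ⟨b0, h0, hb0⟩ := exists_unit_pair _ a0 b0' h0'
  obtain ⟨a1, b1, h1⟩ := h1
  choose e he1 he2 using fun l => exists_split (J l) (hJ l) hdr
  have e0 : Fin d ⊕ Fin (r - d) ≃ Fin r := finSumFinEquiv.trans (finCongr (by omega))
  let Lu : EA s d (r - d) →ₗ[ℂ] Matrix (Fin d ⊕ Fin (r - d)) (Fin d ⊕ Fin (r - d)) ℂ :=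
    { toFun := fun x => Matrix.fromBlocks 0 0 (Matrix.of x.1.1) 0
      map_add' := by intro x y; ext (i|i) (j|j) <;> simp
      map_smul' := by intro k x; ext (i|i) (j|j) <;> simp }
  let Lp : Fin s → EA s d (r - d) →ₗ[ℂ] Matrix (Fin d ⊕ Fin (r - d)) (Fin d ⊕ Fin (r - d)) ℂ := fun l =>
    { toFun := fun x => Matrix.fromBlocks (Matrix.of (x.1.2 l)).toBlocks₁₁
        (Matrix.of (x.1.2 l)).toBlocks₁₂ 0 (Matrix.of (x.1.2 l)).toBlocks₂₂
      map_add' := by intro x y; ext (i|i) (j|j) <;> simp [Matrix.toBlocks₁₁, Matrix.toBlocks₁₂, Matrix.toBlocks₂₂]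
      map_smul' := by intro k x; ext (i|i) (j|j) <;> simp [Matrix.toBlocks₁₁, Matrix.toBlocks₁₂, Matrix.toBlocks₂₂] }
  let Y : Fin s → EA s d (r - d) → Matrix (Fin (r - d)) (Fin d) ℂ := fun l x =>
    Matrix.of fun c k => if GN (J l) k ≤ c then x.2 l c k else 0
  let Ly : Fin s → EA s d (r - d) →ₗ[ℂ] Matrix (Fin d ⊕ Fin (r - d)) (Fin d ⊕ Fin (r - d)) ℂ := fun l =>
    { toFun := fun x => Matrix.fromBlocks 0 0 (Y l x) 0
      map_add' := by
        intro x y; ext (i|i) (j|j) <;> simp [Y]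
        split_ifs <;> simp
      map_smul' := by intro k x; ext (i|i) (j|j) <;> simp [Y] }
  let x0 : EA s d (r - d) := ((0, fun l i j => Matrix.fromBlocks (a0 l) 0 0 (b0 l)⁻¹ i j), 0)
  have hu0 : Lu x0 = 0 := by ext (i|i) (j|j) <;> simp [Lu, x0]
  have hy0 : ∀ l, Ly l x0 = 0 := by intro l; ext (i|i) (j|j) <;> simp [Ly, Y, x0]
  have hp0 : ∀ l, Lp l x0 = Matrix.fromBlocks (a0 l) 0 0 (b0 l)⁻¹ := by
    intro l
    ext (i|i) (j|j) <;> simp [Lp, x0, Matrix.toBlocks₁₁, Matrix.toBlocks₁₂, Matrix.toBlocks₂₂]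
  have hnh := product_nhds Lu Lp Ly x0 hu0 hy0 (by
    intro m
    obtain ⟨v, hv⟩ := duality _ a0 b0 h0 (fun l => b0 l * (m l).toBlocks₂₁)
    let y : Fin s → Matrix (Fin (r - d)) (Fin d) ℂ := fun l => b0 l * ((m l).toBlocks₂₁ - v * a0 l)
    refine ⟨((v, m), y), fun l => ?_⟩
    have hY : Y l ((v, m), y) = y l := by
      ext c k
      simp only [Y, Matrix.of_apply]
      split_ifs with hc
      · rfl
      · have := hv l k c (by omega)
        simp only [y, Matrix.mul_sub, Matrix.sub_apply, ← Matrix.mul_assoc, this, sub_self]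
    rw [hp0]
    have h1 : Ly l ((v, m), y) = Matrix.fromBlocks 0 0 (y l) 0 := by
      rw [← hY]; rfl
    have h2 : Lu ((v, m), y) = Matrix.fromBlocks 0 0 v 0 := rfl
    have h3 : Lp l ((v, m), y) = Matrix.fromBlocks (m l).toBlocks₁₁ (m l).toBlocks₁₂ 0 (m l).toBlocks₂₂ := rfl
    rw [h1, h2, h3]
    conv_rhs => rw [← Matrix.fromBlocks_toBlocks (m l)]
    simp only [Matrix.fromBlocks_multiply, Matrix.fromBlocks_add]
    have h4 : (b0 l)⁻¹ * y l = (m l).toBlocks₂₁ - v * a0 l := by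
      simp only [y]
      rw [← Matrix.mul_assoc, Matrix.nonsing_inv_mul _ (hb0 l), Matrix.one_mul]
    simp [h4])
  let R : (Fin s → Matrix (Fin r) (Fin r) ℂ) →
      (Fin s → Matrix (Fin d ⊕ Fin (r - d)) (Fin d ⊕ Fin (r - d)) ℂ) :=
    fun a l => (a l).submatrix e0 (e l)
  let a2 : Fin s → Matrix (Fin r) (Fin r) ℂ := fun l => (Lp l x0).submatrix e0.symm (e l).symm
  have hRc : Continuous R := by
    refine continuous_pi fun l => ?_
    exact (continuous_apply l).matrix_submatrix _ _
  have hR2 : R a2 = fun l => Lp l x0 := by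
    funext l; simp [R, a2]
  rw [← hR2] at hnh
  have hpre := hRc.continuousAt.preimage_mem_nhds hnh
  obtain ⟨a, ha, ⟨x, hx⟩⟩ := (dense_nul_a θ 0 a1 b1 h1.le).inter_nhds_nonempty hpre
  have ha0 : nul θ a b1 = 0 := Nat.le_zero.1 ha
  rw [nul_eq_zero_iff] at ha0
  let A : Fin s → Matrix (Fin d) (Fin d) ℂ := fun l => (Matrix.of (x.1.2 l)).toBlocks₁₁
  have hA : nul (fun l k => θ l (J l k)) A b1 = 0 := by
    rw [nul_eq_zero_iff]
    intro Z hZ hsum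
    let X : Fin s → Matrix (Fin r) (Fin q) ℂ := fun l =>
      (Matrix.fromRows (Z l) (-(Y l x * Z l))).submatrix (e l).symm id
    have hXm : X ∈ Xsp q θ := by
      intro l j c hc
      obtain ⟨i, rfl⟩ := (e l).surjective j
      simp only [X, Matrix.submatrix_apply, Equiv.symm_apply_apply, id]
      rcases i with k | c'
      · rw [he1] at hc
        exact hZ l k c hc
      · rw [Matrix.fromRows_apply_inr, Matrix.neg_apply, Matrix.mul_apply, neg_eq_zero]
        refine Finset.sum_eq_zero fun k _ => ?_
        simp only [Y, Matrix.of_apply]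
        split_ifs with hk
        · have : e l (Sum.inr c') ≤ J l k := by
            by_contra hn
            exact absurd ((he2 l c' k).2 (not_le.1 hn)) (by omega)
          rw [hZ l k c ((hanti l this).trans hc), mul_zero]
        · rw [zero_mul]
    have hax : ∀ l, a l * X l = (Matrix.fromRows (A l * Z l) (Matrix.of x.1.1 * (A l * Z l))).submatrix e0.symm id := by
      intro l
      have hl : (a l).submatrix e0 (e l) = (1 + Lu x) * Lp l x * (1 + Ly l x) := (congrFun hx l).symm
      have hal : a l = ((1 + Lu x) * Lp l x * (1 + Ly l x)).submatrix e0.symm (e l).symm := by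
        rw [← hl]; simp
      rw [hal]
      simp only [X]
      rw [Matrix.submatrix_mul_equiv]
      congr 1
      change (1 + Matrix.fromBlocks 0 0 (Matrix.of x.1.1) 0) * (Matrix.fromBlocks (A l) _ 0 _) *
        (1 + Matrix.fromBlocks 0 0 (Y l x) 0) * _ = _
      rw [← Matrix.fromBlocks_one]
      simp only [Matrix.fromBlocks_add, Matrix.mul_assoc, Matrix.fromBlocks_mul_fromRows]
      simp
    have hX0 : ∑ l, a l * X l * b1 l = 0 := by
      have hS : ∑ l, a l * X l * b1 l = (Matrix.fromRows (∑ l, A l * Z l * b1 l)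
          (Matrix.of x.1.1 * ∑ l, (A l * Z l * b1 l))).submatrix e0.symm id := by
        rw [Matrix.mul_sum]
        have : ∀ l, a l * X l * b1 l = (Matrix.fromRows (A l * Z l * b1 l)
          (Matrix.of x.1.1 * (A l * Z l * b1 l))).submatrix e0.symm id := by
          intro l
          rw [hax]
          have hsub : ∀ (M : Matrix (Fin d ⊕ Fin (r - d)) (Fin q) ℂ) (C : Matrix (Fin q) (Fin q) ℂ),
              M.submatrix e0.symm id * C = (M * C).submatrix e0.symm id := by
            intro M C; ext i c; simp [Matrix.mul_apply]
          rw [hsub, Matrix.fromRows_mul]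
          simp only [Matrix.mul_assoc]
        rw [Finset.sum_congr rfl fun l _ => this l]
        ext i c
        obtain ⟨i, rfl⟩ := e0.surjective i
        rcases i with i | i <;> simp [Matrix.sum_apply]
      rw [hS, hsum]
      ext i c
      obtain ⟨i, rfl⟩ := e0.surjective i
      rcases i with i | i <;> simp
    have := ha0 X hXm hX0
    funext l
    ext k c
    have h5 := congrFun (congrFun (congrFun this l) (e l (Sum.inl k))) c
    simpa [X] using h5
  have h6 := rank_add_nul (fun l k => θ l (J l k)) A b1
  rw [hA, finrank_Xsp _ (fun l k => hθ l _), add_zero] at h6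
  rw [← h6]
  refine (Submodule.finrank_le _).trans ?_
  rw [Module.finrank_matrix]
  simp [mul_comm]
end LemA3
end Part6

section Part7
open Module Matrix Topology Filter
set_option linter.unusedSectionVars false
set_option linter.unusedSimpArgs false
set_option linter.unusedVariables false

section Spec
variable {s d q r : ℕ}

lemma herm_diag {n : ℕ} (A : Matrix (Fin n) (Fin n) ℂ) (hA : A.IsHermitian) :
    ∃ u : Matrix (Fin n) (Fin n) ℂ, u * uᴴ = 1 ∧
      A = u * Matrix.diagonal (fun i => (hA.eigenvalues i : ℂ)) * uᴴ := by
  refine ⟨hA.eigenvectorUnitary, ?_, ?_⟩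
  · exact Unitary.coe_mul_star_self hA.eigenvectorUnitary
  · have := hA.spectral_theorem
    rw [Unitary.conjStarAlgAut_apply] at this
    exact this

lemma unitary_swap {n : ℕ} {u : Matrix (Fin n) (Fin n) ℂ} (h : u * uᴴ = 1) : uᴴ * u = 1 :=
  mul_eq_one_comm.1 h

lemma perm_unitary {n : ℕ} (e : Equiv.Perm (Fin n)) (x : Fin n → ℂ) :
    ∃ p : Matrix (Fin n) (Fin n) ℂ, p * pᴴ = 1 ∧
      Matrix.diagonal x = p * Matrix.diagonal (fun i => x (e i)) * pᴴ := by
  refine ⟨(1 : Matrix (Fin n) (Fin n) ℂ).submatrix id e, ?_, ?_⟩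
  · rw [Matrix.conjTranspose_submatrix, Matrix.submatrix_mul_equiv]
    simp
  · have : Matrix.diagonal (fun i => x (e i)) = (Matrix.diagonal x).submatrix e e := by
      rw [Matrix.submatrix_diagonal_equiv]; rfl
    rw [this, Matrix.conjTranspose_submatrix, Matrix.submatrix_mul_equiv, Matrix.submatrix_mul_equiv]
    simp

/-- diagonalisation with reordered eigenvalues -/
lemma herm_diag_perm {n : ℕ} (A : Matrix (Fin n) (Fin n) ℂ) (hA : A.IsHermitian)
    (e : Equiv.Perm (Fin n)) :
    ∃ u : Matrix (Fin n) (Fin n) ℂ, u * uᴴ = 1 ∧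
      A = u * Matrix.diagonal (fun i => (hA.eigenvalues (e i) : ℂ)) * uᴴ := by
  obtain ⟨u, hu, h⟩ := herm_diag A hA
  obtain ⟨p, hp, h2⟩ := perm_unitary e (fun i => (hA.eigenvalues i : ℂ))
  refine ⟨u * p, ?_, ?_⟩
  · rw [Matrix.conjTranspose_mul, Matrix.mul_assoc, ← Matrix.mul_assoc p, hp, Matrix.one_mul, hu]
  · conv_lhs => rw [h, h2]
    simp only [Matrix.conjTranspose_mul, Matrix.mul_assoc]

lemma exists_monotone_diag {n : ℕ} (A : Matrix (Fin n) (Fin n) ℂ) (hA : A.IsHermitian) :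
    ∃ (u : Matrix (Fin n) (Fin n) ℂ) (β : Fin n → ℝ), u * uᴴ = 1 ∧ Monotone β ∧
      A = u * Matrix.diagonal (fun i => (β i : ℂ)) * uᴴ := by
  obtain ⟨u, hu, h⟩ := herm_diag_perm A hA (Tuple.sort hA.eigenvalues)
  exact ⟨u, _, hu, Tuple.monotone_sort hA.eigenvalues, h⟩

lemma exists_antitone_diag {n : ℕ} (A : Matrix (Fin n) (Fin n) ℂ) (hA : A.IsHermitian) :
    ∃ (u : Matrix (Fin n) (Fin n) ℂ) (β : Fin n → ℝ), u * uᴴ = 1 ∧ Antitone β ∧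
      A = u * Matrix.diagonal (fun i => (β i : ℂ)) * uᴴ := by
  obtain ⟨u, hu, h⟩ := herm_diag_perm A hA (Fin.revPerm.trans (Tuple.sort hA.eigenvalues))
  refine ⟨u, _, hu, ?_, h⟩
  intro i j hij
  exact Tuple.monotone_sort hA.eigenvalues (Fin.rev_le_rev.2 hij)

lemma herm_conj {n m : Type*} [Fintype m] [Fintype n] [DecidableEq n] (u : Matrix m n ℂ) (x : n → ℝ) :
    (u * Matrix.diagonal (fun i => (x i : ℂ)) * uᴴ).IsHermitian := by
  rw [Matrix.IsHermitian, Matrix.conjTranspose_mul, Matrix.conjTranspose_mul,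
    Matrix.conjTranspose_conjTranspose, Matrix.diagonal_conjTranspose, Matrix.mul_assoc]
  congr 3
  ext i; simp

lemma charpoly_conj_diag {I : Type*} [Fintype I] [DecidableEq I] (u v : Matrix I I ℂ) (h : u * v = 1)
    (x : I → ℝ) : (u * Matrix.diagonal (fun i => (x i : ℂ)) * v).charpoly.roots
      = Finset.univ.val.map (fun i => (x i : ℂ)) := by
  rw [Matrix.charpoly_mul_comm, ← Matrix.mul_assoc, mul_eq_one_comm.1 h, Matrix.one_mul,
    Matrix.charpoly_diagonal, Polynomial.roots_prod _ _ (by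
      rw [Finset.prod_ne_zero_iff]; intro i _; exact Polynomial.X_sub_C_ne_zero _)]
  simp [Multiset.bind_singleton]

lemma exists_perm_of_map_eq {n : ℕ} (x y : Fin n → ℝ)
    (h : Finset.univ.val.map x = Finset.univ.val.map y) :
    ∃ e : Equiv.Perm (Fin n), ∀ i, x i = y (e i) := by
  have hx : x ∘ Tuple.sort x = y ∘ Tuple.sort y := by
    have h1 : List.ofFn (x ∘ Tuple.sort x) = List.ofFn (y ∘ Tuple.sort y) := by
      have hs : ∀ z : Fin n → ℝ, List.ofFn (z ∘ Tuple.sort z) = (Finset.univ.val.map z).sort (· ≤ ·) := by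
        intro z
        have h3 : (Finset.univ.val.map z) = ((List.ofFn (z ∘ Tuple.sort z) : List ℝ) : Multiset ℝ) := by
          rw [List.ofFn_eq_map, ← Multiset.map_coe, ← Multiset.map_map]
          congr 1
          have := congrArg Finset.val (Finset.map_univ_equiv (Tuple.sort z))
          rw [Finset.map_val] at this
          rw [← this]
          rfl
        rw [h3, Multiset.coe_sort]
        exact (List.mergeSort_eq_self _ (Tuple.monotone_sort z).sortedLE_ofFn.pairwise).symm
      rw [hs, hs, h]
    exact List.ofFn_injective h1
  refine ⟨(Tuple.sort x).symm.trans (Tuple.sort y), fun i => ?_⟩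
  have := congrFun hx ((Tuple.sort x).symm i)
  simpa using this

lemma kirwan_iff (Λ : Fin s → Fin r → ℝ) (t : ℝ) :
    KirwanMem Λ t ↔ (∀ l, Antitone (Λ l)) ∧ ∃ u : Fin s → Matrix (Fin r) (Fin r) ℂ,
      (∀ l, u l * (u l)ᴴ = 1) ∧
      ∑ l, u l * Matrix.diagonal (fun j => (Λ l j : ℂ)) * (u l)ᴴ = (t : ℂ) • 1 := by
  constructor
  · rintro ⟨h1, A, hA, hs, he⟩
    refine ⟨h1, ?_⟩
    choose e he using he
    choose u hu hu2 using fun l => herm_diag_perm (A l) (hA l) (e l)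
    refine ⟨u, hu, ?_⟩
    rw [← hs]
    refine Finset.sum_congr rfl fun l _ => ?_
    conv_rhs => rw [hu2 l]
    simp only [he]
  · rintro ⟨h1, u, hu, hs⟩
    refine ⟨h1, fun l => u l * Matrix.diagonal (fun j => (Λ l j : ℂ)) * (u l)ᴴ,
      fun l => herm_conj _ _, hs, fun l => ?_⟩
    apply exists_perm_of_map_eq
    have h2 := charpoly_conj_diag (u l) (u l)ᴴ (hu l) (Λ l)
    have h3 := (herm_conj (u l) (Λ l)).roots_charpoly_eq_eigenvalues
    have h4 := h2.symm.trans h3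
    have h5 := congrArg (Multiset.map Complex.re) h4
    rw [Multiset.map_map, Multiset.map_map] at h5
    simpa [Function.comp_def] using h5

end Spec
end Part7

section Part8
open Module Matrix Topology Filter
set_option linter.unusedSectionVars false
set_option linter.unusedSimpArgs false
set_option linter.unusedVariables false

section Var
variable {s : ℕ} {I : Type} [Fintype I] [DecidableEq I]

lemma second_deriv_nonneg (f f1 : ℝ → ℝ) (f2 : ℝ) (h0 : ∀ x, f 0 ≤ f x) (h1 : ∀ x, HasDerivAt f (f1 x) x)
    (h2 : HasDerivAt f1 f2 0) : f1 0 = 0 ∧ 0 ≤ f2 := by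
  have hmin : IsLocalMin f 0 := Filter.Eventually.of_forall h0
  have hz : f1 0 = 0 := hmin.hasDerivAt_eq_zero (h1 0)
  refine ⟨hz, ?_⟩
  by_contra hneg
  push Not at hneg
  have hd : deriv f = f1 := funext fun x => (h1 x).deriv
  have hmax : IsLocalMax f 0 := isLocalMax_of_deriv_deriv_neg (by rw [hd, h2.deriv]; exact hneg)
    (by rw [hd, hz]) (h1 0).continuousAt
  have hc : f =ᶠ[𝓝 0] fun _ => f 0 := by
    filter_upwards [hmax] with x hx
    exact le_antisymm hx (h0 x)
  have h3 : deriv f =ᶠ[𝓝 0] fun _ => 0 := by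
    have := hc.deriv
    refine this.trans ?_
    filter_upwards with x
    simp
  have h4 := h3.deriv_eq
  rw [hd, h2.deriv] at h4
  simp at h4
  exact hneg.ne h4

attribute [local instance] Matrix.linftyOpNormedAddCommGroup Matrix.linftyOpNormedSpace
  Matrix.linftyOpNormedRing Matrix.linftyOpNormedAlgebra

lemma exp_unitary (X : Matrix I I ℂ) (hX : Xᴴ = -X) (x : ℝ) :
    ∃ v : Matrix I I ℂ, v * vᴴ = 1 ∧ v = NormedSpace.exp (x • X) ∧ vᴴ = NormedSpace.exp (x • (-X)) := by
  have h1 : (NormedSpace.exp (x • X))ᴴ = NormedSpace.exp (x • (-X)) := by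
    rw [← Matrix.exp_conjTranspose, Matrix.conjTranspose_smul, hX]
    simp
  refine ⟨NormedSpace.exp (x • X), ?_, rfl, h1⟩
  rw [h1, ← Matrix.exp_add_of_commute]
  · simp
  · simp

/-- The conjugation curve. -/
noncomputable def Gc (X A : Matrix I I ℂ) (x : ℝ) : Matrix I I ℂ :=
  NormedSpace.exp (x • X) * A * NormedSpace.exp (x • (-X))

lemma Gc_deriv (X A : Matrix I I ℂ) (x : ℝ) :
    HasDerivAt (Gc X A) (Gc X (X * A - A * X) x) x := by
  have h1 : HasDerivAt (fun x : ℝ => NormedSpace.exp (x • X)) (NormedSpace.exp (x • X) * X) x :=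
    hasDerivAt_exp_smul_const X x
  have h2 : HasDerivAt (fun x : ℝ => NormedSpace.exp (x • (-X))) ((-X) * NormedSpace.exp (x • (-X))) x :=
    hasDerivAt_exp_smul_const' (-X) x
  have h3 := (h1.mul_const A).mul h2
  refine HasDerivAt.congr_deriv h3 ?_
  simp only [Gc, Matrix.mul_sub, Matrix.sub_mul, Matrix.mul_assoc, Matrix.neg_mul, Matrix.mul_neg]
  abel

lemma Gc_zero (X A : Matrix I I ℂ) : Gc X A 0 = A := by simp [Gc]

/-- real part of trace as continuous linear map -/
noncomputable def rtr : Matrix I I ℂ →L[ℝ] ℝ :=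
  LinearMap.toContinuousLinearMap
    { toFun := fun M => M.trace.re
      map_add' := by intro x y; simp
      map_smul' := by intro k x; simp }

lemma rtr_apply (M : Matrix I I ℂ) : rtr M = M.trace.re := rfl

theorem variation (A : Fin s → Matrix I I ℂ) (t : ℝ)
    (hmin : ∀ v : Fin s → Matrix I I ℂ, (∀ l, v l * (v l)ᴴ = 1) →
      ((∑ l, A l - (t : ℂ) • 1) * (∑ l, A l - (t : ℂ) • 1)).trace.re ≤
      ((∑ l, v l * A l * (v l)ᴴ - (t : ℂ) • 1) * (∑ l, v l * A l * (v l)ᴴ - (t : ℂ) • 1)).trace.re)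
    (X : Fin s → Matrix I I ℂ) (hX : ∀ l, (X l)ᴴ = - X l) :
    ((∑ l, A l - (t : ℂ) • 1) * ∑ l, (X l * A l - A l * X l)).trace.re = 0 ∧
    0 ≤ ((∑ l, (X l * A l - A l * X l)) * ∑ l, (X l * A l - A l * X l)).trace.re +
      ((∑ l, A l - (t : ℂ) • 1) * ∑ l, (X l * (X l * A l - A l * X l) - (X l * A l - A l * X l) * X l)).trace.re := by
  let C : ℝ → Matrix I I ℂ := fun x => ∑ l, Gc (X l) (A l) x - (t : ℂ) • 1
  let C1 : ℝ → Matrix I I ℂ := fun x => ∑ l, Gc (X l) (X l * A l - A l * X l) x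
  let C2 : Matrix I I ℂ := ∑ l, (X l * (X l * A l - A l * X l) - (X l * A l - A l * X l) * X l)
  have hC0 : C 0 = ∑ l, A l - (t : ℂ) • 1 := by simp [C, Gc_zero]
  have hC10 : C1 0 = ∑ l, (X l * A l - A l * X l) := by simp [C1, Gc_zero]
  have hC : ∀ x, HasDerivAt C (C1 x) x := by
    intro x
    have := (HasDerivAt.sum (u := Finset.univ) (fun l _ => Gc_deriv (X l) (A l) x)).sub_const ((t : ℂ) • (1 : Matrix I I ℂ))
    refine this.congr_of_eventuallyEq ?_
    filter_upwards with y
    simp [C]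
  have hC1 : HasDerivAt C1 C2 0 := by
    have := (HasDerivAt.sum (u := Finset.univ) (fun l _ => Gc_deriv (X l) (X l * A l - A l * X l) 0))
    simp only [Gc_zero] at this
    refine this.congr_of_eventuallyEq ?_
    filter_upwards with y
    simp [C1]
  have hcomm : ∀ M N : Matrix I I ℂ, rtr (M * N) = rtr (N * M) := by
    intro M N; rw [rtr_apply, rtr_apply, Matrix.trace_mul_comm]
  have h1 : ∀ x, HasDerivAt (fun x => rtr (C x * C x)) (2 * rtr (C x * C1 x)) x := by
    intro x
    have := rtr.hasFDerivAt.comp_hasDerivAt x ((hC x).mul (hC x))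
    refine HasDerivAt.congr_deriv this ?_
    change (C1 x * C x + C x * C1 x).trace.re = 2 * (C x * C1 x).trace.re
    rw [Matrix.trace_add, Complex.add_re, Matrix.trace_mul_comm (C1 x)]; ring
  have h2 : HasDerivAt (fun x => 2 * rtr (C x * C1 x)) (2 * (rtr (C1 0 * C1 0) + rtr (C 0 * C2))) 0 := by
    have := (rtr.hasFDerivAt.comp_hasDerivAt 0 ((hC 0).mul hC1)).const_mul 2
    refine HasDerivAt.congr_deriv this ?_
    change 2 * (C1 0 * C1 0 + C 0 * C2).trace.re = 2 * ((C1 0 * C1 0).trace.re + (C 0 * C2).trace.re)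
    rw [Matrix.trace_add, Complex.add_re]
  have := second_deriv_nonneg _ _ _ (by
    intro x
    choose v hv1 hv2 hv3 using fun l => exp_unitary (X l) (hX l) x
    have := hmin v hv1
    rw [hC0]
    simp only [rtr_apply]
    refine this.trans (le_of_eq ?_)
    simp only [hv3]
    simp only [hv2]
    rfl) h1 h2
  rw [hC0, hC10] at this
  simp only [rtr_apply] at this
  constructor
  · linarith [this.1]
  · linarith [this.2]

end Var
end Part8

section Part9
open Module Matrix Topology Filter
set_option linter.unusedSectionVars false
set_option linter.unusedSimpArgs false
set_option linter.unusedVariables false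

section Blk
variable {s d q : ℕ}

lemma frob_eq_sum {m n : Type*} [Fintype m] [Fintype n] (A : Matrix m n ℂ) :
    (Aᴴ * A).trace.re = ∑ i, ∑ j, ‖A i j‖ ^ 2 := by
  rw [Finset.sum_comm]
  simp only [Matrix.trace, Matrix.diag, Matrix.mul_apply, Complex.re_sum, Matrix.conjTranspose_apply]
  refine Finset.sum_congr rfl fun j _ => Finset.sum_congr rfl fun i _ => ?_
  rw [Complex.star_def, ← Complex.normSq_eq_conj_mul_self, Complex.ofReal_re, Complex.normSq_eq_norm_sq]

lemma frob_eq_zero {m n : Type*} [Fintype m] [Fintype n] {A : Matrix m n ℂ}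
    (h : (Aᴴ * A).trace.re ≤ 0) : A = 0 := by
  rw [frob_eq_sum] at h
  have h0 : ∑ i, ∑ j, ‖A i j‖ ^ 2 = 0 := le_antisymm h (by positivity)
  rw [Finset.sum_eq_zero_iff_of_nonneg (fun i _ => by positivity)] at h0
  ext i j
  have h1 := h0 i (Finset.mem_univ _)
  rw [Finset.sum_eq_zero_iff_of_nonneg (fun i _ => by positivity)] at h1
  have := h1 j (Finset.mem_univ _)
  simpa using this

lemma fromBlocks_sub' {n m : Type*} (a a' : Matrix n n ℂ) (b b' : Matrix n m ℂ) (c c' : Matrix m n ℂ)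
    (e e' : Matrix m m ℂ) : Matrix.fromBlocks a b c e - Matrix.fromBlocks a' b' c' e' =
    Matrix.fromBlocks (a - a') (b - b') (c - c') (e - e') := by
  ext (i|i) (j|j) <;> simp

lemma trace_fromBlocks' {n m : Type*} [Fintype n] [Fintype m] (a : Matrix n n ℂ) (b : Matrix n m ℂ) (c : Matrix m n ℂ)
    (e : Matrix m m ℂ) : (Matrix.fromBlocks a b c e).trace = a.trace + e.trace := by
  simp [Matrix.trace, Fintype.sum_sum_type]

lemma commute_of_min {I : Type} [Fintype I] [DecidableEq I] (A : Fin s → Matrix I I ℂ) (hA : ∀ l, (A l)ᴴ = A l) (t : ℝ)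
    (hmin : ∀ v : Fin s → Matrix I I ℂ, (∀ l, v l * (v l)ᴴ = 1) →
      ((∑ l, A l - (t : ℂ) • 1) * (∑ l, A l - (t : ℂ) • 1)).trace.re ≤
      ((∑ l, v l * A l * (v l)ᴴ - (t : ℂ) • 1) * (∑ l, v l * A l * (v l)ᴴ - (t : ℂ) • 1)).trace.re)
    (l : Fin s) : A l * ∑ l, A l = (∑ l, A l) * A l := by
  set B := ∑ l, A l with hB
  have hBh : Bᴴ = B := by rw [hB, Matrix.conjTranspose_sum]; exact Finset.sum_congr rfl fun l _ => hA l
  set Y := A l * B - B * A l with hY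
  have hYs : Yᴴ = -Y := by
    rw [hY, Matrix.conjTranspose_sub, Matrix.conjTranspose_mul, Matrix.conjTranspose_mul, hBh, hA]
    abel
  have h1 := (variation A t hmin (fun k => if k = l then Y else 0) (by
    intro k; split_ifs
    · exact hYs
    · simp)).1
  have h2 : ∑ k, ((if k = l then Y else 0) * A k - A k * (if k = l then Y else 0)) = Y * A l - A l * Y := by
    rw [Finset.sum_eq_single l]
    · simp
    · intro k _ hk; simp [hk]
    · simp
  rw [h2, ← hB] at h1
  have h3 : ((B - (t : ℂ) • 1) * (Y * A l - A l * Y)).trace = (Y * Y).trace := by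
    have e1 : ((B - (t : ℂ) • 1) * (Y * A l - A l * Y)).trace =
        (B * (Y * A l)).trace - (B * (A l * Y)).trace - (t : ℂ) * ((Y * A l).trace - (A l * Y).trace) := by
      rw [Matrix.sub_mul, Matrix.trace_sub, Matrix.mul_sub, Matrix.trace_sub, Matrix.smul_mul,
        Matrix.trace_smul, Matrix.one_mul, Matrix.trace_sub, smul_eq_mul]
    rw [e1, Matrix.trace_mul_comm Y (A l), sub_self, mul_zero, sub_zero]
    have e2 : (B * (Y * A l)).trace = (A l * B * Y).trace := by
      rw [← Matrix.mul_assoc, Matrix.trace_mul_comm, Matrix.mul_assoc]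
    have e3 : Y * Y = A l * B * Y - B * A l * Y := by
      conv_lhs => rw [hY]
      rw [← hY, Matrix.sub_mul]
    rw [e2, e3, Matrix.trace_sub, Matrix.mul_assoc B]
  have h4 : Y = 0 := by
    apply frob_eq_zero
    rw [hYs, Matrix.neg_mul, Matrix.trace_neg, Complex.neg_re, ← h3, h1]
    simp
  rw [hY] at h4
  exact sub_eq_zero.1 h4

lemma second_block (A1 : Fin s → Matrix (Fin d) (Fin d) ℂ) (A2 : Fin s → Matrix (Fin q) (Fin q) ℂ)
    (hA1 : ∀ l, (A1 l)ᴴ = A1 l) (hA2 : ∀ l, (A2 l)ᴴ = A2 l) (t μ : ℝ) (m : Fin q → ℝ) (hm : ∀ i, 0 < m i)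
    (hs1 : ∑ l, A1 l = (μ : ℂ) • 1) (hs2 : ∑ l, A2 l = Matrix.diagonal (fun i => ((μ - m i : ℝ) : ℂ)))
    (hmin : ∀ v : Fin s → Matrix (Fin d ⊕ Fin q) (Fin d ⊕ Fin q) ℂ, (∀ l, v l * (v l)ᴴ = 1) →
      ((∑ l, Matrix.fromBlocks (A1 l) 0 0 (A2 l) - (t : ℂ) • 1) * (∑ l, Matrix.fromBlocks (A1 l) 0 0 (A2 l) - (t : ℂ) • 1)).trace.re ≤
      ((∑ l, v l * Matrix.fromBlocks (A1 l) 0 0 (A2 l) * (v l)ᴴ - (t : ℂ) • 1) * (∑ l, v l * Matrix.fromBlocks (A1 l) 0 0 (A2 l) * (v l)ᴴ - (t : ℂ) • 1)).trace.re)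
    (x : Fin s → Matrix (Fin q) (Fin d) ℂ) (h0 : ∑ l, (x l * A1 l - A2 l * x l) = 0) :
    ∑ l, (Matrix.diagonal (fun i => (m i : ℂ)) * ((x l * A1 l - A2 l * x l) * (x l)ᴴ)).trace.re ≤ 0 := by
  have hv := (variation (fun l => Matrix.fromBlocks (A1 l) 0 0 (A2 l)) t hmin
    (fun l => Matrix.fromBlocks 0 (-(x l)ᴴ) (x l) 0) (by
      intro l; rw [Matrix.fromBlocks_conjTranspose]; simp [Matrix.fromBlocks_neg])).2
  set w : Fin s → Matrix (Fin q) (Fin d) ℂ := fun l => x l * A1 l - A2 l * x l with hw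
  have hwl : ∀ l, x l * A1 l - A2 l * x l = w l := fun l => rfl
  have hwh : ∀ l, (w l)ᴴ = A1 l * (x l)ᴴ - (x l)ᴴ * A2 l := by
    intro l
    rw [hw]; simp only [Matrix.conjTranspose_sub, Matrix.conjTranspose_mul, hA1, hA2]
  have e1 : ∀ l, Matrix.fromBlocks 0 (-(x l)ᴴ) (x l) 0 * Matrix.fromBlocks (A1 l) 0 0 (A2 l) -
      Matrix.fromBlocks (A1 l) 0 0 (A2 l) * Matrix.fromBlocks 0 (-(x l)ᴴ) (x l) 0 =
      Matrix.fromBlocks 0 (w l)ᴴ (w l) 0 := by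
    intro l
    rw [Matrix.fromBlocks_multiply, Matrix.fromBlocks_multiply, fromBlocks_sub', hwh, ← hwl]
    congr 1 <;> simp
    abel
  have e2 : ∀ l, Matrix.fromBlocks 0 (-(x l)ᴴ) (x l) 0 * Matrix.fromBlocks 0 (w l)ᴴ (w l) 0 -
      Matrix.fromBlocks 0 (w l)ᴴ (w l) 0 * Matrix.fromBlocks 0 (-(x l)ᴴ) (x l) 0 =
      Matrix.fromBlocks (-((x l)ᴴ * w l) - (w l)ᴴ * x l) 0 0 (x l * (w l)ᴴ + w l * (x l)ᴴ) := by
    intro l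
    rw [Matrix.fromBlocks_multiply, Matrix.fromBlocks_multiply, fromBlocks_sub']
    congr 1 <;> simp
  have sumB : ∀ (a : Fin s → Matrix (Fin d) (Fin d) ℂ) (b : Fin s → Matrix (Fin d) (Fin q) ℂ)
      (c : Fin s → Matrix (Fin q) (Fin d) ℂ) (d' : Fin s → Matrix (Fin q) (Fin q) ℂ),
      ∑ l, Matrix.fromBlocks (a l) (b l) (c l) (d' l) =
      Matrix.fromBlocks (∑ l, a l) (∑ l, b l) (∑ l, c l) (∑ l, d' l) := by
    intro a b c d'
    ext (i|i) (j|j) <;> simp [Matrix.sum_apply]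
  have e3 : ∑ l, Matrix.fromBlocks (A1 l) 0 0 (A2 l) - (t : ℂ) • 1 =
      Matrix.fromBlocks (((μ - t : ℝ) : ℂ) • 1) 0 0 (((μ - t : ℝ) : ℂ) • 1 - Matrix.diagonal (fun i => (m i : ℂ))) := by
    have := sumB A1 (fun _ => 0) (fun _ => 0) A2
    rw [this, ← Matrix.fromBlocks_one, Matrix.fromBlocks_smul, fromBlocks_sub', hs1, hs2]
    congr 1
    · rw [← sub_smul]; simp
    · simp
    · simp
    · ext i j
      by_cases h : i = j
      · subst h; simp; ring
      · simp [h]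
  have h0' : ∑ l, w l = 0 := h0
  have h0h : ∑ l, (w l)ᴴ = 0 := by rw [← Matrix.conjTranspose_sum, h0']; simp
  rw [e3] at hv
  simp only [e1, e2, sumB, h0', h0h] at hv
  have key : ∀ l, (((μ - t : ℝ) : ℂ) • (1 : Matrix (Fin d) (Fin d) ℂ) * (-((x l)ᴴ * w l) - (w l)ᴴ * x l)).trace.re +
      ((((μ - t : ℝ) : ℂ) • 1 - Matrix.diagonal (fun i => (m i : ℂ))) * (x l * (w l)ᴴ + w l * (x l)ᴴ)).trace.re =
      - 2 * (Matrix.diagonal (fun i => (m i : ℂ)) * (w l * (x l)ᴴ)).trace.re := by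
    intro l
    have k1 : (Matrix.diagonal (fun i => (m i : ℂ)) * (x l * (w l)ᴴ)).trace.re =
        (Matrix.diagonal (fun i => (m i : ℂ)) * (w l * (x l)ᴴ)).trace.re := by
      have : (Matrix.diagonal (fun i => (m i : ℂ)) * (w l * (x l)ᴴ)).trace =
          star (Matrix.diagonal (fun i => (m i : ℂ)) * (x l * (w l)ᴴ)).trace := by
        rw [← Matrix.trace_conjTranspose, Matrix.conjTranspose_mul, Matrix.conjTranspose_mul,
          Matrix.conjTranspose_conjTranspose, Matrix.diagonal_conjTranspose, Matrix.trace_mul_comm]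
        congr 3
        ext i; simp
      rw [this]; simp
    rw [Matrix.sub_mul, Matrix.trace_sub, Matrix.smul_mul, Matrix.smul_mul, Matrix.one_mul, Matrix.one_mul,
      Matrix.mul_add, Matrix.trace_smul, Matrix.trace_smul, Matrix.trace_add, Matrix.trace_sub, Matrix.trace_neg,
      Matrix.trace_add, Matrix.trace_mul_comm (x l)ᴴ, Matrix.trace_mul_comm (w l)ᴴ, Complex.sub_re, Complex.add_re, k1]
    simp only [smul_eq_mul, Complex.re_ofReal_mul, Complex.sub_re, Complex.add_re, Complex.neg_re]
    ring
  have k2 : (0 : ℝ) ≤ ∑ l, (- 2 * (Matrix.diagonal (fun i => (m i : ℂ)) * (w l * (x l)ᴴ)).trace.re) := by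
    refine hv.trans (le_of_eq ?_)
    rw [← Finset.sum_congr rfl fun l _ => key l]
    conv_rhs => rw [Finset.sum_add_distrib]
    rw [Matrix.fromBlocks_multiply, Matrix.fromBlocks_multiply, trace_fromBlocks', trace_fromBlocks']
    simp only [Finset.sum_const_zero, Matrix.mul_zero, Matrix.zero_mul, add_zero, zero_add, Matrix.trace_zero,
      Complex.zero_re, Matrix.mul_sum, Matrix.trace_sum, Complex.add_re, Complex.re_sum]
  rw [← Finset.mul_sum] at k2
  linarith

lemma second_block_z (A1 : Fin s → Matrix (Fin d) (Fin d) ℂ) (A2 : Fin s → Matrix (Fin q) (Fin q) ℂ)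
    (hA1 : ∀ l, (A1 l)ᴴ = A1 l) (hA2 : ∀ l, (A2 l)ᴴ = A2 l) (t μ : ℝ) (m : Fin q → ℝ) (hm : ∀ i, 0 < m i)
    (hs1 : ∑ l, A1 l = (μ : ℂ) • 1) (hs2 : ∑ l, A2 l = Matrix.diagonal (fun i => ((μ - m i : ℝ) : ℂ)))
    (hcom : ∀ l, A2 l * Matrix.diagonal (fun i => (m i : ℂ)) = Matrix.diagonal (fun i => (m i : ℂ)) * A2 l)
    (hmin : ∀ v : Fin s → Matrix (Fin d ⊕ Fin q) (Fin d ⊕ Fin q) ℂ, (∀ l, v l * (v l)ᴴ = 1) →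
      ((∑ l, Matrix.fromBlocks (A1 l) 0 0 (A2 l) - (t : ℂ) • 1) * (∑ l, Matrix.fromBlocks (A1 l) 0 0 (A2 l) - (t : ℂ) • 1)).trace.re ≤
      ((∑ l, v l * Matrix.fromBlocks (A1 l) 0 0 (A2 l) * (v l)ᴴ - (t : ℂ) • 1) * (∑ l, v l * Matrix.fromBlocks (A1 l) 0 0 (A2 l) * (v l)ᴴ - (t : ℂ) • 1)).trace.re)
    (z : Fin s → Matrix (Fin q) (Fin d) ℂ) (h0 : ∑ l, (z l * A1 l - A2 l * z l) = 0) :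
    ∑ l, ((z l * A1 l - A2 l * z l) * (z l)ᴴ).trace.re ≤ 0 := by
  let h : Matrix (Fin q) (Fin q) ℂ := Matrix.diagonal (fun i => (((Real.sqrt (m i))⁻¹ : ℝ) : ℂ))
  have hh : hᴴ = h := by
    simp only [h, Matrix.diagonal_conjTranspose]
    congr 1; ext i; simp
  have hcomh : ∀ l, A2 l * h = h * A2 l := by
    intro l
    ext i j
    have h1 := congrFun (congrFun (hcom l) i) j
    rw [Matrix.mul_diagonal, Matrix.diagonal_mul] at h1
    rw [Matrix.mul_diagonal, Matrix.diagonal_mul]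
    by_cases h2 : A2 l i j = 0
    · simp [h2]
    · have h3 : (m j : ℂ) = m i := by
        rw [mul_comm] at h1; exact mul_right_cancel₀ h2 h1
      have h4 : m j = m i := by exact_mod_cast h3
      rw [h4, mul_comm]
  have hmh : h * Matrix.diagonal (fun i => (m i : ℂ)) * h = 1 := by
    simp only [h, Matrix.diagonal_mul_diagonal, ← Matrix.diagonal_one]
    congr 1; ext i
    have : (Real.sqrt (m i))⁻¹ * m i * (Real.sqrt (m i))⁻¹ = 1 := by
      have h5 := (Real.sqrt_pos.2 (hm i)).ne'
      field_simp
      exact (Real.sq_sqrt (hm i).le).symm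
    exact_mod_cast this
  have hw : ∀ l, h * z l * A1 l - A2 l * (h * z l) = h * (z l * A1 l - A2 l * z l) := by
    intro l
    rw [← Matrix.mul_assoc, hcomh, Matrix.mul_sub, Matrix.mul_assoc, Matrix.mul_assoc]
  have := second_block A1 A2 hA1 hA2 t μ m hm hs1 hs2 hmin (fun l => h * z l) (by
    simp only [hw]
    rw [← Matrix.mul_sum, h0, Matrix.mul_zero])
  refine le_trans (le_of_eq ?_) this
  refine Finset.sum_congr rfl fun l _ => ?_
  rw [hw, Matrix.conjTranspose_mul, hh]
  congr 1
  generalize z l * A1 l - A2 l * z l = ω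
  have e : ω * (z l)ᴴ = h * (Matrix.diagonal (fun i => (m i : ℂ)) * (h * ω * (z l)ᴴ)) := by
    have := congrArg (fun M => M * (ω * (z l)ᴴ)) hmh
    simp only [Matrix.one_mul, Matrix.mul_assoc] at this
    simp only [Matrix.mul_assoc]
    exact this.symm
  rw [e, Matrix.trace_mul_comm]
  simp only [Matrix.mul_assoc]

end Blk
end Part9

section Part10
open Module Matrix Topology Filter
set_option linter.unusedSectionVars false
set_option linter.unusedSimpArgs false
set_option linter.unusedVariables false

section Comb
variable {s d r : ℕ}

lemma card_of_map_eq {I K : Type*} [Fintype I] [Fintype K] (x : I → ℝ) (y : K → ℝ)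
    (h : (Finset.univ : Finset I).val.map x = (Finset.univ : Finset K).val.map y) (p : ℝ → Prop) [DecidablePred p] :
    (Finset.univ.filter fun i => p (x i)).card = (Finset.univ.filter fun i => p (y i)).card := by
  have := congrArg (Multiset.countP p) h
  rw [Multiset.countP_map, Multiset.countP_map] at this
  exact this

lemma roots_blocks {q : ℕ} (a : Matrix (Fin d) (Fin d) ℂ) (b : Matrix (Fin q) (Fin q) ℂ) (ha : a * aᴴ = 1)
    (hb : b * bᴴ = 1) (α : Fin d → ℝ) (β : Fin q → ℝ) :
    (Matrix.fromBlocks (a * Matrix.diagonal (fun i => (α i : ℂ)) * aᴴ) 0 0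
      (b * Matrix.diagonal (fun i => (β i : ℂ)) * bᴴ)).charpoly.roots =
      Finset.univ.val.map (fun i => ((Sum.elim α β i : ℝ) : ℂ)) := by
  rw [← charpoly_conj_diag (Matrix.fromBlocks a 0 0 b) (Matrix.fromBlocks aᴴ 0 0 bᴴ) (by
    rw [Matrix.fromBlocks_multiply]; simp [ha, hb])]
  have : Matrix.diagonal (fun i => ((Sum.elim α β i : ℝ) : ℂ)) = Matrix.fromBlocks
      (Matrix.diagonal (fun i => (α i : ℂ))) 0 0 (Matrix.diagonal (fun i => (β i : ℂ))) := by
    ext (i|i) (j|j) <;> simp [Matrix.diagonal_apply]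
  rw [this, Matrix.fromBlocks_multiply, Matrix.fromBlocks_multiply]
  simp

/-- the combinatorial part for a single index -/
lemma comb_one (hdr : d ≤ r) (Λ : Fin r → ℝ) (hΛ : Antitone Λ) (α : Fin d → ℝ) (hα : Antitone α)
    (β : Fin (r - d) → ℝ) (hβ : Monotone β)
    (h : (Finset.univ : Finset (Fin r)).val.map Λ = (Finset.univ : Finset (Fin d ⊕ Fin (r - d))).val.map (Sum.elim α β)) :
    ∃ J : Fin d → Fin r, StrictMono J ∧ (∀ k, Λ (J k) = α k) ∧
      (∀ k (c : Fin (r - d)), (c : ℕ) < GN J k ↔ β c < α k) ∧ ∀ k, GN J k ≤ r - d := by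
  let g : Fin d → ℕ := fun k => (Finset.univ.filter fun c => β c < α k).card
  have hg : ∀ k, g k ≤ r - d := by
    intro k
    exact (Finset.card_le_univ _).trans (by simp)
  have hganti : ∀ k k', k ≤ k' → g k' ≤ g k := by
    intro k k' hk
    apply Finset.card_le_card
    intro c hc
    simp only [Finset.mem_filter, Finset.mem_univ, true_and] at hc ⊢
    exact lt_of_lt_of_le hc (hα hk)
  have hgc : ∀ k (c : Fin (r - d)), (c : ℕ) < g k ↔ β c < α k := by
    intro k c
    rw [fin_lower _ _ c]
    · simp
    · intro c hc c' hcc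
      simp only [Finset.mem_filter, Finset.mem_univ, true_and] at hc ⊢
      exact lt_of_le_of_lt (hβ hcc) hc
  let J : Fin d → Fin r := fun k => ⟨k + (r - d) - g k, by have := k.2; omega⟩
  have hGN : ∀ k, GN J k = g k := by
    intro k
    simp only [GN, J]
    have := hg k
    omega
  have hcount : ∀ p : ℝ → Prop, ∀ [DecidablePred p], (Finset.univ.filter fun j => p (Λ j)).card =
      (Finset.univ.filter fun k => p (α k)).card + (Finset.univ.filter fun c => p (β c)).card := by
    intro p _
    rw [card_of_map_eq _ _ h p, Finset.card_filter, Finset.card_filter, Finset.card_filter, Fintype.sum_sum_type]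
    rfl
  have hcompl : ∀ k, (Finset.univ.filter fun c => α k ≤ β c).card = (r - d) - g k := by
    intro k
    have := Finset.card_filter_add_card_filter_not (s := (Finset.univ : Finset (Fin (r - d)))) (fun c => β c < α k)
    simp only [not_lt, Finset.card_univ, Fintype.card_fin] at this
    simp only [g]; omega
  refine ⟨J, ?_, ?_, ?_, ?_⟩
  · intro k k' hk
    rw [Fin.lt_def]
    simp only [J]
    have h1 := hganti k k' hk.le
    have h2 := hg k
    have h3 : (k : ℕ) < k' := hk
    omega
  · intro k
    apply le_antisymm
    · by_contra hlt
      push Not at hlt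
      have h1 : J k ∈ (Finset.univ.filter fun j => α k < Λ j) := by simp [hlt]
      rw [← fin_lower _ (by
        intro c hc c' hcc
        simp only [Finset.mem_filter, Finset.mem_univ, true_and] at hc ⊢
        exact lt_of_lt_of_le hc (hΛ hcc))] at h1
      rw [hcount (fun x => α k < x)] at h1
      have h2 : (Finset.univ.filter fun k' => α k < α k').card ≤ k := by
        have : (Finset.univ.filter fun k' => α k < α k') ⊆ Finset.univ.filter fun k' : Fin d => (k' : ℕ) < k := by
          intro k' hk'
          simp only [Finset.mem_filter, Finset.mem_univ, true_and] at hk' ⊢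
          by_contra hn
          exact absurd hk' (not_lt.2 (hα (by rw [Fin.le_def]; omega)))
        have := Finset.card_le_card this
        rw [Fin.card_filter_val_lt] at this
        omega
      have h3 : (Finset.univ.filter fun c => α k < β c).card ≤ (r - d) - g k := by
        rw [← hcompl]
        apply Finset.card_le_card
        intro c hc
        simp only [Finset.mem_filter, Finset.mem_univ, true_and] at hc ⊢
        exact hc.le
      have h4 := hg k
      simp only [J] at h1
      omega
    · have h1 : J k ∈ (Finset.univ.filter fun j => α k ≤ Λ j) := by
        rw [← fin_lower _ (by
          intro c hc c' hcc
          simp only [Finset.mem_filter, Finset.mem_univ, true_and] at hc ⊢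
          exact le_trans hc (hΛ hcc))]
        rw [hcount (fun x => α k ≤ x), hcompl]
        have h2 : (k : ℕ) + 1 ≤ (Finset.univ.filter fun k' => α k ≤ α k').card := by
          have : (Finset.univ.filter fun k' : Fin d => (k' : ℕ) < k + 1) ⊆ (Finset.univ.filter fun k' => α k ≤ α k') := by
            intro k' hk'
            simp only [Finset.mem_filter, Finset.mem_univ, true_and] at hk' ⊢
            exact hα (by rw [Fin.le_def]; omega)
          have := Finset.card_le_card this
          rw [Fin.card_filter_val_lt] at this
          have := k.2
          omega
        have h4 := hg k
        simp only [J]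
        omega
      simpa using h1
  · intro k c; rw [hGN, hgc]
  · intro k; rw [hGN]; exact hg k

end Comb
end Part10

section Part11
open Module Matrix Topology Filter
set_option linter.unusedSectionVars false
set_option linter.unusedSimpArgs false
set_option linter.unusedVariables false

section Second
variable {s d r q : ℕ}

lemma trace_omega (a : Matrix (Fin d) (Fin d) ℂ) (b : Matrix (Fin q) (Fin q) ℂ) (ha : aᴴ * a = 1)
    (hb : bᴴ * b = 1) (α : Fin d → ℝ) (β : Fin q → ℝ) (y : Matrix (Fin q) (Fin d) ℂ) :
    (b * y * aᴴ) * (a * Matrix.diagonal (fun i => (α i : ℂ)) * aᴴ) -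
      (b * Matrix.diagonal (fun i => (β i : ℂ)) * bᴴ) * (b * y * aᴴ) =
      b * (Matrix.of fun c k => ((α k - β c : ℝ) : ℂ) * y c k) * aᴴ := by
  have h1 : (Matrix.of fun c k => ((α k - β c : ℝ) : ℂ) * y c k) = y * Matrix.diagonal (fun i => (α i : ℂ)) -
      Matrix.diagonal (fun i => (β i : ℂ)) * y := by
    ext c k
    simp
    ring
  rw [h1, Matrix.mul_sub, Matrix.sub_mul]
  congr 1
  · calc _ = b * y * (aᴴ * a) * Matrix.diagonal (fun i => (α i : ℂ)) * aᴴ := by simp only [Matrix.mul_assoc]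
      _ = _ := by rw [ha]; simp only [Matrix.mul_assoc, Matrix.mul_one, Matrix.one_mul]
  · calc _ = b * Matrix.diagonal (fun i => (β i : ℂ)) * (bᴴ * b) * y * aᴴ := by simp only [Matrix.mul_assoc]
      _ = _ := by rw [hb]; simp only [Matrix.mul_assoc, Matrix.mul_one, Matrix.one_mul]

lemma trace_conj_two (a : Matrix (Fin d) (Fin d) ℂ) (b : Matrix (Fin q) (Fin q) ℂ) (ha : aᴴ * a = 1)
    (hb : bᴴ * b = 1) (w y : Matrix (Fin q) (Fin d) ℂ) :
    ((b * w * aᴴ) * (b * y * aᴴ)ᴴ).trace = ∑ c, ∑ k, w c k * star (y c k) := by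
  have : ((b * w * aᴴ) * (b * y * aᴴ)ᴴ).trace = (w * yᴴ).trace := by
    rw [Matrix.conjTranspose_mul, Matrix.conjTranspose_mul, Matrix.conjTranspose_conjTranspose]
    calc _ = (b * (w * (aᴴ * a) * yᴴ * bᴴ)).trace := by simp only [Matrix.mul_assoc]
      _ = (w * (aᴴ * a) * yᴴ * (bᴴ * b)).trace := by rw [Matrix.trace_mul_comm]; simp only [Matrix.mul_assoc]
      _ = _ := by rw [ha, hb]; simp
  rw [this]
  simp [Matrix.trace, Matrix.mul_apply]

lemma re_term (x : ℝ) (y : ℂ) : ((x : ℂ) * y * star y).re = x * ‖y‖ ^ 2 := by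
  have : y * star y = ((‖y‖ ^ 2 : ℝ) : ℂ) := by
    have := Complex.mul_conj y
    rw [Complex.normSq_eq_norm_sq] at this
    exact this
  rw [mul_assoc, this, ← Complex.ofReal_mul, Complex.ofReal_re]

lemma second_data (A1 : Fin s → Matrix (Fin d) (Fin d) ℂ) (A2 : Fin s → Matrix (Fin q) (Fin q) ℂ)
    (μ : ℝ) (m : Fin q → ℝ) (hm : ∀ i, 0 < m i)
    (hs1 : ∑ l, A1 l = (μ : ℂ) • (1 : Matrix (Fin d) (Fin d) ℂ))
    (hs2 : ∑ l, A2 l = Matrix.diagonal (fun i => ((μ - m i : ℝ) : ℂ)))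
    (hz : ∀ z : Fin s → Matrix (Fin q) (Fin d) ℂ, ∑ l, (z l * A1 l - A2 l * z l) = 0 →
      ∑ l, ((z l * A1 l - A2 l * z l) * (z l)ᴴ).trace.re ≤ 0)
    (a : Fin s → Matrix (Fin d) (Fin d) ℂ) (b : Fin s → Matrix (Fin q) (Fin q) ℂ)
    (ha : ∀ l, a l * (a l)ᴴ = 1) (hb : ∀ l, b l * (b l)ᴴ = 1)
    (α : Fin s → Fin d → ℝ) (β : Fin s → Fin q → ℝ)
    (hA1 : ∀ l, A1 l = a l * Matrix.diagonal (fun i => (α l i : ℂ)) * (a l)ᴴ)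
    (hA2 : ∀ l, A2 l = b l * Matrix.diagonal (fun i => (β l i : ℂ)) * (b l)ᴴ)
    (g : Fin s → Fin d → ℕ) (hg : ∀ l k, g l k ≤ q)
    (hgc : ∀ l k (c : Fin q), (c : ℕ) < g l k ↔ β l c < α l k) :
    nul g a (fun l => (b l)ᴴ) = 0 ∧ ∑ l, ∑ k, g l k = d * q := by
  have ha' := fun l => unitary_swap (ha l)
  have hb' := fun l => unitary_swap (hb l)
  have hnul : nul g a (fun l => (b l)ᴴ) = 0 := by
    rw [nul_eq_zero_iff]
    intro X hX h0
    rw [mem_Xsp] at hX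
    let y : Fin s → Matrix (Fin q) (Fin d) ℂ := fun l => Matrix.of fun c k =>
      star (X l k c) / ((α l k - β l c : ℝ) : ℂ)
    have hy : ∀ l, (Matrix.of fun c k => ((α l k - β l c : ℝ) : ℂ) * y l c k) = (X l)ᴴ := by
      intro l
      ext c k
      simp only [Matrix.of_apply, y, Matrix.conjTranspose_apply]
      by_cases hc : (c : ℕ) < g l k
      · have := (hgc l k c).1 hc
        have h1 : ((α l k - β l c : ℝ) : ℂ) ≠ 0 := by
          rw [Ne, Complex.ofReal_eq_zero]; linarith
        field_simp
      · rw [hX l k c (not_lt.1 hc)]; simp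
    have hom : ∀ l, (b l * y l * (a l)ᴴ) * A1 l - A2 l * (b l * y l * (a l)ᴴ) = b l * (X l)ᴴ * (a l)ᴴ := by
      intro l
      rw [hA1, hA2, trace_omega _ _ (ha' l) (hb' l), hy]
    have key := hz (fun l => b l * y l * (a l)ᴴ) (by
      simp only [hom]
      have := congrArg Matrix.conjTranspose h0
      simpa [Matrix.conjTranspose_sum, Matrix.conjTranspose_mul, Matrix.mul_assoc] using this)
    simp only [hom] at key
    have hterm : ∀ l, ((b l * (X l)ᴴ * (a l)ᴴ) * (b l * y l * (a l)ᴴ)ᴴ).trace.re =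
        ∑ c, ∑ k, (α l k - β l c) * ‖y l c k‖ ^ 2 := by
      intro l
      rw [← hy, trace_conj_two _ _ (ha' l) (hb' l), Complex.re_sum]
      refine Finset.sum_congr rfl fun c _ => ?_
      rw [Complex.re_sum]
      refine Finset.sum_congr rfl fun k _ => ?_
      rw [Matrix.of_apply, re_term]
    simp only [hterm] at key
    have hpos : ∀ l c k, 0 ≤ (α l k - β l c) * ‖y l c k‖ ^ 2 := by
      intro l c k
      by_cases hc : (c : ℕ) < g l k
      · have := (hgc l k c).1 hc
        have : 0 ≤ α l k - β l c := by linarith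
        positivity
      · simp [y, hX l k c (not_lt.1 hc)]
    have hz0 : ∀ l c k, (α l k - β l c) * ‖y l c k‖ ^ 2 = 0 := by
      have e1 := le_antisymm key (Finset.sum_nonneg fun l _ => Finset.sum_nonneg fun c _ =>
        Finset.sum_nonneg fun k _ => hpos l c k)
      intro l c k
      rw [Finset.sum_eq_zero_iff_of_nonneg (fun l _ => Finset.sum_nonneg fun c _ =>
        Finset.sum_nonneg fun k _ => hpos l c k)] at e1
      have e2 := e1 l (Finset.mem_univ _)
      rw [Finset.sum_eq_zero_iff_of_nonneg (fun c _ =>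
        Finset.sum_nonneg fun k _ => hpos l c k)] at e2
      have e3 := e2 c (Finset.mem_univ _)
      rw [Finset.sum_eq_zero_iff_of_nonneg (fun k _ => hpos l c k)] at e3
      exact e3 k (Finset.mem_univ _)
    funext l
    ext k c
    by_cases hc : (c : ℕ) < g l k
    · have h1 := (hgc l k c).1 hc
      have h2 : α l k - β l c ≠ 0 := by linarith
      have h3 := hz0 l c k
      have h4 : y l c k = 0 := by simpa [h2] using h3
      have h5 : ((α l k - β l c : ℝ) : ℂ) ≠ 0 := by
          rw [Ne, Complex.ofReal_eq_zero]; exact h2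
      simp only [y, Matrix.of_apply, div_eq_zero_iff, h5, or_false] at h4
      simpa using h4
    · simpa using hX l k c (not_lt.1 hc)
  refine ⟨hnul, le_antisymm ?_ ?_⟩
  · have h1 := rank_add_nul g a (fun l => (b l)ᴴ)
    rw [hnul, finrank_Xsp g hg] at h1
    have h2 := Submodule.finrank_le (LinearMap.range (Mr g a (fun l => (b l)ᴴ)))
    have h3 : finrank ℂ (Matrix (Fin d) (Fin q) ℂ) = d * q := by
      rw [Module.finrank_matrix]; simp
    omega
  · let f : Matrix (Fin q) (Fin d) ℂ →ₗ[ℂ] Xsp q g :=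
      { toFun := fun z => ⟨fun l => Matrix.of fun k c => if (c : ℕ) < g l k then ((b l)ᴴ * z * a l) c k else 0, by
          rw [mem_Xsp]
          intro l k c hc
          simp [not_lt.2 hc]⟩
        map_add' := by
          intro z w
          apply Subtype.ext
          funext l
          ext k c
          by_cases hc : (c : ℕ) < g l k <;> simp [hc, Matrix.mul_add, Matrix.add_mul]
        map_smul' := by
          intro t w
          apply Subtype.ext
          funext l
          ext k c
          by_cases hc : (c : ℕ) < g l k <;> simp [hc] }
    have hf : Function.Injective f := by
      rw [← LinearMap.ker_eq_bot, LinearMap.ker_eq_bot']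
      intro z hz0
      have hval : ∀ l k (c : Fin q), (c : ℕ) < g l k → ((b l)ᴴ * z * a l) c k = 0 := by
        intro l k c hc
        have h1 := congrArg (fun X : Xsp q g => X.1 l k c) hz0
        simpa [f, hc] using h1
      have hzl : ∀ l, z = b l * ((b l)ᴴ * z * a l) * (a l)ᴴ := by
        intro l
        calc z = (b l * (b l)ᴴ) * z * (a l * (a l)ᴴ) := by rw [ha, hb]; simp
          _ = _ := by simp only [Matrix.mul_assoc]
      have hle : ∀ l, ((z * A1 l - A2 l * z) * zᴴ).trace.re ≤ 0 := by
        intro l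
        have e : ((z * A1 l - A2 l * z) * zᴴ).trace.re = ∑ c, ∑ k, (α l k - β l c) * ‖((b l)ᴴ * z * a l) c k‖ ^ 2 := by
          have h1 := hzl l
          generalize (b l)ᴴ * z * a l = y at h1 ⊢
          rw [h1, hA1, hA2, trace_omega _ _ (ha' l) (hb' l), trace_conj_two _ _ (ha' l) (hb' l), Complex.re_sum]
          refine Finset.sum_congr rfl fun c _ => ?_
          rw [Complex.re_sum]
          refine Finset.sum_congr rfl fun k _ => ?_
          rw [Matrix.of_apply, re_term]
        rw [e]
        refine Finset.sum_nonpos fun c _ => Finset.sum_nonpos fun k _ => ?_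
        by_cases hc : (c : ℕ) < g l k
        · simp [hval l k c hc]
        · have h2 := mt (hgc l k c).2 hc
          have h3 : α l k - β l c ≤ 0 := by linarith
          exact mul_nonpos_of_nonpos_of_nonneg h3 (by positivity)
      have hsum : ∑ l, ((z * A1 l - A2 l * z) * zᴴ).trace.re = ∑ c, ∑ k, m c * ‖z c k‖ ^ 2 := by
        have e1 : ∑ l, (z * A1 l - A2 l * z) = Matrix.diagonal (fun i => (m i : ℂ)) * z := by
          rw [Finset.sum_sub_distrib, ← Matrix.mul_sum, ← Matrix.sum_mul, hs1, hs2]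
          ext c k
          simp
          ring
        rw [← Complex.re_sum, ← Matrix.trace_sum, ← Matrix.sum_mul, e1]
        simp only [Matrix.trace, Matrix.diag, Complex.re_sum]
        refine Finset.sum_congr rfl fun c _ => ?_
        rw [Matrix.mul_apply, Complex.re_sum]
        refine Finset.sum_congr rfl fun k _ => ?_
        rw [← re_term]
        simp
      have h0 : ∑ c, ∑ k, m c * ‖z c k‖ ^ 2 ≤ 0 := by
        rw [← hsum]
        exact Finset.sum_nonpos fun l _ => hle l
      have hp : ∀ c k, 0 ≤ m c * ‖z c k‖ ^ 2 := fun c k => mul_nonneg (hm c).le (by positivity)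
      have e1 := le_antisymm h0 (Finset.sum_nonneg fun c _ => Finset.sum_nonneg fun k _ => hp c k)
      rw [Finset.sum_eq_zero_iff_of_nonneg (fun c _ => Finset.sum_nonneg fun k _ => hp c k)] at e1
      ext c k
      have e2 := e1 c (Finset.mem_univ _)
      rw [Finset.sum_eq_zero_iff_of_nonneg (fun k _ => hp c k)] at e2
      have e3 := e2 k (Finset.mem_univ _)
      simpa [(hm c).ne'] using e3
    have := LinearMap.finrank_le_finrank_of_injective hf
    rw [finrank_Xsp g hg, Module.finrank_matrix] at this
    simp at this
    rw [mul_comm]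
    exact this

/-- the second-order information at a minimum, in combinatorial form -/
lemma second_comb (hdr : d ≤ r) (Λ : Fin s → Fin r → ℝ) (hΛ : ∀ l, Antitone (Λ l))
    (A1 : Fin s → Matrix (Fin d) (Fin d) ℂ) (A2 : Fin s → Matrix (Fin (r - d)) (Fin (r - d)) ℂ)
    (hA1 : ∀ l, (A1 l).IsHermitian) (hA2 : ∀ l, (A2 l).IsHermitian)
    (μ : ℝ) (m : Fin (r - d) → ℝ) (hm : ∀ i, 0 < m i)
    (hs1 : ∑ l, A1 l = (μ : ℂ) • (1 : Matrix (Fin d) (Fin d) ℂ))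
    (hs2 : ∑ l, A2 l = Matrix.diagonal (fun i => ((μ - m i : ℝ) : ℂ)))
    (hz : ∀ z : Fin s → Matrix (Fin (r - d)) (Fin d) ℂ, ∑ l, (z l * A1 l - A2 l * z l) = 0 →
      ∑ l, ((z l * A1 l - A2 l * z l) * (z l)ᴴ).trace.re ≤ 0)
    (hroots : ∀ l, (Matrix.fromBlocks (A1 l) 0 0 (A2 l)).charpoly.roots =
      (Finset.univ : Finset (Fin r)).val.map (fun j => (Λ l j : ℂ))) :
    ∃ J : Fin s → Fin d → Fin r, (∀ l, StrictMono (J l)) ∧ TJ J Λ = d * μ ∧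
      (∃ a b, nul (q := r - d) (fun l => GN (J l)) a b = 0) ∧ ∑ l, ∑ k, GN (J l) k = d * (r - d) := by
  choose a α ha hα hA1' using fun l => exists_antitone_diag (A1 l) (hA1 l)
  choose b β hb hβ hA2' using fun l => exists_monotone_diag (A2 l) (hA2 l)
  have hmap : ∀ l, (Finset.univ : Finset (Fin r)).val.map (Λ l) =
      (Finset.univ : Finset (Fin d ⊕ Fin (r - d))).val.map (Sum.elim (α l) (β l)) := by
    intro l
    have h1 := hroots l
    rw [hA1' l, hA2' l, roots_blocks _ _ (ha l) (hb l)] at h1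
    have h2 := congrArg (Multiset.map Complex.re) h1
    simp only [Multiset.map_map, Function.comp_def, Complex.ofReal_re] at h2
    exact h2.symm
  choose J hJ hJα hJβ hJr using fun l => comb_one hdr (Λ l) (hΛ l) (α l) (hα l) (β l) (hβ l) (hmap l)
  obtain ⟨h1, h2⟩ := second_data A1 A2 μ m hm hs1 hs2 hz a b ha hb α β hA1' hA2' (fun l => GN (J l)) hJr hJβ
  refine ⟨J, hJ, ?_, ⟨_, _, h1⟩, h2⟩
  have h3 := congrArg (fun M => M.trace.re) hs1
  simp only [Matrix.trace_sum, Complex.re_sum, Matrix.trace_smul, Matrix.trace_one] at h3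
  have h4 : ∀ l, (A1 l).trace.re = ∑ k, α l k := by
    intro l
    rw [hA1' l, Matrix.mul_assoc, Matrix.trace_mul_comm, Matrix.mul_assoc, unitary_swap (ha l)]
    simp
  simp only [h4] at h3
  simp only [TJ, hJα]
  rw [h3]
  simp
  ring

end Second
end Part11

section Part12
open Module Matrix Topology Filter
set_option linter.unusedSectionVars false
set_option linter.unusedSimpArgs false
set_option linter.unusedVariables false

section First
variable {s d r q : ℕ}

/-- the squared distance to the scalar matrix -/
noncomputable def FF {I : Type} [Fintype I] [DecidableEq I] (A : Fin s → Matrix I I ℂ) (t : ℝ) : ℝ :=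
  ((∑ l, A l - (t : ℂ) • 1) * (∑ l, A l - (t : ℂ) • 1)).trace.re

lemma exists_min_unitary (D : Fin s → Matrix (Fin r) (Fin r) ℂ) (t : ℝ) :
    ∃ u : Fin s → Matrix (Fin r) (Fin r) ℂ, (∀ l, u l * (u l)ᴴ = 1) ∧
      ∀ v : Fin s → Matrix (Fin r) (Fin r) ℂ, (∀ l, v l * (v l)ᴴ = 1) →
        FF (fun l => u l * D l * (u l)ᴴ) t ≤ FF (fun l => v l * D l * (v l)ᴴ) t := by
  let K : Set (Fin s → Matrix (Fin r) (Fin r) ℂ) := {u | ∀ l, u l * (u l)ᴴ = 1}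
  have hK : IsCompact K := by
    have h1 : IsCompact (Set.univ.pi fun _ : Fin s => (Set.univ.pi fun _ : Fin r => Set.univ.pi fun _ : Fin r =>
        Metric.closedBall (0 : ℂ) 1 : Set (Fin r → Fin r → ℂ))) :=
      isCompact_univ_pi fun _ => isCompact_univ_pi fun _ => isCompact_univ_pi fun _ => isCompact_closedBall _ _
    refine h1.of_isClosed_subset ?_ ?_
    · have : K = ⋂ l, {u | u l * (u l)ᴴ = 1} := by ext u; simp [K]
      rw [this]
      refine isClosed_iInter fun l => ?_
      refine isClosed_eq ?_ continuous_const
      fun_prop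
    · intro u hu l _ i _ j _
      rw [mem_closedBall_zero_iff]
      exact entry_norm_bound_of_unitary (U := u l) (Matrix.mem_unitaryGroup_iff.2 (hu l)) i j
  have hne : K.Nonempty := ⟨fun _ => 1, by intro l; simp⟩
  have hc : Continuous fun u : Fin s → Matrix (Fin r) (Fin r) ℂ => FF (fun l => u l * D l * (u l)ᴴ) t := by
    unfold FF
    fun_prop
  obtain ⟨u, hu, hmin⟩ := hK.exists_isMinOn hne hc.continuousOn
  exact ⟨u, hu, fun v hv => hmin hv⟩

lemma FF_conj (A : Fin s → Matrix (Fin r) (Fin r) ℂ) (t : ℝ) (w : Matrix (Fin r) (Fin r) ℂ) (hw : w * wᴴ = 1) :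
    FF (fun l => wᴴ * A l * w) t = FF A t := by
  unfold FF
  have hw' := unitary_swap hw
  have : ∑ l, wᴴ * A l * w - (t : ℂ) • 1 = wᴴ * (∑ l, A l - (t : ℂ) • 1) * w := by
    rw [Matrix.mul_sub, Matrix.sub_mul, Matrix.mul_sum, Matrix.sum_mul]
    congr 1
    simp [hw']
  rw [this]
  generalize ∑ l, A l - (t : ℂ) • 1 = B
  have : wᴴ * B * w * (wᴴ * B * w) = wᴴ * (B * (w * wᴴ) * B * w) := by simp only [Matrix.mul_assoc]
  rw [this, hw, Matrix.trace_mul_comm]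
  have : B * 1 * B * w * wᴴ = B * B * (w * wᴴ) := by simp only [Matrix.mul_assoc, Matrix.mul_one, Matrix.one_mul]
  rw [this, hw, Matrix.mul_one]

lemma FF_reindex {I K : Type} [Fintype I] [DecidableEq I] [Fintype K] [DecidableEq K] (e : I ≃ K)
    (A : Fin s → Matrix K K ℂ) (t : ℝ) :
    FF (fun l => (A l).submatrix e e) t = FF A t := by
  unfold FF
  have : ∑ l, (A l).submatrix e e - (t : ℂ) • 1 = (∑ l, A l - (t : ℂ) • 1).submatrix e e := by
    ext i j
    simp [Matrix.sum_apply, Matrix.one_apply]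
  rw [this, Matrix.submatrix_mul_equiv]
  congr 1
  simp only [Matrix.trace, Matrix.diag, Matrix.submatrix_apply]
  exact e.sum_comp (fun i => ((∑ l, A l - (t : ℂ) • 1) * (∑ l, A l - (t : ℂ) • 1)) i i)

lemma submatrix_conj {I K : Type} [Fintype I] [DecidableEq I] [Fintype K] [DecidableEq K] (e : I ≃ K)
    (v : Matrix I I ℂ) (A : Matrix K K ℂ) :
    v * A.submatrix e e * vᴴ = (v.submatrix e.symm e.symm * A * (v.submatrix e.symm e.symm)ᴴ).submatrix e e := by
  rw [← Matrix.submatrix_mul_equiv _ _ _ e, ← Matrix.submatrix_mul_equiv _ _ _ e]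
  rw [Matrix.conjTranspose_submatrix]
  simp

lemma exists_destab (Λ : Fin s → Fin r → ℝ) (hΛ : ∀ l, Antitone (Λ l)) (t : ℝ) (hT : TT Λ = r * t)
    (hnot : ¬ KirwanMem Λ t) :
    ∃ d : ℕ, 1 ≤ d ∧ d < r ∧ ∃ J : Fin s → Fin d → Fin r, (∀ l, StrictMono (J l)) ∧ d * t < TJ J Λ ∧
      (∃ a b, nul (q := r - d) (fun l => GN (J l)) a b = 0) ∧ ∑ l, ∑ k, GN (J l) k = d * (r - d) := by
  obtain ⟨u0, hu0, hmin0⟩ := exists_min_unitary (fun l => Matrix.diagonal (fun j => (Λ l j : ℂ))) t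
  have hB : (∑ l, u0 l * Matrix.diagonal (fun j => (Λ l j : ℂ)) * (u0 l)ᴴ).IsHermitian := by
    unfold Matrix.IsHermitian
    rw [Matrix.conjTranspose_sum]
    exact Finset.sum_congr rfl fun l _ => herm_conj (u0 l) (Λ l)
  obtain ⟨w, hw, hwB⟩ := herm_diag _ hB
  generalize hB.eigenvalues = ν at hwB
  have hw' := unitary_swap hw
  let u : Fin s → Matrix (Fin r) (Fin r) ℂ := fun l => wᴴ * u0 l
  have hu : ∀ l, u l * (u l)ᴴ = 1 := by
    intro l
    simp only [u, Matrix.conjTranspose_mul, Matrix.conjTranspose_conjTranspose]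
    calc _ = wᴴ * (u0 l * (u0 l)ᴴ) * w := by simp only [Matrix.mul_assoc]
      _ = 1 := by rw [hu0, Matrix.mul_one, hw']
  let A : Fin s → Matrix (Fin r) (Fin r) ℂ := fun l => u l * Matrix.diagonal (fun j => (Λ l j : ℂ)) * (u l)ᴴ
  have hAw : ∀ l, A l = wᴴ * (u0 l * Matrix.diagonal (fun j => (Λ l j : ℂ)) * (u0 l)ᴴ) * w := by
    intro l
    simp only [A, u, Matrix.conjTranspose_mul, Matrix.conjTranspose_conjTranspose, Matrix.mul_assoc]
  have hmin : ∀ v : Fin s → Matrix (Fin r) (Fin r) ℂ, (∀ l, v l * (v l)ᴴ = 1) →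
      FF A t ≤ FF (fun l => v l * A l * (v l)ᴴ) t := by
    intro v hv
    have h1 := hmin0 (fun l => v l * u l) (by
      intro l
      rw [Matrix.conjTranspose_mul]
      calc _ = v l * (u l * (u l)ᴴ) * (v l)ᴴ := by simp only [Matrix.mul_assoc]
        _ = 1 := by rw [hu, Matrix.mul_one, hv])
    rw [← FF_conj _ t w hw] at h1
    convert h1 using 2
    · funext l; exact hAw l
    · funext l
      simp only [A, Matrix.conjTranspose_mul, Matrix.mul_assoc]
  have hAh : ∀ l, (A l).IsHermitian := fun l => herm_conj (u l) (Λ l)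
  have hsum : ∑ l, A l = Matrix.diagonal (fun i => (ν i : ℂ)) := by
    simp only [hAw]
    rw [← Matrix.sum_mul, ← Matrix.mul_sum, hwB]
    calc _ = (wᴴ * w) * Matrix.diagonal (fun i => (ν i : ℂ)) * (wᴴ * w) := by simp only [Matrix.mul_assoc]
      _ = _ := by rw [hw']; simp
  have hνsum : ∑ i, ν i = r * t := by
    have h1 := congrArg (fun M => M.trace.re) hsum
    simp only [Matrix.trace_sum, Complex.re_sum] at h1
    have h4 : ∀ l, (A l).trace.re = ∑ k, Λ l k := by
      intro l
      simp only [A]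
      rw [Matrix.mul_assoc, Matrix.trace_mul_comm, Matrix.mul_assoc, unitary_swap (hu l)]
      simp
    simp only [h4] at h1
    rw [TT] at hT
    rw [hT] at h1
    simpa using h1.symm
  have hnt : ∃ i, ν i ≠ t := by
    by_contra hcon
    push Not at hcon
    apply hnot
    rw [kirwan_iff]
    refine ⟨hΛ, u, hu, ?_⟩
    have : ∑ l, A l = (t : ℂ) • 1 := by
      rw [hsum]
      simp only [hcon]
      rw [Matrix.smul_one_eq_diagonal]
    exact this
  obtain ⟨i0, hi0⟩ := hnt
  obtain ⟨im, -, him⟩ := Finset.exists_max_image Finset.univ ν ⟨i0, Finset.mem_univ _⟩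
  have hmax : ∀ i, ν i ≤ ν im := fun i => him i (Finset.mem_univ _)
  set μ := ν im with hμ
  have hcon : ∑ _i : Fin r, t = r * t := by simp
  have hμt : t < μ := by
    by_contra hle
    push Not at hle
    have h1 : ∑ i, ν i < ∑ _i : Fin r, t :=
      Finset.sum_lt_sum (fun i _ => (hmax i).trans hle)
        ⟨i0, Finset.mem_univ _, lt_of_le_of_ne ((hmax i0).trans hle) hi0⟩
    rw [hνsum, hcon] at h1
    exact lt_irrefl _ h1
  obtain ⟨i1, hi1⟩ : ∃ i, ν i ≠ μ := by
    by_contra hcon2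
    push Not at hcon2
    have h1 : ∑ _i : Fin r, t < ∑ i, ν i :=
      Finset.sum_lt_sum (fun i _ => by rw [hcon2]; exact hμt.le) ⟨i0, Finset.mem_univ _, by rw [hcon2]; exact hμt⟩
    rw [hνsum, hcon] at h1
    exact lt_irrefl _ h1
  let S : Finset (Fin r) := Finset.univ.filter fun i => ν i = μ
  have hSmem : ∀ i, i ∈ S ↔ ν i = μ := by simp [S]
  set d := S.card with hd
  have hd1 : 1 ≤ d := Finset.card_pos.2 ⟨im, by rw [hSmem]⟩
  have hSc : Sᶜ.card = r - d := by rw [Finset.card_compl, Fintype.card_fin]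
  have hd2 : d < r := by
    have : 0 < Sᶜ.card := Finset.card_pos.2 ⟨i1, by rw [Finset.mem_compl, hSmem]; exact hi1⟩
    omega
  let e : Fin d ⊕ Fin (r - d) ≃ Fin r := finSumEquivOfFinset hd.symm hSc
  have he1 : ∀ i, ν (e (Sum.inl i)) = μ := by
    intro i
    rw [← hSmem]
    simp only [e, finSumEquivOfFinset_inl]
    exact Finset.orderEmbOfFin_mem _ _ _
  have he2 : ∀ i, ν (e (Sum.inr i)) < μ := by
    intro i
    refine lt_of_le_of_ne (hmax _) ?_
    rw [Ne, ← hSmem, ← Finset.mem_compl]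
    simp only [e, finSumEquivOfFinset_inr]
    exact Finset.orderEmbOfFin_mem _ _ _
  have hcomm : ∀ l i j, A l i j * (ν j : ℂ) = (ν i : ℂ) * A l i j := by
    intro l i j
    have h1 := commute_of_min A hAh t hmin l
    rw [hsum] at h1
    have h2 := congrFun (congrFun h1 i) j
    rwa [Matrix.mul_diagonal, Matrix.diagonal_mul] at h2
  have hoff : ∀ l i j, ν i ≠ ν j → A l i j = 0 := by
    intro l i j hij
    have h1 := hcomm l i j
    by_contra h2
    apply hij
    have h3 : (ν j : ℂ) = ν i := by
      rw [mul_comm] at h1; exact mul_right_cancel₀ h2 h1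
    exact_mod_cast h3.symm
  let A1 : Fin s → Matrix (Fin d) (Fin d) ℂ := fun l => (A l).submatrix (fun i => e (Sum.inl i)) (fun i => e (Sum.inl i))
  let A2 : Fin s → Matrix (Fin (r - d)) (Fin (r - d)) ℂ :=
    fun l => (A l).submatrix (fun i => e (Sum.inr i)) (fun i => e (Sum.inr i))
  have hbl : ∀ l, (A l).submatrix e e = Matrix.fromBlocks (A1 l) 0 0 (A2 l) := by
    intro l
    ext (i|i) (j|j)
    · rfl
    · simp only [Matrix.submatrix_apply, Matrix.fromBlocks_apply₁₂, Matrix.zero_apply]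
      exact hoff _ _ _ (by rw [he1]; exact (he2 j).ne')
    · simp only [Matrix.submatrix_apply, Matrix.fromBlocks_apply₂₁, Matrix.zero_apply]
      exact hoff _ _ _ (by rw [he1]; exact (he2 i).ne)
    · rfl
  let m : Fin (r - d) → ℝ := fun i => μ - ν (e (Sum.inr i))
  have hm : ∀ i, 0 < m i := fun i => sub_pos.2 (he2 i)
  have hs1 : ∑ l, A1 l = (μ : ℂ) • (1 : Matrix (Fin d) (Fin d) ℂ) := by
    ext i j
    have h1 := congrFun (congrFun hsum (e (Sum.inl i))) (e (Sum.inl j))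
    rw [Matrix.sum_apply] at h1 ⊢
    simp only [A1, Matrix.submatrix_apply]
    rw [h1, Matrix.diagonal_apply, he1, Matrix.smul_apply, Matrix.one_apply]
    simp
  have hs2 : ∑ l, A2 l = Matrix.diagonal (fun i => ((μ - m i : ℝ) : ℂ)) := by
    ext i j
    have h1 := congrFun (congrFun hsum (e (Sum.inr i))) (e (Sum.inr j))
    rw [Matrix.sum_apply] at h1 ⊢
    simp only [A2, Matrix.submatrix_apply]
    rw [h1, Matrix.diagonal_apply, Matrix.diagonal_apply]
    simp [m]
  have hA1 : ∀ l, (A1 l).IsHermitian := fun l => (hAh l).submatrix _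
  have hA2 : ∀ l, (A2 l).IsHermitian := fun l => (hAh l).submatrix _
  have hminb : ∀ v : Fin s → Matrix (Fin d ⊕ Fin (r - d)) (Fin d ⊕ Fin (r - d)) ℂ, (∀ l, v l * (v l)ᴴ = 1) →
      FF (fun l => Matrix.fromBlocks (A1 l) 0 0 (A2 l)) t ≤
        FF (fun l => v l * Matrix.fromBlocks (A1 l) 0 0 (A2 l) * (v l)ᴴ) t := by
    intro v hv
    simp only [← hbl]
    rw [FF_reindex e A t]
    have h1 := hmin (fun l => (v l).submatrix e.symm e.symm) (by
      intro l
      rw [Matrix.conjTranspose_submatrix, Matrix.submatrix_mul_equiv, hv]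
      simp)
    rw [← FF_reindex e (fun l => (v l).submatrix e.symm e.symm * A l * ((v l).submatrix e.symm e.symm)ᴴ) t] at h1
    convert h1 using 2
    funext l
    exact submatrix_conj e (v l) (A l)
  have hcom2 : ∀ l, A2 l * Matrix.diagonal (fun i => (m i : ℂ)) = Matrix.diagonal (fun i => (m i : ℂ)) * A2 l := by
    intro l
    ext i j
    rw [Matrix.mul_diagonal, Matrix.diagonal_mul]
    have h1 := hcomm l (e (Sum.inr i)) (e (Sum.inr j))
    simp only [A2, m, Matrix.submatrix_apply, Complex.ofReal_sub]
    linear_combination -h1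
  have hz := second_block_z A1 A2 hA1 hA2 t μ m hm hs1 hs2 hcom2 hminb
  have hroots : ∀ l, (Matrix.fromBlocks (A1 l) 0 0 (A2 l)).charpoly.roots =
      (Finset.univ : Finset (Fin r)).val.map (fun j => (Λ l j : ℂ)) := by
    intro l
    rw [← hbl]
    have h1 := Matrix.charpoly_reindex e.symm (A l)
    rw [Matrix.reindex_apply, Equiv.symm_symm] at h1
    rw [h1]
    exact charpoly_conj_diag (u l) (u l)ᴴ (hu l) (Λ l)
  obtain ⟨J, hJ, hJT, hJn, hJs⟩ := second_comb hd2.le Λ hΛ A1 A2 hA1 hA2 μ m hm hs1 hs2 hz hroots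
  refine ⟨d, hd1, hd2, J, hJ, ?_, hJn, hJs⟩
  rw [hJT]
  have : (0 : ℝ) < d := by exact_mod_cast hd1
  exact mul_lt_mul_of_pos_left hμt this

end First
end Part12

section Part13
open Module Matrix Topology Filter
set_option linter.unusedSectionVars false
set_option linter.unusedSimpArgs false
set_option linter.unusedVariables false

section Main
variable {s d r q : ℕ}

lemma GN_cast (hdr : d ≤ r) (J : Fin d → Fin r) (hJ : StrictMono J) (k : Fin d) :
    ((GN J k : ℕ) : ℝ) = (k : ℝ) - (J k : ℝ) + ((r : ℝ) - (d : ℝ)) := by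
  have h := strictMono_le hJ k
  have h2 : GN J k + J k + d = r + k := by unfold GN; omega
  have h3 : ((GN J k + J k + d : ℕ) : ℝ) = ((r + k : ℕ) : ℝ) := by rw [h2]
  push_cast at h3
  linarith

lemma GN_antitone (hdr : d ≤ r) (J : Fin d → Fin r) (hJ : StrictMono J) : Antitone (GN J) := by
  rw [antitone_iff_forall_lt]
  intro a b hab
  have h1 : (J b : ℝ) - J a ≥ b - a := by
    have hind : ∀ n : ℕ, ∀ h : (a : ℕ) + n < d, (J a : ℕ) + n ≤ J ⟨a + n, h⟩ := by
      intro n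
      induction n with
      | zero => intro h; simp
      | succ n ih =>
        intro h
        have h1 := ih (by omega)
        have h2 : J ⟨a + n, by omega⟩ < J ⟨a + (n + 1), h⟩ := hJ (by rw [Fin.lt_def]; simp)
        rw [Fin.lt_def] at h2
        omega
    have h2 : (a : ℕ) < b := hab
    have h3 := hind (b - a) (by have := b.2; omega)
    have h4 : (⟨(a : ℕ) + (b - a), by have := b.2; omega⟩ : Fin d) = b := by
      apply Fin.ext; simp; omega
    rw [h4] at h3
    have h5 : (J a : ℕ) + b ≤ J b + a := by omega
    have h6 : ((J a : ℕ) : ℝ) + b ≤ J b + a := by exact_mod_cast h5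
    linarith
  have h2 := GN_cast hdr J hJ a
  have h3 := GN_cast hdr J hJ b
  have h4 : (GN J b : ℝ) ≤ GN J a := by linarith
  exact_mod_cast h4

lemma GN_le (hdr : d ≤ r) (J : Fin d → Fin r) (hJ : StrictMono J) (k : Fin d) : GN J k ≤ r - d := by
  have h : ∀ n : ℕ, ∀ h : n < d, n ≤ (J ⟨n, h⟩ : ℕ) := by
    intro n
    induction n with
    | zero => intro h; simp
    | succ n ih =>
      intro h
      have h1 := ih (by omega)
      have h2 : J ⟨n, by omega⟩ < J ⟨n + 1, h⟩ := hJ (by rw [Fin.lt_def]; simp)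
      rw [Fin.lt_def] at h2
      omega
  have := h k k.2
  unfold GN
  simp only [Fin.eta] at this
  omega

lemma kirwan_nul (hdr : d ≤ r) (J : Fin s → Fin d → Fin r) (hJ : ∀ l, StrictMono (J l))
    (hK : KirwanMem (GammaT J) ((r : ℝ) - d)) :
    ∃ a b, nul (q := r - d) (fun l => GN (J l)) a b = 0 := by
  rw [kirwan_iff] at hK
  obtain ⟨-, u, hu, hsum⟩ := hK
  refine lemB _ (fun l k => GN_le hdr (J l) (hJ l) k) u hu ?_
  intro P hP hPP
  have h1 : ∀ l, (fun j => ((GN (J l) j : ℕ) : ℂ)) = fun j => ((GammaT J l j : ℝ) : ℂ) := by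
    intro l
    funext j
    rw [GammaT, ← GN_cast hdr (J l) (hJ l) j]
    simp
  simp only [h1]
  rw [← Complex.re_sum, ← Matrix.trace_sum, ← Matrix.mul_sum, hsum]
  have : ((r - d : ℕ) : ℝ) = (r : ℝ) - d := by rw [Nat.cast_sub hdr]
  rw [this]
  simp only [Matrix.mul_smul, Matrix.mul_one, Matrix.trace_smul, smul_eq_mul]
  rw [Complex.re_ofReal_mul]

lemma trace_proj_diag_nonneg (P u : Matrix (Fin r) (Fin r) ℂ) (hP : Pᴴ = P) (hPP : P * P = P)
    (δ : Fin r → ℝ) (hδ : ∀ j, 0 ≤ δ j) :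
    0 ≤ (P * (u * Matrix.diagonal (fun j => (δ j : ℂ)) * uᴴ)).trace.re := by
  have h := trace_conj_mul_nonneg (P * u * Matrix.diagonal (fun j => ((Real.sqrt (δ j) : ℝ) : ℂ)))
  have hD : (Matrix.diagonal (fun j => ((Real.sqrt (δ j) : ℝ) : ℂ)) : Matrix (Fin r) (Fin r) ℂ)ᴴ =
      Matrix.diagonal (fun j => ((Real.sqrt (δ j) : ℝ) : ℂ)) := by
    rw [Matrix.diagonal_conjTranspose]; congr 1; ext i; simp
  have hDD : (Matrix.diagonal (fun j => ((Real.sqrt (δ j) : ℝ) : ℂ)) : Matrix (Fin r) (Fin r) ℂ) *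
      Matrix.diagonal (fun j => ((Real.sqrt (δ j) : ℝ) : ℂ)) = Matrix.diagonal (fun j => (δ j : ℂ)) := by
    rw [Matrix.diagonal_mul_diagonal]
    congr 1; ext i
    rw [← Complex.ofReal_mul, Real.mul_self_sqrt (hδ i)]
  rw [Matrix.conjTranspose_mul, Matrix.conjTranspose_mul, hD, hP] at h
  generalize Matrix.diagonal (fun j => ((Real.sqrt (δ j) : ℝ) : ℂ)) = D at h hDD
  rw [← hDD]
  convert h using 2
  calc (P * (u * (D * D) * uᴴ)).trace = ((P * P) * (u * D * D * uᴴ)).trace := by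
        rw [hPP]; simp only [Matrix.mul_assoc]
    _ = ((P * u * D) * (D * uᴴ * P)).trace := by
        rw [Matrix.mul_assoc, Matrix.trace_mul_comm]; simp only [Matrix.mul_assoc]
    _ = _ := by rw [Matrix.trace_mul_comm]; simp only [Matrix.mul_assoc]

lemma forward (hs : 2 ≤ s) (hdr : d ≤ r) (Λ : Fin s → Fin r → ℝ) (t : ℝ) (hK : KirwanMem Λ t)
    (J : Fin s → Fin d → Fin r) (hJ : ∀ l, StrictMono (J l))
    (hJ0 : ∃ a b, nul (q := r - d) (fun l => GN (J l)) a b = 0) : TJ J Λ ≤ d * t := by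
  rw [kirwan_iff] at hK
  obtain ⟨hΛ, u, hu, hsum⟩ := hK
  obtain ⟨C, hC⟩ : ∃ C : ℕ, ∀ l j, |Λ l j| + |t| ≤ C := by
    refine ⟨⌈∑ l, ∑ j, |Λ l j| + |t|⌉₊, fun l j => le_trans ?_ (Nat.le_ceil _)⟩
    gcongr
    have h1 : |Λ l j| ≤ ∑ j, |Λ l j| := Finset.single_le_sum (fun j _ => abs_nonneg (Λ l j)) (Finset.mem_univ j)
    have h2 : ∑ j, |Λ l j| ≤ ∑ l, ∑ j, |Λ l j| :=
      Finset.single_le_sum (f := fun l => ∑ j, |Λ l j|) (fun l _ => Finset.sum_nonneg fun j _ => abs_nonneg (Λ l j)) (Finset.mem_univ l)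
    linarith
  rcases Nat.eq_zero_or_pos d with hd0 | hd0
  · subst hd0; simp [TJ]
  have hs0 : 0 < s := by omega
  have htC : |t| ≤ C := by
    have := hC ⟨0, hs0⟩ ⟨0, by omega⟩
    have := abs_nonneg (Λ ⟨0, hs0⟩ ⟨0, by omega⟩)
    linarith
  have key : ∀ N : ℕ, (N : ℝ) * (TJ J Λ - d * t) ≤ d + s * d := by
    intro N
    have hN : (0 : ℝ) ≤ N := Nat.cast_nonneg N
    have hbl : ∀ l j, -((N : ℝ) * C) ≤ N * Λ l j := by
      intro l j
      have h1 := hC l j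
      have h2 := neg_abs_le (Λ l j)
      have h3 := abs_nonneg t
      have : -(C : ℝ) ≤ Λ l j := by linarith
      nlinarith
    have hfl : ∀ l j, 0 ≤ ⌊(N : ℝ) * Λ l j⌋ + (N * C : ℕ) := by
      intro l j
      have : -((N * C : ℕ) : ℤ) ≤ ⌊(N : ℝ) * Λ l j⌋ := by
        rw [Int.le_floor]; push_cast; exact hbl l j
      omega
    have hst : 0 ≤ ⌈(N : ℝ) * t⌉ + s * (N * C : ℕ) := by
      have h1 : (0 : ℝ) ≤ ((⌈(N : ℝ) * t⌉ + s * (N * C : ℕ) : ℤ) : ℝ) := by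
        push_cast
        have h2 := Int.le_ceil ((N : ℝ) * t)
        have h3 := neg_abs_le t
        have h4 : (2 : ℝ) ≤ s := by exact_mod_cast hs
        have h5 : -(C : ℝ) ≤ t := by linarith
        have h6 : (0 : ℝ) ≤ N * C := by positivity
        nlinarith
      exact_mod_cast h1
    let θ : Fin s → Fin r → ℕ := fun l j => (⌊(N : ℝ) * Λ l j⌋ + (N * C : ℕ)).toNat
    let Q : ℕ := (⌈(N : ℝ) * t⌉ + s * (N * C : ℕ)).toNat
    have hθc : ∀ l j, ((θ l j : ℕ) : ℝ) = (⌊(N : ℝ) * Λ l j⌋ : ℝ) + N * C := by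
      intro l j
      have h1 : ((θ l j : ℕ) : ℤ) = ⌊(N : ℝ) * Λ l j⌋ + (N * C : ℕ) := Int.toNat_of_nonneg (hfl l j)
      have h2 : (((θ l j : ℕ) : ℤ) : ℝ) = ((⌊(N : ℝ) * Λ l j⌋ + (N * C : ℕ) : ℤ) : ℝ) := by rw [h1]
      push_cast at h2
      exact h2
    have hQc : (Q : ℝ) = (⌈(N : ℝ) * t⌉ : ℝ) + s * (N * C) := by
      have h1 : (Q : ℤ) = ⌈(N : ℝ) * t⌉ + s * (N * C : ℕ) := Int.toNat_of_nonneg hst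
      have h2 : ((Q : ℤ) : ℝ) = ((⌈(N : ℝ) * t⌉ + s * (N * C : ℕ) : ℤ) : ℝ) := by rw [h1]
      push_cast at h2
      exact h2
    have hθQ : ∀ l j, θ l j ≤ Q := by
      intro l j
      have h1 : ((θ l j : ℕ) : ℝ) ≤ Q := by
        rw [hθc, hQc]
        have h2 := Int.le_ceil ((N : ℝ) * t)
        have h3 := Int.floor_le ((N : ℝ) * Λ l j)
        have h4 := le_abs_self (Λ l j)
        have h5 := neg_abs_le t
        have h6 := hC l j
        have h7 : Λ l j - t ≤ C := by linarith
        have h8 : (N : ℝ) * (Λ l j - t) ≤ N * C := mul_le_mul_of_nonneg_left h7 hN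
        have h9 : (2 : ℝ) ≤ s := by exact_mod_cast hs
        have h10 : (0 : ℝ) ≤ N * C := by positivity
        nlinarith
      exact_mod_cast h1
    have hanti : ∀ l, Antitone (θ l) := by
      intro l i j hij
      have h1 := hΛ l hij
      have h2 : ⌊(N : ℝ) * Λ l j⌋ ≤ ⌊(N : ℝ) * Λ l i⌋ := Int.floor_le_floor (mul_le_mul_of_nonneg_left h1 hN)
      exact Int.toNat_le_toNat (by omega)
    have hnul : ∃ a b, nul (q := Q) θ a b = 0 := by
      refine lemB θ hθQ u hu ?_
      intro P hP hPP
      let δ : Fin s → Fin r → ℝ := fun l j => N * Λ l j + N * C - θ l j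
      have hδ : ∀ l j, 0 ≤ δ l j := by
        intro l j
        simp only [δ, hθc]
        have h3 := Int.floor_le ((N : ℝ) * Λ l j)
        linarith
      have hdec : ∀ l, (P * (u l * Matrix.diagonal (fun j => (θ l j : ℂ)) * (u l)ᴴ)).trace.re =
          N * (P * (u l * Matrix.diagonal (fun j => (Λ l j : ℂ)) * (u l)ᴴ)).trace.re + N * C * P.trace.re -
          (P * (u l * Matrix.diagonal (fun j => (δ l j : ℂ)) * (u l)ᴴ)).trace.re := by
        intro l
        have h1 : Matrix.diagonal (fun j => (θ l j : ℂ)) = ((N : ℝ) : ℂ) • Matrix.diagonal (fun j => (Λ l j : ℂ)) +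
            ((N * C : ℝ) : ℂ) • (1 : Matrix (Fin r) (Fin r) ℂ) - Matrix.diagonal (fun j => (δ l j : ℂ)) := by
          ext i j
          by_cases hij : i = j
          · subst hij
            simp [δ]
          · simp [Matrix.diagonal_apply_ne _ hij, Matrix.one_apply_ne hij]
        rw [h1]
        simp only [Matrix.mul_add, Matrix.mul_sub, Matrix.add_mul, Matrix.sub_mul, Matrix.mul_smul, Matrix.smul_mul,
          Matrix.mul_one, hu, Matrix.trace_add, Matrix.trace_sub, Matrix.trace_smul, smul_eq_mul, Complex.add_re,
          Complex.sub_re, Complex.re_ofReal_mul]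
      have hmain : ∑ l, (P * (u l * Matrix.diagonal (fun j => (Λ l j : ℂ)) * (u l)ᴴ)).trace.re = t * P.trace.re := by
        rw [← Complex.re_sum, ← Matrix.trace_sum, ← Matrix.mul_sum, hsum]
        simp only [Matrix.mul_smul, Matrix.mul_one, Matrix.trace_smul, smul_eq_mul]
        rw [Complex.re_ofReal_mul]
      have hPt : 0 ≤ P.trace.re := by
        have := trace_conj_mul_nonneg P
        rwa [hP, hPP] at this
      have hnn : 0 ≤ ∑ l, (P * (u l * Matrix.diagonal (fun j => (δ l j : ℂ)) * (u l)ᴴ)).trace.re :=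
        Finset.sum_nonneg fun l _ => trace_proj_diag_nonneg P (u l) hP hPP (δ l) (hδ l)
      simp only [hdec]
      rw [Finset.sum_sub_distrib, Finset.sum_add_distrib, ← Finset.mul_sum, hmain, Finset.sum_const,
        Finset.card_univ, Fintype.card_fin, nsmul_eq_mul, hQc]
      have h2 := Int.le_ceil ((N : ℝ) * t)
      have h3 := mul_le_mul_of_nonneg_right h2 hPt
      nlinarith
    have hA := lemA hdr J hJ hJ0 θ hθQ hanti hnul
    have hA' : ((∑ l, ∑ k, θ l (J l k) : ℕ) : ℝ) ≤ ((Q * d : ℕ) : ℝ) := by exact_mod_cast hA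
    push_cast at hA'
    rw [hQc] at hA'
    have h1 : ∑ l, ∑ k, ((N : ℝ) * Λ l (J l k) + (N * C - 1)) ≤ ∑ l, ∑ k, ((θ l (J l k) : ℕ) : ℝ) := by
      refine Finset.sum_le_sum fun l _ => Finset.sum_le_sum fun k _ => ?_
      rw [hθc]
      have := Int.sub_one_lt_floor ((N : ℝ) * Λ l (J l k))
      linarith
    simp only [Finset.sum_add_distrib, ← Finset.mul_sum, Finset.sum_const, Finset.card_univ, Fintype.card_fin,
      nsmul_eq_mul] at h1
    have h2 := Int.ceil_lt_add_one ((N : ℝ) * t)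
    have h3 : (0 : ℝ) ≤ d := Nat.cast_nonneg d
    have h4 := mul_le_mul_of_nonneg_right h2.le h3
    unfold TJ
    nlinarith
  by_contra hlt
  push Not at hlt
  have hpos : 0 < TJ J Λ - d * t := by linarith
  obtain ⟨N, hN⟩ := exists_nat_gt (((d : ℝ) + s * d) / (TJ J Λ - d * t))
  rw [div_lt_iff₀ hpos] at hN
  linarith [key N]

lemma kirwan_trace (Λ : Fin s → Fin r → ℝ) (t : ℝ) (hK : KirwanMem Λ t) : TT Λ = r * t := by
  rw [kirwan_iff] at hK
  obtain ⟨-, u, hu, hsum⟩ := hK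
  have h1 := congrArg (fun M => M.trace.re) hsum
  simp only [Matrix.trace_sum, Complex.re_sum] at h1
  have h4 : ∀ l, (u l * Matrix.diagonal (fun j => (Λ l j : ℂ)) * (u l)ᴴ).trace.re = ∑ k, Λ l k := by
    intro l
    rw [Matrix.mul_assoc, Matrix.trace_mul_comm, Matrix.mul_assoc, unitary_swap (hu l)]
    simp
  simp only [h4] at h1
  rw [TT, h1]
  simp
  ring

lemma main_aux (s : ℕ) (hs : 2 ≤ s) : ∀ r : ℕ, 1 ≤ r → ∀ (Λ : Fin s → Fin r → ℝ) (t : ℝ), (∀ l, Antitone (Λ l)) →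
    (KirwanMem Λ t ↔
      (TT Λ = (r : ℝ) * t ∧
        ∀ (d : ℕ), 1 ≤ d → d < r →
          ∀ J : Fin s → Fin d → Fin r, (∀ l, StrictMono (J l)) →
            KirwanMem (GammaT J) ((r : ℝ) - (d : ℝ)) → TJ J Λ ≤ (d : ℝ) * t)) := by
  intro r
  induction r using Nat.strong_induction_on with
  | _ r ih =>
    intro hr Λ t hΛ
    constructor
    · intro hK
      refine ⟨kirwan_trace Λ t hK, ?_⟩
      intro d hd1 hd2 J hJ hJK
      exact forward hs hd2.le Λ t hK J hJ (kirwan_nul hd2.le J hJ hJK)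
    · rintro ⟨hT, hineq⟩
      by_contra hnot
      obtain ⟨d, hd1, hd2, J, hJ, hJT, hJ0, hJs⟩ := exists_destab Λ hΛ t hT hnot
      have hG : ∀ l k, GammaT J l k = ((GN (J l) k : ℕ) : ℝ) := fun l k => (GN_cast hd2.le (J l) (hJ l) k).symm
      have hsub : ((r - d : ℕ) : ℝ) = (r : ℝ) - d := by rw [Nat.cast_sub hd2.le]
      refine absurd (hineq d hd1 hd2 J hJ ?_) (not_le.2 hJT)
      rw [ih d hd2 hd1 (GammaT J) ((r : ℝ) - d) (by
        intro l i j hij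
        rw [hG, hG]
        exact_mod_cast GN_antitone hd2.le (J l) (hJ l) hij)]
      constructor
      · unfold TT
        simp only [hG]
        rw [← hsub]
        exact_mod_cast hJs
      · intro m hm1 hm2 J' hJ' hK'
        have h1 := kirwan_nul hm2.le J' hJ' hK'
        have h2 := lemA hm2.le J' hJ' h1 (fun l => GN (J l)) (fun l k => GN_le hd2.le (J l) (hJ l) k)
          (fun l => GN_antitone hd2.le (J l) (hJ l)) hJ0
        unfold TJ
        simp only [hG]
        rw [← hsub, mul_comm]
        exact_mod_cast h2

end Main
end Part13

/-- **Inductive description of the Kirwan cone** (Horn's conjecture).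
`(Λ, t) ∈ E(r,s)` lies in `𝒦(r,s)` iff `T(Λ) = r t` and, for every `d ∈ [r-1]`
and every `s`-tuple `𝐉 ∈ Subsets(d,r,s)` with `(Γ(𝐉), r-d) ∈ 𝒦(d,s)`,
`T_𝐉(Λ) ≤ d t`. -/
theorem kirwan_cone_induction (s r : ℕ) (hs : 2 ≤ s) (hr : 1 ≤ r)
    (Λ : Fin s → Fin r → ℝ) (t : ℝ) (hΛ : ∀ l, Antitone (Λ l)) :
    KirwanMem Λ t ↔
      (TT Λ = (r : ℝ) * t ∧
        ∀ (d : ℕ), 1 ≤ d → d < r →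
          ∀ J : Fin s → Fin d → Fin r, (∀ l, StrictMono (J l)) →
            KirwanMem (GammaT J) ((r : ℝ) - (d : ℝ)) → TJ J Λ ≤ (d : ℝ) * t) := by
  exact main_aux s hs r hr Λ t hΛ
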